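/- arXiv:2508.17549 — 2 statements merged into one kernel-verified Lean document; each statement's English description precedes it below -/
import Mathlib

section
/- Let G be a finite simple graph that admits a planar straight-line drawing in ℝ². Let K ⊆ ℝ² be a convex set and let γ : ℝ → ℝ² be continuously differentiable with deriv γ t ≠ 0 for every t, with Set.range γ contained in the frontier of K and with Set.range γ not collinear (¬Collinear ℝ (Set.range γ)). Then G has a planar straight-line drawing f such that, writing D for the union of the images of all vertices together with the closed segments representing all edges, every connected component of the complement ℝ² \ D has nonempty intersection with Set.range γ. (That is, every face of the drawing is crossed by the smooth convex curve.) -/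
open Set

/-- A planar straight-line drawing of a simple graph `G` in the plane:
an injective placement of vertices such that segments representing distinct
edges meet only in images of shared endpoints, and no vertex image lies on
the segment of an edge not incident to it. -/
def IsPlanarDrawing {V : Type*} (G : SimpleGraph V)
    (f : V → EuclideanSpace ℝ (Fin 2)) : Prop :=
  Function.Injective f ∧
  (∀ u v u' v', G.Adj u v → G.Adj u' v' → ({u, v} : Set V) ≠ {u', v'} →
    segment ℝ (f u) (f v) ∩ segment ℝ (f u') (f v') ⊆
      f '' (({u, v} : Set V) ∩ {u', v'})) ∧
  (∀ u v w, G.Adj u v → w ≠ u → w ≠ v → f w ∉ segment ℝ (f u) (f v))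

/-- The union of all vertex images and all closed edge segments of a drawing. -/
def drawingSet {V : Type*} (G : SimpleGraph V)
    (f : V → EuclideanSpace ℝ (Fin 2)) : Set (EuclideanSpace ℝ (Fin 2)) :=
  Set.range f ∪ ⋃ (p : V × V) (_ : G.Adj p.1 p.2), segment ℝ (f p.1) (f p.2)

/-- `Disc n L I E`: a triangulated disc made of `n` triangles, with boundary cycle `L`, interior
vertices `I` and edges `E`. The edge joining the ends of `L` is the root of the disc. -/
inductive Disc {U : Type*} : ℕ → List U → Set U → Set (Sym2 U) → Prop
  | edge {a b : U} (hab : a ≠ b) : Disc 0 [a, b] ∅ {s(a, b)}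
  | split {n₁ n₂ n : ℕ} {L₁ L₂ L : List U} {b w c : U} {I₁ I₂ I : Set U}
      {E₁ E₂ E : Set (Sym2 U)} (h₁ : Disc n₁ (L₁ ++ [w]) I₁ E₁) (h₂ : Disc n₂ (w :: L₂) I₂ E₂)
      (hb : L₁.head? = some b) (hc : L₂.getLast? = some c)
      (hd : ∀ a, a ∈ L₁ ++ [w] ∨ a ∈ I₁ → a ∈ w :: L₂ ∨ a ∈ I₂ → a = w)
      (hn : n = n₁ + n₂ + 1) (hL : L = L₁ ++ w :: L₂) (hI : I = I₁ ∪ I₂)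
      (hE : E = insert s(b, c) (E₁ ∪ E₂)) : Disc n L I E
  | inner {n n' : ℕ} {L : List U} {b w c : U} {I I' : Set U} {E E' : Set (Sym2 U)}
      (h : Disc n (L ++ [w]) I E) (hb : L.head? = some b) (hc : L.getLast? = some c)
      (h3 : 3 ≤ L.length) (hbc : s(b, c) ∉ E) (hn : n' = n + 1) (hI : I' = insert w I)
      (hE : E' = insert s(b, c) E) : Disc n' L I' E'

namespace Disc

variable {U : Type*} {n n' : ℕ} {L : List U} {I I' : Set U} {E E' : Set (Sym2 U)}

theorem two_le_length (h : Disc n L I E) : 2 ≤ L.length := by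
  induction h with
  | edge => simp
  | split h₁ h₂ hb hc hd hn hL hI hE ih₁ ih₂ => subst hL; simp at ih₁ ih₂ ⊢; omega
  | inner => omega

theorem nodup_disjoint (h : Disc n L I E) : L.Nodup ∧ ∀ a ∈ L, a ∉ I := by
  induction h with
  | edge hab => simp [hab]
  | @split n₁ n₂ n L₁ L₂ L b w c I₁ I₂ I E₁ E₂ E h₁ h₂ hb hc hd hn hL hI hE ih₁ ih₂ =>
    subst hL hI
    obtain ⟨a1, a2⟩ := ih₁
    obtain ⟨b1, b2⟩ := ih₂
    rw [List.nodup_append] at a1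
    rw [List.nodup_cons] at b1
    have hw : w ∉ L₁ := fun h => a1.2.2 w h w (by simp) rfl
    refine ⟨?_, ?_⟩
    · rw [List.nodup_append, List.nodup_cons]
      refine ⟨a1.1, b1, ?_⟩
      rintro a ha b hb' rfl
      have := hd a (by simp [ha]) (Or.inl hb')
      exact hw (this ▸ ha)
    · intro a ha
      rw [List.mem_append, List.mem_cons] at ha
      rintro (hi | hi)
      · have h1 := a2 a
        have : a ∈ w :: L₂ := by
          rcases ha with ha | ha | ha
          · exact absurd hi (h1 (by simp [ha]))
          · simp [ha]
          · simp [ha]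
        have := hd a (Or.inr hi) (Or.inl this)
        exact h1 (by simp [this]) hi
      · have h1 := b2 a
        have : a ∈ L₁ ++ [w] := by
          rcases ha with ha | ha | ha
          · simp [ha]
          · simp [ha]
          · exact absurd hi (h1 (by simp [ha]))
        have := hd a (Or.inl this) (Or.inr hi)
        exact h1 (by simp [this]) hi
  | @inner n n' L b w c I I' E E' h hb hc h3 hbc hn hI hE ih =>
    subst hI
    obtain ⟨a1, a2⟩ := ih
    rw [List.nodup_append] at a1
    refine ⟨a1.1, fun a ha => ?_⟩
    rintro (hi | hi)
    · exact a1.2.2 a ha w (by simp) hi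
    · exact a2 a (by simp [ha]) hi

theorem mem_of_head?_getLast? (h : Disc n L I E) {b c : U} (hb : L.head? = some b)
    (hc : L.getLast? = some c) : s(b, c) ∈ E := by
  cases h with
  | edge => simp_all
  | @split n₁ n₂ n L₁ L₂ L b w c I₁ I₂ I E₁ E₂ E h₁ h₂ hb' hc' hd hn hL hI hE =>
    subst hL hE
    have e1 : L₁ ≠ [] := by rintro rfl; simp at hb'
    have e2 : L₂ ≠ [] := by rintro rfl; simp at hc'
    simp [List.head?_append, hb', List.getLast?_append, List.getLast?_cons, hc'] at hb hc
    simp [hb, hc]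
  | inner h hb' hc' h3 hbc hn hI hE =>
    subst hE
    rw [hb'] at hb
    rw [hc'] at hc
    simp_all

/-- Splitting a consecutive pair of `L₁ ++ w :: L₂` between the two parts. -/
theorem consecutive_split {L₁ L₂ P Q : List U} {w x y : U}
    (e : L₁ ++ w :: L₂ = P ++ x :: y :: Q) :
    (∃ R, L₁ ++ [w] = P ++ x :: y :: R ∧ y :: Q = y :: R ++ L₂) ∨
      ∃ R, w :: L₂ = R ++ x :: y :: Q ∧ P ++ [x] = L₁ ++ R ++ [x] := by
  have e' : L₁ ++ w :: L₂ = (P ++ [x]) ++ y :: Q := by rw [e]; simp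
  rcases List.append_eq_append_iff.mp e' with ⟨a, h1, h2⟩ | ⟨a, h1, h2⟩
  · cases a with
    | nil =>
      simp at h1 h2
      refine Or.inl ⟨[], ?_, ?_⟩
      · rw [← h1, h2.1]; simp
      · simp [h2.2]
    | cons w' a =>
      simp only [List.cons_append, List.cons.injEq] at h2
      obtain ⟨rfl, rfl⟩ := h2
      rcases List.eq_nil_or_concat (w :: a) with h3 | ⟨P', x', h3⟩
      · simp at h3
      · rw [List.concat_eq_append] at h3
        have : x' = x := by
          rw [h3, ← List.append_assoc] at h1
          exact ((List.append_inj' h1 rfl).2 |> List.singleton_inj.mp).symm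
        subst this
        refine Or.inr ⟨P', ?_, ?_⟩
        · rw [← List.cons_append, h3]; simp
        · rw [h1, h3]; simp
  · cases a with
    | nil =>
      simp at h1 h2
      refine Or.inl ⟨[], ?_, ?_⟩
      · rw [h1, h2.1]; simp
      · simp [h2.2]
    | cons w' a =>
      simp only [List.cons_append, List.cons.injEq] at h2
      obtain ⟨rfl, rfl⟩ := h2
      refine Or.inl ⟨a ++ [w], ?_, ?_⟩
      · rw [h1]; simp
      · simp

theorem mem_of_consecutive (h : Disc n L I E) :
    ∀ {P Q : List U} {x y : U}, L = P ++ x :: y :: Q → s(x, y) ∈ E := by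
  induction h with
  | @edge a b hab =>
    intro P Q x y e
    match P with
    | [] => simp_all
    | [_] => simp_all
    | _ :: _ :: _ => simp_all
  | @split n₁ n₂ n L₁ L₂ L b w c I₁ I₂ I E₁ E₂ E h₁ h₂ hb hc hd hn hL hI hE ih₁ ih₂ =>
    intro P Q x y e
    subst hE
    rcases consecutive_split (hL.symm.trans e) with ⟨R, h, -⟩ | ⟨R, h, -⟩
    · exact Or.inr (Or.inl (ih₁ h))
    · exact Or.inr (Or.inr (ih₂ h))
  | @inner n n' L b w c I I' E E' h hb hc h3 hbc hn hI hE ih =>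
    intro P Q x y e
    subst hE
    exact Set.mem_insert_of_mem _ (ih (P := P) (Q := Q ++ [w]) (by rw [e]; simp))

theorem mem_of_mem_edge (h : Disc n L I E) :
    ∀ {x y : U}, s(x, y) ∈ E → (x ∈ L ∨ x ∈ I) ∧ (y ∈ L ∨ y ∈ I) := by
  induction h with
  | edge => simp; tauto
  | @split n₁ n₂ n L₁ L₂ L b w c I₁ I₂ I E₁ E₂ E h₁ h₂ hb hc hd hn hL hI hE ih₁ ih₂ =>
    subst hL hI hE
    have e1 := List.mem_of_mem_head? hb
    have e2 := List.mem_of_mem_getLast? hc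
    rintro x y (h | h | h)
    · rw [Sym2.eq_iff] at h
      rcases h with ⟨rfl, rfl⟩ | ⟨rfl, rfl⟩ <;> simp [e1, e2]
    · have := ih₁ h
      simp at this ⊢; tauto
    · have := ih₂ h
      simp at this ⊢; tauto
  | @inner n n' L b w c I I' E E' h hb hc h3 hbc hn hI hE ih =>
    subst hI hE
    have e1 := List.mem_of_mem_head? hb
    have e2 := List.mem_of_mem_getLast? hc
    rintro x y (h | h)
    · rw [Sym2.eq_iff] at h
      rcases h with ⟨rfl, rfl⟩ | ⟨rfl, rfl⟩ <;> simp [e1, e2]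
    · have := ih h
      simp at this ⊢; tauto

theorem eq_of_pair {a b : U} (h : Disc n [a, b] I E) : n = 0 ∧ I = ∅ ∧ E = {s(a, b)} := by
  generalize hL : [a, b] = L at h
  cases h with
  | edge => simp at hL; simp [hL]
  | split h₁ h₂ hb hc hd hn hL' hI hE =>
    have l1 := h₁.two_le_length
    have l2 := h₂.two_le_length
    have := congrArg List.length (hL.trans hL')
    simp at l1 l2 this; omega
  | inner h hb hc h3 =>
    subst hL; simp at h3

theorem head_ne_last (h : Disc n L I E) {b c : U} (hb : L.head? = some b)
    (hc : L.getLast? = some c) : b ≠ c := by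
  rintro rfl
  have h2 := h.two_le_length
  have hn := h.nodup_disjoint.1
  match L, hb with
  | a :: L, hb =>
    simp only [List.head?_cons, Option.some.injEq] at hb
    subst hb
    have : L ≠ [] := by rintro rfl; simp at h2
    obtain ⟨M, z, rfl⟩ := List.eq_nil_or_concat L |>.resolve_left this
    simp [List.getLast?_cons] at hc
    simp [hc] at hn

set_option maxHeartbeats 400000 in
theorem glue (h : Disc n L I E) :
    ∀ {P Q M : List U} {x y : U} {n' : ℕ} {I' : Set U} {E' : Set (Sym2 U)},
      L = P ++ x :: y :: Q → Disc n' (x :: M ++ [y]) I' E' →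
      (∀ a, a ∈ L ∨ a ∈ I → a ∈ x :: M ++ [y] ∨ a ∈ I' → a = x ∨ a = y) →
      Disc (n + n') (P ++ x :: M ++ y :: Q) (I ∪ I') (E ∪ E') := by
  induction h with
  | @edge a b hab =>
    intro P Q M x y n' I' E' e h' hd
    have : P = [] ∧ Q = [] ∧ a = x ∧ b = y := by
      match P with
      | [] => simp_all
      | [_] => simp_all
      | _ :: _ :: _ => simp_all
    obtain ⟨rfl, rfl, rfl, rfl⟩ := this
    have : s(a, b) ∈ E' := h'.mem_of_head?_getLast? (by simp) (by simp [List.getLast?_cons])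
    simpa [this] using h'
  | @split n₁ n₂ n L₁ L₂ L b w c I₁ I₂ I E₁ E₂ E h₁ h₂ hb hc hd hn hL hI hE ih₁ ih₂ =>
    intro P Q M x y n' I' E' e h' hd'
    subst hE hI hn
    rcases consecutive_split (hL.symm.trans e) with ⟨R, h, hQ⟩ | ⟨R, h, hP⟩
    · have g := ih₁ h h' (fun a ha => hd' a (by
        subst hL; simp at ha ⊢; tauto))
      obtain ⟨R', z, hR⟩ := List.eq_nil_or_concat (y :: R) |>.resolve_left (by simp)
      rw [List.concat_eq_append] at hR
      have hh : L₁ = P ++ x :: R' ∧ w = z := by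
        rw [hR] at h
        have := List.append_inj' (s₁ := L₁) (s₂ := P ++ x :: R') (t₁ := [w]) (t₂ := [z])
          (by rw [h]; simp) rfl
        simpa using this
      obtain ⟨h1, rfl⟩ := hh
      have eq : P ++ x :: M ++ y :: R = (P ++ x :: M ++ R') ++ [w] := by
        rw [hR]; simp
      rw [eq] at g
      refine g.split (L₂ := L₂) h₂ (b := b) (c := c) ?_ hc ?_ (by omega) ?_ ?_ ?_
      · rw [← hb, h1]; cases P <;> simp
      · intro a ha hb'
        have h5 := hd' a (by rw [hL]; simp at hb' ⊢; tauto)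
        refine hd a ?_ hb'
        rw [h]
        rw [← eq] at ha
        simp at ha h5 ⊢
        clear ih₁ ih₂ hd hd' g h₁ h₂ h'
        grind
      · rw [hQ, hR]; simp
      · rw [Set.union_right_comm]
      · rw [Set.insert_union, Set.union_right_comm]
    · have g := ih₂ h h' (fun a ha => hd' a (by
        subst hL; simp at ha ⊢; tauto))
      have hP' : P = L₁ ++ R := (List.append_inj' hP rfl).1
      obtain ⟨S, hS, hS'⟩ : ∃ S, R ++ x :: M ++ y :: Q = w :: S ∧ S.getLast? = some c := by
        have hl : L₂ ≠ [] := by rintro rfl; simp at hc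
        have h8 : (y :: Q).getLast? = some c := by
          have := congrArg List.getLast? h
          simp [List.getLast?_append, List.getLast?_cons, hc] at this
          simp [List.getLast?_cons, this]
        cases R with
        | nil =>
          simp at h
          exact ⟨M ++ y :: Q, by simp [h.1], by rw [List.getLast?_append, h8]; rfl⟩
        | cons r R =>
          simp at h
          exact ⟨R ++ x :: M ++ y :: Q, by simp [h.1], by rw [List.getLast?_append, h8]; rfl⟩
      have eq : P ++ x :: M ++ y :: Q = L₁ ++ w :: S := by rw [← hS, hP']; simp
      rw [hS] at g
      refine h₁.split g hb hS' ?_ (by omega) eq ?_ ?_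
      · intro a ha hb'
        have h5 := hd' a (by rw [hL]; simp at ha ⊢; tauto)
        refine hd a ha ?_
        rw [h]
        rw [← hS] at hb'
        simp at hb' h5 ⊢
        clear ih₁ ih₂ hd hd' g h₁ h₂ h'
        grind
      · rw [Set.union_assoc]
      · rw [Set.insert_union, Set.union_assoc]
  | @inner n n' L b w c I J E F h hb hc h3 hbc hn hI hE ih =>
    intro P Q M x y n' I' E' e h' hd'
    subst hE hI hn
    have g := ih (P := P) (Q := Q ++ [w]) (by rw [e]; simp) h'
      (fun a ha => hd' a (by simp at ha ⊢; tauto))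
    have hne : b ≠ c := by
      have : Disc (n + 1) L (insert w I) (insert s(b, c) E) :=
        h.inner hb hc h3 hbc rfl rfl rfl
      exact this.head_ne_last hb hc
    have e1 := List.mem_of_mem_head? hb
    have e2 := List.mem_of_mem_getLast? hc
    rw [show P ++ x :: M ++ y :: (Q ++ [w]) = (P ++ x :: M ++ y :: Q) ++ [w] by simp] at g
    refine g.inner (b := b) (c := c) ?_ ?_ ?_ ?_ (by omega) ?_ ?_
    · rw [← hb, e]; cases P <;> simp
    · rw [← hc, e]; simp [List.getLast?_append, List.getLast?_cons]
    · rw [e] at h3; simp at h3 ⊢; omega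
    · rintro (h9 | h9)
      · exact hbc h9
      · have := h'.mem_of_mem_edge h9
        have k1 := hd' b (Or.inl e1) this.1
        have k2 := hd' c (Or.inl e2) this.2
        have k3 : s(x, y) ∈ E := h.mem_of_consecutive (P := P) (Q := Q ++ [w]) (by rw [e]; simp)
        rcases k1 with rfl | rfl <;> rcases k2 with rfl | rfl
        · exact hne rfl
        · exact hbc k3
        · exact hbc (Sym2.eq_swap ▸ k3)
        · exact hne rfl
    · rw [Set.insert_union]
    · rw [Set.insert_union]

end Disc

namespace Disc

variable {U : Type*} {n n' : ℕ} {L : List U} {I I' : Set U} {E E' : Set (Sym2 U)}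

theorem rotate_step (IH : ∀ m < n, ∀ {x : U} {L : List U} {I : Set U} {E : Set (Sym2 U)},
      Disc m (x :: L) I E → Disc m (L ++ [x]) I E)
    (IH' : ∀ m < n, ∀ {P Q : List U} {p z q : U} {I : Set U} {E : Set (Sym2 U)},
      Disc m (P ++ p :: z :: q :: Q) I E → s(p, q) ∉ E →
      Disc (m + 1) (P ++ p :: q :: Q) (insert z I) (insert s(p, q) E))
    {x : U} (h : Disc n (x :: L) I E) : Disc n (L ++ [x]) I E := by
  generalize hX : x :: L = X at h
  cases h with
  | @edge a b hab =>
    simp at hX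
    obtain ⟨rfl, rfl⟩ := hX
    rw [Sym2.eq_swap]
    exact Disc.edge hab.symm
  | @split n₁ n₂ n L₁ L₂ _ b w c I₁ I₂ I E₁ E₂ E h₁ h₂ hb hc hd hn hL hI hE =>
    obtain ⟨M, rfl⟩ : ∃ M, L₁ = x :: M := by
      cases L₁ with
      | nil => simp at hb
      | cons y M => rw [hL] at hX; simp at hX; exact ⟨M, by rw [hX.1]⟩
    obtain ⟨N, c', rfl⟩ := List.eq_nil_or_concat L₂ |>.resolve_left (by rintro rfl; simp at hc)
    simp at hc hb
    subst hc hb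
    rw [hL] at hX
    simp at hX
    subst hX hE hI hn
    have hx : ∀ a, (a ∈ x :: M ++ [w] ∨ a ∈ I₁) → (a ∈ w :: N.concat c' ∨ a ∈ I₂) → a = w := hd
    have nd₁ := h₁.nodup_disjoint
    have nd₂ := h₂.nodup_disjoint
    have hxw : x ≠ w := h₁.head_ne_last (by simp) (by simp [List.getLast?_cons])
    have hcx : c' ≠ x := fun e =>
      hxw (hx x (by simp) (by simp [e]))
    have T : Disc (n₂ + 0 + 1) (w :: N.concat c' ++ [x]) I₂
        (insert s(w, x) (E₂ ∪ {s(c', x)})) := by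
      have h₂' : Disc n₂ ((w :: N) ++ [c']) I₂ E₂ := by simpa using h₂
      refine h₂'.split (Disc.edge hcx) (b := w) (c := x) (by simp) (by simp) ?_ rfl ?_ ?_ rfl
      · intro a ha hb
        simp at hb
        rcases hb with rfl | rfl
        · rfl
        · exact absurd (hx a (by simp) (by simp at ha ⊢; tauto)) hxw
      · simp
      · simp
    have R := IH n₁ (by omega) h₁
    have g := R.glue (P := M) (Q := []) (x := w) (y := x) (M := N.concat c') (by simp) T (by
      intro a ha hb
      by_cases hax : a = x
      · exact Or.inr hax
      · refine Or.inl (hx a ?_ ?_)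
        · simp at ha ⊢; tauto
        · simp at hb ⊢; tauto)
    have hm : s(w, x) ∈ E₁ := by
      rw [Sym2.eq_swap]; exact h₁.mem_of_head?_getLast? (by simp) (by simp [List.getLast?_cons])
    convert g using 1
    · omega
    · simp
    · ext e
      simp only [Set.mem_insert_iff, Set.mem_union, Set.mem_singleton_iff,
        Sym2.eq_swap (a := x) (b := c')]
      by_cases he : e = s(w, x)
      · subst he; tauto
      · tauto
  | @inner m n L' b w c I I' E E' h hb hc h3 hbc hn hI hE =>
    subst hX hn hI hE
    obtain ⟨N, c', rfl⟩ := List.eq_nil_or_concat L |>.resolve_left (by rintro rfl; simp at h3)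
    simp [List.getLast?_cons] at hc hb
    subst hc hb
    have R := IH m (by omega) (x := x) (L := N.concat c' ++ [w]) (by simpa using h)
    have g := IH' m (by omega) (P := N) (p := c') (z := w) (q := x) (Q := [])
      (by simpa using R) (by rwa [Sym2.eq_swap])
    rw [Sym2.eq_swap] at g
    simpa using g

set_option maxHeartbeats 400000 in
theorem cover_step (IH : ∀ m < n, ∀ {x : U} {L : List U} {I : Set U} {E : Set (Sym2 U)},
      Disc m (x :: L) I E → Disc m (L ++ [x]) I E)
    (IH' : ∀ m < n, ∀ {P Q : List U} {p z q : U} {I : Set U} {E : Set (Sym2 U)},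
      Disc m (P ++ p :: z :: q :: Q) I E → s(p, q) ∉ E →
      Disc (m + 1) (P ++ p :: q :: Q) (insert z I) (insert s(p, q) E))
    {P Q : List U} {p z q : U} (h : Disc n (P ++ p :: z :: q :: Q) I E) (hpq : s(p, q) ∉ E) :
    Disc (n + 1) (P ++ p :: q :: Q) (insert z I) (insert s(p, q) E) := by
  generalize hX : P ++ p :: z :: q :: Q = X at h
  cases h with
  | @edge a b hab =>
    have := congrArg List.length hX
    simp at this; omega
  | @split n₁ n₂ n L₁ L₂ _ b w c I₁ I₂ I E₁ E₂ E h₁ h₂ hb hc hd hn hL hI hE =>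
    subst hE hI hn
    simp only [Set.mem_insert_iff, Set.mem_union, not_or] at hpq
    obtain ⟨hpq0, hpq1, hpq2⟩ := hpq
    rcases consecutive_split (hX.trans hL).symm with ⟨R, h, hQ⟩ | ⟨R, h, hP⟩
    · cases R with
      | cons r R =>
        simp at hQ
        obtain ⟨rfl, hQ⟩ := hQ
        rw [h] at h₁
        have g := IH' n₁ (by omega) h₁ hpq1
        obtain ⟨R', z', hR⟩ := List.eq_nil_or_concat (q :: R) |>.resolve_left (by simp)
        rw [List.concat_eq_append] at hR
        have hh : L₁ = P ++ p :: z :: R' ∧ w = z' := by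
          rw [hR] at h
          have := List.append_inj' (s₁ := L₁) (s₂ := P ++ p :: z :: R') (t₁ := [w]) (t₂ := [z'])
            (by rw [h]; simp) rfl
          simpa using this
        obtain ⟨h1, rfl⟩ := hh
        have eq : P ++ p :: q :: R = (P ++ p :: R') ++ [w] := by
          rw [hR]; simp
        rw [eq] at g
        refine g.split (L₂ := L₂) h₂ (b := b) (c := c) ?_ hc ?_ (by omega) ?_ ?_ ?_
        · rw [← hb, h1]; cases P <;> simp
        · intro a ha hb'
          refine hd a ?_ hb'
          rw [h]
          rw [← eq] at ha
          simp at ha ⊢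
          clear IH IH' hd g h₁ h₂
          grind
        · rw [show q :: Q = (q :: R) ++ L₂ by simp [hQ], hR]; simp
        · rw [Set.insert_union]
        · rw [Set.insert_union, Set.insert_comm]
      | nil =>
        simp at hQ
        have hh : L₁ = P ++ [p] ∧ w = z := by
          have := List.append_inj' (s₁ := L₁) (s₂ := P ++ [p]) (t₁ := [w]) (t₂ := [z])
            (by rw [h]; simp) rfl
          simpa using this
        obtain ⟨rfl, rfl⟩ := hh
        subst hQ
        have R := IH n₂ (by omega) h₂
        have nd₁ := h₁.nodup_disjoint
        have nd₂ := h₂.nodup_disjoint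
        have hw1 : p ≠ w := by
          have := nd₁.1; simp [List.nodup_append] at this; tauto
        have hw2 : w ≠ q ∧ w ∉ Q := by
          have := nd₂.1; simp at this; tauto
        have hqp : p ≠ q := fun e => hw1 (hd p (by simp) (by simp [e]))
        have T : Disc (0 + n₂ + 1) (p :: (q :: Q) ++ [w]) I₂
            (insert s(p, w) ({s(p, q)} ∪ E₂)) := by
          refine (Disc.split (L₁ := [p]) (w := q) (L₂ := Q ++ [w]) (Disc.edge hqp) R
            (b := p) (c := w) (by simp) (by simp) ?_ rfl ?_ ?_ rfl)
          · intro a ha ha'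
            simp at ha
            rcases ha with rfl | rfl
            · exact absurd (hd a (by simp) (by simp at ha' ⊢; tauto)) hw1
            · rfl
          · simp
          · simp
        have g := h₁.glue (P := P) (Q := []) (x := p) (y := w) (M := q :: Q) (by simp) T (by
          intro a ha hb
          by_cases hax : a = p
          · exact Or.inl hax
          · refine Or.inr (hd a ?_ ?_)
            · simp at ha ⊢; tauto
            · simp at hb ⊢; tauto)
        have hm : s(p, w) ∈ E₁ := h₁.mem_of_consecutive (P := P) (Q := []) (by simp)
        rw [show P ++ p :: q :: Q ++ [w] = (P ++ p :: q :: Q) ++ [w] by simp] at g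
        have hbP : b ∈ P ++ [p] := List.mem_of_mem_head? hb
        have hcQ : c ∈ q :: Q := List.mem_of_mem_getLast? hc
        have hbw : b ≠ w := by
          rintro rfl
          have := nd₁.1
          rw [List.nodup_append] at this
          exact this.2.2 b hbP b (by simp) rfl
        have hcw : c ≠ w := by
          rintro rfl
          simp at hcQ; rcases hcQ with rfl | h
          · exact hw2.1 rfl
          · exact hw2.2 h
        have hb' : ¬ (b ∈ w :: q :: Q ∨ b ∈ I₂) := fun h => hbw (hd b (by simp at hbP ⊢; tauto) h)
        have hc' : ¬ (c ∈ P ++ [p] ++ [w] ∨ c ∈ I₁) := fun h =>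
          hcw (hd c h (by simp at hcQ ⊢; tauto))
        refine g.inner (b := b) (c := c) ?_ ?_ ?_ ?_ (by omega) ?_ ?_
        · rw [← hb]; cases P <;> simp
        · rw [← hc]; simp [List.getLast?_append, List.getLast?_cons]
        · have : ¬ (P = [] ∧ Q = []) := by
            rintro ⟨rfl, rfl⟩
            simp at hb hc
            subst hb hc
            exact hpq0 rfl
          simp
          by_contra hlt
          exact this ⟨List.length_eq_zero_iff.mp (by omega), List.length_eq_zero_iff.mp (by omega)⟩
        · rintro (h | h | h | h)
          · exact hc' (h₁.mem_of_mem_edge h).2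
          · rw [Sym2.eq_iff] at h; tauto
          · exact hpq0 h.symm
          · exact hb' (h₂.mem_of_mem_edge h).1
        · rfl
        · ext e
          simp only [Set.mem_insert_iff, Set.mem_union, Set.mem_singleton_iff]
          by_cases he : e = s(p, w)
          · subst he; tauto
          · tauto
    · have hP' : P = L₁ ++ R := (List.append_inj' hP rfl).1
      rw [h] at h₂
      have g := IH' n₂ (by omega) h₂ hpq2
      obtain ⟨S, hS, hS'⟩ : ∃ S, R ++ p :: q :: Q = w :: S ∧ S.getLast? = some c := by
        have hl : L₂ ≠ [] := by rintro rfl; simp at hc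
        have h8 : (q :: Q).getLast? = some c := by
          have := congrArg List.getLast? h
          simp [List.getLast?_append, List.getLast?_cons, hc] at this
          simp [List.getLast?_cons, this]
        cases R with
        | nil =>
          simp at h
          exact ⟨q :: Q, by simp [h.1], h8⟩
        | cons r R =>
          simp at h
          exact ⟨R ++ p :: q :: Q, by simp [h.1], by
            rw [List.getLast?_append, List.getLast?_cons_cons, h8]; rfl⟩
      rw [hS] at g
      refine h₁.split g hb hS' ?_ (by omega) ?_ ?_ ?_
      · intro a ha hb'
        refine hd a ha ?_
        rw [h]
        rw [← hS] at hb'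
        simp at hb' ⊢
        clear IH IH' hd g h₁ h₂
        grind
      · rw [← hS, hP']; simp
      · rw [Set.union_insert]
      · rw [Set.union_insert, Set.insert_comm]
  | @inner m n L' b w c I I' E E' h hb hc h3 hbc hn hI hE =>
    subst hX hn hI hE
    simp only [Set.mem_insert_iff, not_or] at hpq
    have g := IH' m (by omega) (P := P) (p := p) (z := z) (q := q) (Q := Q ++ [w])
      (by simpa using h) hpq.2
    rw [show P ++ p :: q :: (Q ++ [w]) = (P ++ p :: q :: Q) ++ [w] by simp] at g
    refine g.inner (b := b) (c := c) ?_ ?_ ?_ ?_ rfl ?_ ?_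
    · rw [← hb]; cases P <;> simp
    · rw [← hc]; simp [List.getLast?_append, List.getLast?_cons]
    · have : ¬ (P = [] ∧ Q = []) := by
        rintro ⟨rfl, rfl⟩
        simp at hb hc
        subst hb hc
        exact hpq.1 rfl
      simp
      by_contra hlt
      exact this ⟨List.length_eq_zero_iff.mp (by omega), List.length_eq_zero_iff.mp (by omega)⟩
    · rintro (h | h)
      · exact hpq.1 h.symm
      · exact hbc h
    · rw [Set.insert_comm]
    · rw [Set.insert_comm]

theorem rotate_and_cover (n : ℕ) :
    (∀ {x : U} {L : List U} {I : Set U} {E : Set (Sym2 U)},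
      Disc n (x :: L) I E → Disc n (L ++ [x]) I E) ∧
    ∀ {P Q : List U} {p z q : U} {I : Set U} {E : Set (Sym2 U)},
      Disc n (P ++ p :: z :: q :: Q) I E → s(p, q) ∉ E →
      Disc (n + 1) (P ++ p :: q :: Q) (insert z I) (insert s(p, q) E) := by
  induction n using Nat.strong_induction_on with
  | _ n ih =>
    exact ⟨fun h => rotate_step (fun m hm => (ih m hm).1) (fun m hm => (ih m hm).2) h,
      fun h => cover_step (fun m hm => (ih m hm).1) (fun m hm => (ih m hm).2) h⟩

/-- The root of a disc can be moved to any boundary edge. -/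
theorem rotate {A B : List U} (h : Disc n (A ++ B) I E) : Disc n (B ++ A) I E := by
  induction A generalizing B with
  | nil => simpa using h
  | cons a A ih =>
    have := ih (B := B ++ [a]) (by simpa using (rotate_and_cover n).1 h)
    simpa using this

theorem cover {P Q : List U} {p z q : U} (h : Disc n (P ++ p :: z :: q :: Q) I E)
    (hpq : s(p, q) ∉ E) :
    Disc (n + 1) (P ++ p :: q :: Q) (insert z I) (insert s(p, q) E) :=
  (rotate_and_cover n).2 h hpq

theorem insert_vertex {P Q : List U} {p z q : U} (h : Disc n (P ++ p :: q :: Q) I E)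
    (hz : z ∉ P ++ p :: q :: Q) (hzI : z ∉ I) :
    Disc (n + 1) (P ++ p :: z :: q :: Q) I (insert s(p, z) (insert s(z, q) E)) := by
  have hpz : p ≠ z := by rintro rfl; simp at hz
  have hqz : z ≠ q := by rintro rfl; simp at hz
  have hpq : p ≠ q := by
    have := h.nodup_disjoint.1; simp [List.nodup_append] at this; tauto
  have T : Disc 1 (p :: [z] ++ [q]) ∅ (insert s(p, q) ({s(p, z)} ∪ {s(z, q)})) :=
    (Disc.split (L₁ := [p]) (w := z) (L₂ := [q]) (Disc.edge hpz) (Disc.edge hqz)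
      (b := p) (c := q) (by simp) (by simp) (by
        intro a ha hb
        simp at ha hb
        rcases ha with rfl | rfl
        · tauto
        · rfl) rfl (by simp) (by simp) rfl)
  have g := h.glue rfl T (by
    intro a ha hb
    simp at hb
    rcases hb with rfl | rfl | rfl
    · simp
    · exact absurd ha (by rintro (h | h); exacts [hz h, hzI h])
    · simp)
  have hm : s(p, q) ∈ E := h.mem_of_consecutive rfl
  convert g using 1
  · simp
  · simp
  · ext e
    simp only [Set.mem_insert_iff, Set.mem_union, Set.mem_singleton_iff]
    by_cases he : e = s(p, q)
    · subst he; tauto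
    · tauto

end Disc

/-- `Peel L I E`: the polygon `L` with interior vertices `I` and edges `E` can be decomposed by
repeatedly either cutting along a chord at the second vertex of the boundary or removing that
vertex together with the fan of triangles around it. -/
inductive Peel {U : Type*} : List U → Set U → Set (Sym2 U) → Prop
  | edge {b c : U} (h : b ≠ c) : Peel [b, c] ∅ {s(b, c)}
  | chord {b v x : U} {A B L : List U} {I₁ I₂ I : Set U} {E₁ E₂ E : Set (Sym2 U)}
      (h₁ : Peel (v :: A ++ [x]) I₁ E₁) (h₂ : Peel (b :: v :: x :: B) I₂ E₂) (hA : A ≠ [])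
      (hd : ∀ a, a ∈ v :: A ++ [x] ∨ a ∈ I₁ → a ∈ b :: v :: x :: B ∨ a ∈ I₂ → a = v ∨ a = x)
      (m₁ : s(v, x) ∈ E₁) (m₂ : s(v, x) ∈ E₂) (hL : L = b :: v :: A ++ x :: B)
      (hI : I = I₁ ∪ I₂) (hE : E = E₁ ∪ E₂) : Peel L I E
  | corner {b v x : U} {Z X L : List U} {I I' : Set U} {E E' : Set (Sym2 U)}
      (h : Peel (b :: Z ++ x :: X) I E) (hv : v ∉ b :: Z ++ x :: X) (hvI : v ∉ I)
      (hL : L = b :: v :: x :: X) (hI : I' = I ∪ {z | z ∈ Z})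
      (hE : E' = E ∪ {e | ∃ y ∈ b :: Z ++ [x], e = s(v, y)}) : Peel L I' E'

namespace Disc

variable {U : Type*} {n n' : ℕ} {L : List U} {I I' : Set U} {E E' : Set (Sym2 U)}

theorem pos_of_three_le (h : Disc n L I E) (h3 : 3 ≤ L.length) : 0 < n := by
  cases h <;> simp_all

theorem chord_or_fan (h : Disc n L I E) :
    ∀ {v : U} {Y : List U}, L = v :: Y → 2 ≤ Y.length →
      (∃ A x B n₁ n₂ I₁ I₂ E₁ E₂, Y = A ++ x :: B ∧ A ≠ [] ∧ B ≠ [] ∧ n₁ < n ∧ n₂ < n ∧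
        Disc n₁ (v :: A ++ [x]) I₁ E₁ ∧ Disc n₂ (v :: x :: B) I₂ E₂ ∧
        (∀ a, a ∈ v :: A ++ [x] ∨ a ∈ I₁ → a ∈ v :: x :: B ∨ a ∈ I₂ → a = v ∨ a = x) ∧
        I = I₁ ∪ I₂ ∧ E = E₁ ∪ E₂) ∨
      ∃ Z n' I' E', n' < n ∧ Disc n' (Y ++ Z) I' E' ∧ v ∉ Y ++ Z ∧ v ∉ I' ∧
        I = I' ∪ {z | z ∈ Z} ∧
        E = E' ∪ {e | ∃ y, (y ∈ Z ∨ Y.head? = some y ∨ Y.getLast? = some y) ∧ e = s(v, y)} := by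
  induction h with
  | @edge a b hab =>
    intro v Y hY h2
    have := congrArg List.length hY
    simp at this; omega
  | @split n₁ n₂ n L₁ L₂ L b w c I₁ I₂ I E₁ E₂ E h₁ h₂ hb hc hd hn hL hI hE ih₁ ih₂ =>
    intro v Y hY h2
    clear ih₁ ih₂
    subst hL hI hE hn
    obtain ⟨M, rfl⟩ : ∃ M, L₁ = v :: M := by
      cases L₁ with
      | nil => simp at hb
      | cons y M => simp at hY; exact ⟨M, by rw [hY.1]⟩
    simp at hb hY
    subst hb hY
    have hvw : v ≠ w := h₁.head_ne_last (by simp) (by simp [List.getLast?_cons])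
    have hv2 : ∀ h : v ∈ w :: L₂ ∨ v ∈ I₂, False := fun h => hvw (hd v (by simp) h)
    have m₁ : s(v, w) ∈ E₁ :=
      h₁.mem_of_head?_getLast? (by simp) (by simp [List.getLast?_cons])
    rcases List.eq_nil_or_concat M with rfl | hM
    · obtain ⟨rfl, rfl, rfl⟩ := h₁.eq_of_pair
      refine Or.inr ⟨[], n₂, I₂, E₂, by omega, by simpa using h₂, ?_, ?_, ?_, ?_⟩
      · intro h; exact hv2 (Or.inl (by simpa using h))
      · intro h; exact hv2 (Or.inr (by simpa using h))
      · simp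
      · ext e
        simp only [Set.mem_insert_iff, Set.mem_union, Set.mem_singleton_iff, Set.mem_ofPred_eq]
        have : ([] ++ w :: L₂).getLast? = some c := by simp [List.getLast?_cons, hc]
        rw [this]
        constructor
        · rintro (rfl | rfl | h)
          · exact Or.inr ⟨c, by simp⟩
          · exact Or.inr ⟨w, by simp⟩
          · exact Or.inl h
        · rintro (h | ⟨y, h, rfl⟩)
          · tauto
          · simp at h
            rcases h with rfl | rfl <;> simp
    · have hM : M ≠ [] := by rintro rfl; simp at hM
      have hL₂ : L₂ ≠ [] := by rintro rfl; simp at hc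
      have hp : 0 < n₁ := h₁.pos_of_three_le (by
        have := List.length_pos_iff.mpr hM; simp; omega)
      have T : Disc (0 + n₂ + 1) (v :: w :: L₂) I₂ (insert s(v, c) ({s(v, w)} ∪ E₂)) := by
        refine Disc.split (L₁ := [v]) (Disc.edge hvw) h₂ (by simp) hc ?_ rfl (by simp) (by simp) rfl
        intro a ha hb
        simp at ha
        rcases ha with rfl | rfl
        · exact (hv2 hb).elim
        · rfl
      refine Or.inl ⟨M, w, L₂, n₁, 0 + n₂ + 1, I₁, I₂, E₁, _, rfl, hM, hL₂, by omega, by omega,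
        h₁, T, ?_, rfl, ?_⟩
      · intro a ha hb
        by_cases hav : a = v
        · exact Or.inl hav
        · refine Or.inr (hd a ha ?_)
          simpa [hav] using hb
      · ext e
        simp only [Set.mem_insert_iff, Set.mem_union, Set.mem_singleton_iff]
        by_cases he : e = s(v, w)
        · subst he; tauto
        · tauto
  | @inner m n L' b z c I I' E E' h hb hc h3 hbc hn hI hE ih =>
    intro v Y hY h2
    subst hY hn hI hE
    simp at hb
    subst hb
    have hY : Y ≠ [] := by rintro rfl; simp at h2
    have hcY : Y.getLast? = some c := by
      obtain ⟨Y', y, rfl⟩ := List.eq_nil_or_concat Y |>.resolve_left hY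
      simpa [List.getLast?_cons] using hc
    rcases ih (v := v) (Y := Y ++ [z]) (by simp) (by simp; omega) with
      ⟨A, x, B, n₁, n₂, I₁, I₂, E₁, E₂, hYz, hA, hB, hn₁, hn₂, h₁, h₂, hd, rfl, rfl⟩ |
      ⟨Z, n', I', E', hn, hZ, hv, hvI, rfl, rfl⟩
    · left
      obtain ⟨B', z', rfl⟩ := List.eq_nil_or_concat B |>.resolve_left hB
      have e := List.append_inj' (s₁ := Y) (s₂ := A ++ x :: B') (t₁ := [z]) (t₂ := [z'])
        (by rw [hYz]; simp) rfl
      simp at e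
      obtain ⟨rfl, rfl⟩ := e
      have hB' : B' ≠ [] := by
        rintro rfl
        simp at hcY
        subst hcY
        exact hbc (Or.inr (h₂.mem_of_consecutive (P := []) rfl))
      have T : Disc (n₂ + 1) (v :: x :: B') (insert z I₂) (insert s(v, c) E₂) := by
        rw [List.concat_eq_append] at h₂
        refine Disc.inner (L := v :: x :: B') (by simpa using h₂) (by simp) ?_ ?_ ?_ rfl rfl rfl
        · rw [List.getLast?_append] at hcY
          simpa [List.getLast?_cons] using hcY
        · have := List.length_pos_iff.mpr hB'; simp; omega
        · exact fun h => hbc (Or.inr h)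
      refine ⟨A, x, B', n₁, n₂ + 1, I₁, _, E₁, _, rfl, hA, hB', by omega, by omega, h₁, T, ?_,
        ?_, ?_⟩
      · intro a ha hb
        refine hd a ha ?_
        simp at hb ⊢
        tauto
      · rw [Set.union_insert]
      · rw [Set.union_insert]
    · right
      refine ⟨z :: Z, n', I', E', by omega, by simpa using hZ, by simpa using hv, hvI, ?_, ?_⟩
      · ext a; simp; tauto
      · have : (Y ++ [z]).head? = Y.head? := by cases Y <;> simp_all
        rw [this]
        ext e
        simp only [Set.mem_insert_iff, Set.mem_union, Set.mem_ofPred_eq, hcY,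
          List.getLast?_append, List.getLast?_singleton, Option.or_some, Option.some.injEq,
          List.mem_cons]
        constructor
        · rintro (rfl | h | ⟨y, h, rfl⟩)
          · exact Or.inr ⟨c, by simp⟩
          · exact Or.inl h
          · refine Or.inr ⟨y, ?_, rfl⟩
            simp at h
            tauto
        · rintro (h | ⟨y, h, rfl⟩)
          · exact Or.inr (Or.inl h)
          · rcases h with (rfl | h) | h | h
            · exact Or.inr (Or.inr ⟨y, by simp⟩)
            · exact Or.inr (Or.inr ⟨y, by tauto⟩)
            · exact Or.inr (Or.inr ⟨y, by tauto⟩)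
            · subst h; exact Or.inl rfl

theorem peel (h : Disc n L I E) : Peel L I E := by
  induction n using Nat.strong_induction_on generalizing L I E with
  | _ n IH =>
    match L, h, h.two_le_length with
    | [b, c], h, _ =>
      have hbc : b ≠ c := h.head_ne_last (by simp) (by simp)
      obtain ⟨rfl, rfl, rfl⟩ := h.eq_of_pair
      exact Peel.edge hbc
    | b :: v :: x' :: X', h, _ =>
      have h' : Disc n (v :: (x' :: X' ++ [b])) I E := by
        simpa using h.rotate (A := [b]) (B := v :: x' :: X')
      rcases h'.chord_or_fan rfl (by simp) with
        ⟨A, x, B, n₁, n₂, I₁, I₂, E₁, E₂, hY, hA, hB, hn₁, hn₂, h₁, h₂, hd, rfl, rfl⟩ |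
        ⟨Z, n', I', E', hn, hZ, hv, hvI, rfl, rfl⟩
      · obtain ⟨B', z', rfl⟩ := List.eq_nil_or_concat B |>.resolve_left hB
        have e := List.append_inj' (s₁ := x' :: X') (s₂ := A ++ x :: B') (t₁ := [b]) (t₂ := [z'])
          (by rw [hY]; simp) rfl
        simp at e
        obtain ⟨e, rfl⟩ := e
        have m₁ : s(v, x) ∈ E₁ :=
          h₁.mem_of_head?_getLast? (by simp) (by simp [List.getLast?_cons])
        have m₂ : s(v, x) ∈ E₂ := h₂.mem_of_consecutive (P := []) rfl
        have h₂' : Disc n₂ (b :: v :: x :: B') I₂ E₂ := by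
          simpa using Disc.rotate (A := v :: x :: B') (B := [b]) (by simpa using h₂)
        refine Peel.chord (IH _ hn₁ h₁) (IH _ hn₂ h₂') hA ?_ m₁ m₂ ?_ rfl rfl
        · intro a ha hb
          refine hd a ha ?_
          simp at hb ⊢
          tauto
        · simp [e]
      · have hZ' : Disc n' (b :: Z ++ x' :: X') I' E' := by
          simpa using Disc.rotate (A := x' :: X') (B := b :: Z) (by simpa using hZ)
        refine Peel.corner (IH _ hn hZ') (v := v) ?_ hvI rfl rfl ?_
        · intro h; apply hv; simp at h ⊢; tauto
        · congr 1
          ext e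
          simp only [Set.mem_ofPred_eq, List.cons_append, List.mem_cons, List.mem_append,
            List.not_mem_nil, or_false, List.head?_cons, Option.some.injEq]
          have : (x' :: (X' ++ [b])).getLast? = some b := by simp [List.getLast?_cons]
          rw [this]
          constructor
          · rintro ⟨y, h, rfl⟩
            refine ⟨y, ?_, rfl⟩
            simp at h
            tauto
          · rintro ⟨y, h, rfl⟩
            refine ⟨y, ?_, rfl⟩
            simp
            tauto

end Disc

section Sweep

variable {V : Type*}

/-- The height over `x` of the segment joining the vertices of the pair `p`, which lie at abscissae
`X` and heights `Y`. -/
noncomputable def segmentHeight (X Y : V → ℝ) (p : V × V) (x : ℝ) : ℝ :=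
  Y p.1 + (Y p.2 - Y p.1) * ((x - X p.1) / (X p.2 - X p.1))

/-- The vertices of `G`, seen as degenerate pairs, and the edges of `G`, oriented rightwards. -/
def IsCell (G : SimpleGraph V) (X : V → ℝ) (p : V × V) : Prop :=
  p.1 = p.2 ∨ G.Adj p.1 p.2 ∧ X p.1 < X p.2

/-- The cell `p` has to be swept before the cell `q`. -/
def Precedes (X Y : V → ℝ) (p q : V × V) : Prop :=
  (∃ x, X p.1 ≤ x ∧ x ≤ X p.2 ∧ X q.1 ≤ x ∧ x ≤ X q.2 ∧
    segmentHeight X Y p x < segmentHeight X Y q x) ∨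
  p.1 = p.2 ∧ q.1 ≠ q.2 ∧ (p.1 = q.1 ∨ p.1 = q.2)

/-- Cells meet at endpoints only. -/
def NonCrossing (G : SimpleGraph V) (X Y : V → ℝ) : Prop :=
  ∀ p q, IsCell G X p → IsCell G X q → p ≠ q → ∀ x, X p.1 ≤ x → x ≤ X p.2 → X q.1 ≤ x →
    x ≤ X q.2 → segmentHeight X Y p x = segmentHeight X Y q x → x = X p.1 ∨ x = X p.2

theorem segmentHeight_left (X Y : V → ℝ) (p : V × V) : segmentHeight X Y p (X p.1) = Y p.1 := by
  simp [segmentHeight]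

theorem segmentHeight_right (X Y : V → ℝ) {p : V × V} (h : p.1 = p.2 ∨ X p.1 < X p.2) :
    segmentHeight X Y p (X p.2) = Y p.2 := by
  rcases h with h | h
  · simp [segmentHeight, h]
  · rw [segmentHeight, div_self (by linarith)]; ring

theorem IsCell.le {G : SimpleGraph V} {X : V → ℝ} {p : V × V} (h : IsCell G X p) :
    X p.1 ≤ X p.2 := by
  rcases h with h | h
  · rw [h]
  · exact h.2.le

theorem segmentHeight_crossing {X Y : V → ℝ} (p q : V × V) {x₀ x₁ : ℝ} (h : x₀ < x₁)
    (h₀ : segmentHeight X Y q x₀ < segmentHeight X Y p x₀)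
    (h₁ : segmentHeight X Y p x₁ < segmentHeight X Y q x₁) :
    ∃ x, x₀ < x ∧ x < x₁ ∧ segmentHeight X Y p x = segmentHeight X Y q x := by
  have hc : ContinuousOn (fun x => segmentHeight X Y p x - segmentHeight X Y q x)
      (Set.Icc x₀ x₁) := by
    unfold segmentHeight; fun_prop
  obtain ⟨x, hx, e⟩ := intermediate_value_Ioo' h.le hc
    (show (0 : ℝ) ∈ Set.Ioo _ _ from ⟨by simp; linarith, by simp; linarith⟩)
  exact ⟨x, hx.1, hx.2, by simp at e; linarith⟩

/-- Every nonempty finite set of cells contains one that can be swept first. -/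
theorem exists_first_cell {G : SimpleGraph V} {X Y : V → ℝ} (hX : Function.Injective X)
    (hNC : NonCrossing G X Y) {S : Set (V × V)} (hS : S.Finite) (hne : S.Nonempty)
    (hcell : ∀ p ∈ S, IsCell G X p) : ∃ p ∈ S, ∀ q ∈ S, ¬ Precedes X Y q p := by
  -- `T` consists of the cells whose left end is visible from below
  let T : Set (V × V) := {p ∈ S | ∀ q ∈ S, X q.1 ≤ X p.1 → X p.1 ≤ X q.2 →
    Y p.1 ≤ segmentHeight X Y q (X p.1)}
  have hTS : T ⊆ S := fun p hp => hp.1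
  have hT : T.Nonempty := by
    obtain ⟨p, hp, hmin⟩ := Set.exists_min_image S (fun p => X p.1) hS hne
    refine ⟨p, hp, fun q hq h _ => ?_⟩
    have : p.1 = q.1 := hX (le_antisymm (hmin q hq) h)
    rw [this, segmentHeight_left]
  obtain ⟨m, hm, hmax⟩ := Set.exists_max_image T (fun p => X p.1) (hS.subset hTS) hT
  let T' : Set (V × V) := {p ∈ T | p.1 = m.1}
  have hT'S : T'.Finite := hS.subset fun p hp => hTS hp.1
  obtain ⟨A, hAT', hA⟩ : ∃ A ∈ T', ∀ B ∈ T', B.1 = B.2 → A.1 = A.2 := by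
    by_cases h : ∃ A ∈ T', A.1 = A.2
    · obtain ⟨A, hA, h⟩ := h
      exact ⟨A, hA, fun _ _ _ => h⟩
    · push Not at h
      exact ⟨m, ⟨hm, rfl⟩, fun B hB e => absurd e (h B hB)⟩
  obtain ⟨A, hAT', hA, hslope⟩ : ∃ A ∈ T', (∀ B ∈ T', B.1 = B.2 → A.1 = A.2) ∧
      (A.1 ≠ A.2 → ∀ B ∈ T', (Y A.2 - Y A.1) / (X A.2 - X A.1) ≤
        (Y B.2 - Y B.1) / (X B.2 - X B.1)) := by
    by_cases hv : A.1 = A.2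
    · exact ⟨A, hAT', hA, fun h => absurd hv h⟩
    · obtain ⟨B, hB, hmin⟩ := Set.exists_min_image T'
        (fun p => (Y p.2 - Y p.1) / (X p.2 - X p.1)) hT'S ⟨A, hAT'⟩
      exact ⟨B, hB, fun C hC e => absurd (hA C hC e) hv, fun _ => hmin⟩
  have hAm : A.1 = m.1 := hAT'.2
  have hAS : A ∈ S := hTS hAT'.1
  have hAvis := hAT'.1.2
  refine ⟨A, hAS, ?_⟩
  by_contra! hex
  obtain ⟨B, ⟨hBS, hBA⟩, hBmin⟩ := Set.exists_min_image {q ∈ S | Precedes X Y q A} (fun p => X p.1)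
    (hS.subset fun p hp => hp.1) hex
  have hcA := hcell A hAS
  have hcB := hcell B hBS
  have hne : B ≠ A := by
    rintro rfl
    rcases hBA with ⟨x, -, -, -, -, h⟩ | ⟨h, h', -⟩
    · exact lt_irrefl _ h
    · exact h' h
  rcases lt_trichotomy (X B.1) (X A.1) with hlt | heq | hgt
  · rcases hBA with ⟨x, h1, h2, h3, h4, h⟩ | ⟨h, h', h'' | h''⟩
    · have hv := hAvis B hBS hlt.le (h3.trans h2)
      have hxA : X A.1 < x := by
        refine lt_of_le_of_ne h3 ?_
        rintro rfl
        rw [segmentHeight_left] at h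
        linarith
      rw [← segmentHeight_left X Y A] at hv
      rcases hv.lt_or_eq with hv | hv
      · obtain ⟨y, hy1, hy2, e⟩ := segmentHeight_crossing B A hxA hv h
        rcases hNC A B hcA hcB hne.symm y hy1.le (by linarith) (by linarith) (by linarith) e.symm
          with h | h <;> linarith
      · rcases hNC B A hcB hcA hne (X A.1) hlt.le (by linarith) le_rfl (by linarith) hv.symm
          with h | h <;> linarith
    · rw [h''] at hlt; exact lt_irrefl _ hlt
    · have := hcA.le
      rw [h''] at hlt; linarith
  · have e := hX heq
    have hBT' : B ∈ T' := by
      refine ⟨⟨hBS, ?_⟩, e.trans hAm⟩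
      rw [e]; exact hAvis
    rcases hBA with ⟨x, h1, h2, h3, h4, h⟩ | ⟨h, h', -⟩
    · have hxA : X A.1 < x := by
        refine lt_of_le_of_ne h3 ?_
        rintro rfl
        rw [segmentHeight_left, ← e, segmentHeight_left] at h
        exact lt_irrefl _ h
      have hAne : A.1 ≠ A.2 := by intro h; rw [← h] at h4; linarith
      have := hslope hAne B hBT'
      rw [segmentHeight, segmentHeight, e, mul_div_assoc', mul_div_assoc', mul_div_right_comm,
        mul_div_right_comm] at h
      rw [e] at this
      nlinarith
    · exact h' (hA B hBT' h)
  · have hBA' : X B.1 ≤ X A.2 ∧ segmentHeight X Y B (X B.1) ≤ segmentHeight X Y A (X B.1) := by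
      rcases hBA with ⟨x, h1, h2, h3, h4, h⟩ | ⟨h, h', h'' | h''⟩
      · refine ⟨by linarith, ?_⟩
        by_contra! hlt
        have hxB : X B.1 < x := lt_of_le_of_ne h1 (by rintro rfl; linarith)
        obtain ⟨y, hy1, hy2, e⟩ := segmentHeight_crossing B A hxB hlt h
        rcases hNC A B hcA hcB hne.symm y (by linarith) (by linarith) (by linarith) (by linarith)
          e.symm with h | h <;> linarith
      · rw [h''] at hgt; exact absurd hgt (lt_irrefl _)
      · refine ⟨by rw [h''], ?_⟩
        rw [segmentHeight_left, h'', segmentHeight_right]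
        exact hcA.imp_right And.right
    have hBT : B ∉ T := fun h => by
      have := hmax B h
      rw [← hAm] at this
      linarith
    have : ∃ C ∈ S, X C.1 ≤ X B.1 ∧ X B.1 ≤ X C.2 ∧ segmentHeight X Y C (X B.1) < Y B.1 := by
      by_contra! h
      exact hBT ⟨hBS, h⟩
    obtain ⟨C, hCS, h1, h2, h3⟩ := this
    have hle := hBmin C ⟨hCS, Or.inl ⟨X B.1, h1, h2, hgt.le, hBA'.1, by
      have := hBA'.2
      rw [segmentHeight_left] at this
      linarith⟩⟩
    have e := hX (le_antisymm h1 hle)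
    rw [← e, segmentHeight_left] at h3
    exact lt_irrefl _ h3

theorem Disc.cover_list {U : Type*} {d v : U} {P Q : List U} :
    ∀ {N : List U} {z : U} {n : ℕ} {I : Set U} {E : Set (Sym2 U)},
      Disc n (P ++ d :: z :: N ++ v :: Q) I E → (∀ y ∈ N ++ [v], s(d, y) ∉ E) →
      ∃ n' E', Disc n' (P ++ d :: v :: Q) (I ∪ {y | y ∈ z :: N}) E' ∧ E ⊆ E' ∧
        ∀ e ∈ E', e ∈ E ∨ d ∈ e := by
  intro N
  induction N with
  | nil =>
    intro z n I E h hd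
    have g := Disc.cover (P := P) (Q := Q) (p := d) (z := z) (q := v) (by simpa using h)
      (hd v (by simp))
    refine ⟨n + 1, insert s(d, v) E, ?_, Set.subset_insert s(d, v) E, ?_⟩
    · convert g using 1
      ext; simp
    · rintro e (rfl | he)
      · simp
      · exact Or.inl he
  | cons z' N ih =>
    intro z n I E h hd
    have g := Disc.cover (P := P) (Q := N ++ v :: Q) (p := d) (z := z) (q := z') (by simpa using h)
      (hd z' (by simp))
    have hnd := g.nodup_disjoint.1
    obtain ⟨n', E', h', hE, hE'⟩ := ih (z := z') (by simpa using g) (by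
      rintro y hy (he | he)
      · have : y = z' := by
          rw [Sym2.eq_iff] at he
          rcases he with ⟨-, h⟩ | ⟨h1, h2⟩
          · exact h
          · rw [h2, h1]
        subst this
        simp [List.nodup_append] at hnd hy
        tauto
      · exact hd y (by simp at hy ⊢; tauto) he)
    refine ⟨n', E', ?_, (Set.subset_insert _ _).trans hE, ?_⟩
    · convert h' using 1
      ext; simp; tauto
    · intro e he
      rcases hE' e he with (rfl | h) | h
      · simp
      · exact Or.inl h
      · exact Or.inr h

/-- A sweep line invariant: the cells in `S` have been swept, producing a disc whose boundary is
the upper envelope `M`. -/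
structure Swept (G : SimpleGraph V) (X Y : V → ℝ) (S : Set (V × V)) (M : List V)
    (I : Set (V ⊕ ℕ)) (E : Set (Sym2 (V ⊕ ℕ))) : Prop where
  disc : ∃ n, Disc n (Sum.inr 0 :: M.map Sum.inl ++ [Sum.inr 1]) I E
  sorted : M.Pairwise fun a b => X a < X b
  cell : ∀ p ∈ S, IsCell G X p
  closed : ∀ p ∈ S, ∀ q, IsCell G X q → Precedes X Y q p → q ∈ S
  vertex : ∀ w, (w, w) ∈ S ↔ w ∈ M ∨ Sum.inl w ∈ I
  covered : ∀ w, (w, w) ∈ S → w ∉ M → ∃ p ∈ S, X p.1 ≤ X w ∧ X w ≤ X p.2 ∧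
    Y w < segmentHeight X Y p (X w)
  edge : ∀ p ∈ S, p.1 ≠ p.2 → s(Sum.inl p.1, Sum.inl p.2) ∈ E
  fresh : ∃ N, 2 ≤ N ∧ ∀ k, N ≤ k → Sum.inr k ∉ I

theorem Swept.initial (G : SimpleGraph V) (X Y : V → ℝ) :
    Swept G X Y ∅ [] ∅ {s(Sum.inr 0, Sum.inr 1)} where
  disc := ⟨0, Disc.edge (by simp)⟩
  sorted := List.Pairwise.nil
  cell := by simp
  closed := by simp
  vertex := by simp
  covered := by simp
  edge := by simp
  fresh := ⟨2, le_rfl, by simp⟩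

theorem exists_split_of_pairwise {X : V → ℝ} (hX : Function.Injective X) {w : V} :
    ∀ {M : List V}, (M.Pairwise fun a b => X a < X b) → w ∉ M →
    ∃ A B, M = A ++ B ∧ (∀ a ∈ A, X a < X w) ∧ ∀ b ∈ B, X w < X b := by
  intro M
  induction M with
  | nil => intro _ _; exact ⟨[], [], by simp⟩
  | cons m M ih =>
    intro h hw
    simp only [List.pairwise_cons, List.mem_cons, not_or] at h hw
    rcases lt_or_gt_of_ne (hX.ne hw.1) with hl | hl
    · exact ⟨[], m :: M, rfl, by simp, by
        simp only [List.mem_cons, forall_eq_or_imp]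
        exact ⟨hl, fun b hb => hl.trans (h.1 b hb)⟩⟩
    · obtain ⟨A, B, rfl, hA, hB⟩ := ih h.2 hw.2
      exact ⟨m :: A, B, rfl, by simpa [hl] using hA, hB⟩

theorem Swept.step_vertex {G : SimpleGraph V} {X Y : V → ℝ} (hX : Function.Injective X)
    {S : Set (V × V)} {M : List V} {I : Set (V ⊕ ℕ)} {E : Set (Sym2 (V ⊕ ℕ))}
    (h : Swept G X Y S M I E) {w : V} (hw : (w, w) ∉ S)
    (hmin : ∀ q, IsCell G X q → Precedes X Y q (w, w) → q ∈ S) :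
    ∃ M' I' E', Swept G X Y (insert (w, w) S) M' I' E' := by
  have hwM : w ∉ M ∧ Sum.inl w ∉ I := by
    rw [h.vertex] at hw; tauto
  obtain ⟨A, B, rfl, hA, hB⟩ := exists_split_of_pairwise hX h.sorted hwM.1
  obtain ⟨n, hD⟩ := h.disc
  obtain ⟨P, p, hP⟩ := List.eq_nil_or_concat (Sum.inr 0 :: A.map Sum.inl : List (V ⊕ ℕ))
    |>.resolve_left (by simp)
  obtain ⟨q, Q, hQ⟩ : ∃ q Q, (B.map Sum.inl ++ [Sum.inr 1] : List (V ⊕ ℕ)) = q :: Q := by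
    cases B <;> simp
  rw [List.concat_eq_append] at hP
  have e : (Sum.inr 0 :: (A ++ B).map Sum.inl ++ [Sum.inr 1] : List (V ⊕ ℕ)) =
      P ++ p :: q :: Q := by
    rw [List.map_append, ← List.cons_append, List.append_assoc, hP, hQ]; simp
  have hmem : Sum.inl w ∉ P ++ p :: q :: Q := by
    rw [← e]; simpa using hwM.1
  rw [e] at hD
  have g := hD.insert_vertex hmem hwM.2
  have e' : (Sum.inr 0 :: (A ++ w :: B).map Sum.inl ++ [Sum.inr 1] : List (V ⊕ ℕ)) =
      P ++ p :: Sum.inl w :: q :: Q := by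
    rw [List.map_append, ← List.cons_append, List.append_assoc, hP, List.map_cons,
      List.cons_append, hQ]; simp
  rw [← e'] at g
  refine ⟨A ++ w :: B, I, _, ⟨_, g⟩, ?_, ?_, ?_, ?_, ?_, ?_, h.fresh⟩
  · have := h.sorted
    rw [List.pairwise_append] at this ⊢
    rw [List.pairwise_cons]
    refine ⟨this.1, ⟨hB, this.2.1⟩, ?_⟩
    intro a ha b hb
    simp at hb
    rcases hb with rfl | hb
    · exact hA a ha
    · exact this.2.2 a ha b hb
  · rintro p (rfl | hp)
    · exact Or.inl rfl
    · exact h.cell p hp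
  · rintro p (rfl | hp) q hq hqp
    · exact Or.inr (hmin q hq hqp)
    · exact Or.inr (h.closed p hp q hq hqp)
  · intro y
    have := h.vertex y
    simp only [Set.mem_insert_iff, Prod.mk.injEq, this, List.mem_append, List.mem_cons]
    tauto
  · rintro y hy hyM
    have hy' : (y, y) ∈ S := by
      rcases hy with hy | hy
      · simp at hy; subst hy; simp at hyM
      · exact hy
    obtain ⟨p, hp, hp'⟩ := h.covered y hy' (by simp at hyM ⊢; tauto)
    exact ⟨p, Or.inr hp, hp'⟩
  · rintro p (rfl | hp) hne
    · exact absurd rfl hne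
    · exact Or.inr (Or.inr (h.edge p hp hne))

set_option maxHeartbeats 400000 in
theorem Swept.step_edge {G : SimpleGraph V} {X Y : V → ℝ}
    (hNC : NonCrossing G X Y) {S : Set (V × V)} {M : List V} {I : Set (V ⊕ ℕ)}
    {E : Set (Sym2 (V ⊕ ℕ))} (h : Swept G X Y S M I E) {u v : V} (he : (u, v) ∉ S)
    (hadj : G.Adj u v) (huv : X u < X v)
    (hmin : ∀ q, IsCell G X q → Precedes X Y q (u, v) → q ∈ S) :
    ∃ M' I' E', Swept G X Y (insert (u, v) S) M' I' E' := by
  have hcell : IsCell G X (u, v) := Or.inr ⟨hadj, huv⟩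
  have hne : u ≠ v := hadj.ne
  have hcl : ∀ p ∈ insert (u, v) S, ∀ q, IsCell G X q → Precedes X Y q p →
      q ∈ insert (u, v) S := by
    rintro p (rfl | hp) q hq hqp
    · exact Or.inr (hmin q hq hqp)
    · exact Or.inr (h.closed p hp q hq hqp)
  have hcells : ∀ p ∈ insert (u, v) S, IsCell G X p := by
    rintro p (rfl | hp)
    · exact hcell
    · exact h.cell p hp
  have hvert : ∀ w, (w, w) ∈ insert (u, v) S ↔ (w, w) ∈ S := by
    intro w
    constructor
    · rintro (hw | hw)
      · simp at hw; exact absurd (hw.1.symm.trans hw.2) hne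
      · exact hw
    · exact Or.inr
  by_cases hE : s(Sum.inl u, Sum.inl v) ∈ E
  · refine ⟨M, I, E, h.disc, h.sorted, hcells, hcl, ?_, ?_, ?_, h.fresh⟩
    · intro w; rw [hvert, h.vertex]
    · intro w hw hwM
      obtain ⟨p, hp, hp'⟩ := h.covered w ((hvert w).mp hw) hwM
      exact ⟨p, Or.inr hp, hp'⟩
    · rintro p (rfl | hp) hne
      · exact hE
      · exact h.edge p hp hne
  have hend : ∀ w, w = u ∨ w = v → w ∈ M := by
    intro w hw
    have hwS : (w, w) ∈ S := hmin _ (Or.inl rfl) (Or.inr ⟨rfl, hne, hw⟩)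
    by_contra hwM
    obtain ⟨p, hp, h1, h2, h3⟩ := h.covered w hwS hwM
    refine he (h.closed p hp _ hcell (Or.inl ⟨X w, ?_, ?_, h1, h2, ?_⟩))
    · rcases hw with rfl | rfl
      · exact le_rfl
      · exact huv.le
    · rcases hw with rfl | rfl
      · exact huv.le
      · exact le_rfl
    · rcases hw with rfl | rfl
      · have := segmentHeight_left X Y (w, v)
        simp at this; rwa [this]
      · have := segmentHeight_right X Y (p := (u, w)) (Or.inr huv)
        simp at this; rwa [this]
  obtain ⟨A, B', rfl⟩ := List.append_of_mem (hend u (Or.inl rfl))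
  have hsort := h.sorted
  rw [List.pairwise_append, List.pairwise_cons] at hsort
  have hvB : v ∈ B' := by
    have := hend v (Or.inr rfl)
    simp only [List.mem_append, List.mem_cons] at this
    rcases this with hv | hv | hv
    · have := hsort.2.2 v hv u (by simp)
      linarith
    · exact absurd hv.symm hne
    · exact hv
  obtain ⟨N, B, rfl⟩ := List.append_of_mem hvB
  obtain ⟨n, hD⟩ := h.disc
  have eL : (Sum.inr 0 :: (A ++ u :: (N ++ v :: B)).map Sum.inl ++ [Sum.inr 1] : List (V ⊕ ℕ)) =
      (Sum.inr 0 :: A.map Sum.inl) ++ Sum.inl u ::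
        (N.map Sum.inl ++ Sum.inl v :: (B.map Sum.inl ++ [Sum.inr 1])) := by simp
  rw [eL] at hD
  cases N with
  | nil => exact absurd (hD.mem_of_consecutive rfl) hE
  | cons z N =>
    obtain ⟨k, hk, hfresh⟩ := h.fresh
    have hd : (Sum.inr k : V ⊕ ℕ) ∉ (Sum.inr 0 :: A.map Sum.inl) ++ Sum.inl u ::
        ((z :: N).map Sum.inl ++ Sum.inl v :: (B.map Sum.inl ++ [Sum.inr 1])) := by
      simp; omega
    have hdE : ∀ y, s(Sum.inr k, y) ∉ E := by
      intro y hy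
      rcases (hD.mem_of_mem_edge hy).1 with hy | hy
      · exact hd hy
      · exact hfresh k le_rfl hy
    have hD₁ := hD.insert_vertex hd (hfresh k le_rfl)
    have hnd := hD₁.nodup_disjoint.1
    obtain ⟨n', E', hD₂, hEE', hE'⟩ := Disc.cover_list (d := Sum.inr k) (v := Sum.inl v)
      (P := (Sum.inr 0 :: A.map Sum.inl) ++ [Sum.inl u]) (z := Sum.inl z) (N := N.map Sum.inl)
      (Q := B.map Sum.inl ++ [Sum.inr 1]) (by simpa using hD₁) (by
        rintro y hy (e | e | e)
        · rw [Sym2.eq_iff] at e; simp at e hy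
          subst e
          simp [List.nodup_append] at hnd
          have := hsort.2.1.1 u
          simp at hy
          rcases hy with hy | hy
          · exact lt_irrefl _ (this (by simp [hy]))
          · exact hne hy
        · have hyz : y = Sum.inl z := by
            rw [Sym2.eq_iff] at e; simp at e; exact e
          subst hyz
          simp at hy
          have := hsort.2.1.2
          simp only [List.cons_append, List.pairwise_cons, List.mem_append, List.mem_cons] at this
          exact lt_irrefl _ (this.1 z (by tauto))
        · exact hdE y e)
    have hD₃ := Disc.cover (P := (Sum.inr 0 :: A.map Sum.inl)) (p := Sum.inl u) (z := Sum.inr k)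
      (q := Sum.inl v) (by simpa using hD₂) (by
        intro e
        rcases hE' _ e with (e | e | e) | e
        · rw [Sym2.eq_iff] at e; simp at e
        · rw [Sym2.eq_iff] at e; simp at e
        · exact hE e
        · simp at e)
    refine ⟨A ++ u :: v :: B, insert (Sum.inr k) (I ∪ {y | y ∈ Sum.inl z :: N.map Sum.inl}),
      insert s(Sum.inl u, Sum.inl v) E', ⟨n' + 1, ?_⟩, ?_, hcells, hcl, ?_, ?_, ?_, ?_⟩
    · convert hD₃ using 1
      · simp
      · ext; simp
    · have hs := h.sorted
      refine hs.sublist ?_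
      exact List.Sublist.append_left (List.Sublist.cons_cons _ (List.sublist_append_right _ _)) _
    · intro w
      rw [hvert, h.vertex]
      simp
      tauto
    · intro w hw hwM
      rw [hvert] at hw
      by_cases hwN : w ∈ z :: N
      · refine ⟨(u, v), Or.inl rfl, ?_⟩
        have h1 : X u < X w := hsort.2.1.1 w (List.mem_append_left _ hwN)
        have h2 : X w < X v := by
          have := hsort.2.1.2
          rw [List.pairwise_append] at this
          exact this.2.2 w hwN v (by simp)
        refine ⟨h1.le, h2.le, ?_⟩
        have hwl := segmentHeight_left X Y (w, w)
        simp only at hwl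
        by_contra! hle
        rcases hle.lt_or_eq with hlt | heq
        · exact he (h.closed _ hw _ hcell (Or.inl ⟨X w, h1.le, h2.le, le_rfl, le_rfl, by
            rwa [hwl]⟩))
        · rcases hNC (u, v) (w, w) hcell (Or.inl rfl) (by rintro ⟨⟩; exact hne rfl) (X w) h1.le
            h2.le le_rfl le_rfl (by rw [hwl, heq]) with e | e
          · exact h1.ne' e
          · exact h2.ne e
      · obtain ⟨p, hp, hp'⟩ := h.covered w hw (by simp at hwM hwN ⊢; tauto)
        exact ⟨p, Or.inr hp, hp'⟩
    · rintro p (rfl | hp) hne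
      · exact Or.inl rfl
      · exact Or.inr (hEE' (Or.inr (Or.inr (h.edge p hp hne))))
    · refine ⟨k + 1, by omega, fun j hj => ?_⟩
      have := hfresh j (by omega)
      simp [this]
      omega

/-- Every non-crossing graph is contained in a triangulated disc. -/
theorem exists_disc [Finite V] {G : SimpleGraph V} {X Y : V → ℝ} (hX : Function.Injective X)
    (hNC : NonCrossing G X Y) : ∃ (n : ℕ) (M : List V) (I : Set (V ⊕ ℕ)) (E : Set (Sym2 (V ⊕ ℕ))),
      Disc n (Sum.inr 0 :: M.map Sum.inl ++ [Sum.inr 1]) I E ∧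
      (∀ w, w ∈ M ∨ Sum.inl w ∈ I) ∧ ∀ u v, G.Adj u v → s(Sum.inl u, Sum.inl v) ∈ E := by
  have key : ∀ k, ∀ S M I E, Swept G X Y S M I E → ({p | IsCell G X p} \ S).ncard = k →
      ∃ M I E, Swept G X Y {p | IsCell G X p} M I E := by
    intro k
    induction k with
    | zero =>
      intro S M I E h hk
      rw [Set.ncard_eq_zero (Set.toFinite _), Set.sdiff_eq_empty] at hk
      have : S = {p | IsCell G X p} := Set.Subset.antisymm (fun p hp => h.cell p hp) hk
      exact ⟨M, I, E, this ▸ h⟩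
    | succ k ih =>
      intro S M I E h hk
      have hne : ({p | IsCell G X p} \ S).Nonempty := by
        rw [← Set.ncard_pos (Set.toFinite _)]; omega
      obtain ⟨p, hp, hmin⟩ := exists_first_cell hX hNC (Set.toFinite _) hne (fun p hp => hp.1)
      have hmin' : ∀ q, IsCell G X q → Precedes X Y q p → q ∈ S := by
        intro q hq hqp
        by_contra hqS
        exact hmin q ⟨hq, hqS⟩ hqp
      obtain ⟨M', I', E', h'⟩ : ∃ M' I' E', Swept G X Y (insert p S) M' I' E' := by
        obtain ⟨u, v⟩ := p
        rcases hp.1 with e | ⟨hadj, hlt⟩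
        · simp at e
          subst e
          exact h.step_vertex hX hp.2 hmin'
        · exact h.step_edge hNC hp.2 hadj hlt hmin'
      refine ih _ _ _ _ h' ?_
      rw [show {p | IsCell G X p} \ insert p S = ({p | IsCell G X p} \ S) \ {p} by
        ext; simp; tauto, Set.ncard_sdiff_singleton_of_mem hp, hk]
      rfl
  obtain ⟨M, I, E, h⟩ := key _ _ _ _ _ (Swept.initial G X Y) rfl
  obtain ⟨n, hD⟩ := h.disc
  refine ⟨n, M, I, E, hD, fun w => (h.vertex w).mp (Or.inl rfl), ?_⟩
  intro u v huv
  rcases lt_or_gt_of_ne (hX.ne huv.ne) with hlt | hlt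
  · exact h.edge (u, v) (Or.inr ⟨huv, hlt⟩) huv.ne
  · rw [Sym2.eq_swap]
    exact h.edge (v, u) (Or.inr ⟨huv.symm, hlt⟩) huv.ne'

end Sweep

section Projection

variable {V : Type*}

theorem exists_injective_shear [Finite V] {f : V → EuclideanSpace ℝ (Fin 2)}
    (hf : Function.Injective f) : ∃ ε : ℝ, Function.Injective fun u => f u 0 + ε * f u 1 := by
  let bad : Set ℝ :=
    ⋃ p : V × V, {ε | f p.1 ≠ f p.2 ∧ f p.1 0 + ε * f p.1 1 = f p.2 0 + ε * f p.2 1}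
  have hbad : bad.Finite := by
    refine Set.finite_iUnion fun p => ?_
    refine Set.Subsingleton.finite ?_
    rintro ε ⟨hne, h⟩ ε' ⟨-, h'⟩
    have h1 : (ε - ε') * (f p.1 1 - f p.2 1) = 0 := by linear_combination h - h'
    rcases mul_eq_zero.mp h1 with h2 | h2
    · linarith
    · exfalso
      apply hne
      have h3 : f p.1 1 = f p.2 1 := by linarith
      have h4 : f p.1 0 = f p.2 0 := by rw [h3] at h; linarith
      ext i
      fin_cases i <;> assumption
  obtain ⟨ε, hε⟩ := hbad.exists_notMem
  refine ⟨ε, fun u v h => ?_⟩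
  by_contra huv
  exact hε (Set.mem_iUnion.mpr ⟨(u, v), hf.ne huv, h⟩)

theorem IsPlanarDrawing.nonCrossing {G : SimpleGraph V} {f : V → EuclideanSpace ℝ (Fin 2)}
    (hf : IsPlanarDrawing G f) (ε : ℝ) :
    NonCrossing G (fun u => f u 0 + ε * f u 1) (fun u => f u 1) := by
  intro p q hp hq hpq x hp1 hp2 hq1 hq2 hx
  have key : ∀ p : V × V, IsCell G (fun u => f u 0 + ε * f u 1) p →
      f p.1 0 + ε * f p.1 1 ≤ x → x ≤ f p.2 0 + ε * f p.2 1 →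
      ∃ P ∈ segment ℝ (f p.1) (f p.2), P 0 + ε * P 1 = x ∧
        P 1 = segmentHeight (fun u => f u 0 + ε * f u 1) (fun u => f u 1) p x := by
    intro p hp h1 h2
    rcases hp with hp | ⟨-, hp⟩
    · refine ⟨f p.1, left_mem_segment _ _ _, ?_, ?_⟩
      · rw [← hp] at h2; linarith
      · simp [segmentHeight, hp]
    · simp only at hp
      set t := (x - (f p.1 0 + ε * f p.1 1)) /
        ((f p.2 0 + ε * f p.2 1) - (f p.1 0 + ε * f p.1 1)) with ht
      have ht' : t * ((f p.2 0 + ε * f p.2 1) - (f p.1 0 + ε * f p.1 1)) =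
        x - (f p.1 0 + ε * f p.1 1) := div_mul_cancel₀ _ (by linarith)
      refine ⟨AffineMap.lineMap (f p.1) (f p.2) t, ?_, ?_, ?_⟩
      · rw [segment_eq_image_lineMap]
        refine ⟨t, ⟨div_nonneg (by linarith) (by linarith), ?_⟩, rfl⟩
        rw [div_le_one (by linarith)]; linarith
      · simp [AffineMap.lineMap_apply]
        linear_combination ht'
      · simp [AffineMap.lineMap_apply, segmentHeight, ← ht]; ring
  obtain ⟨P, hP, hPx, hPy⟩ := key p hp hp1 hp2
  obtain ⟨Q, hQ, hQx, hQy⟩ := key q hq hq1 hq2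
  have hPQ : P = Q := by
    have h1 : P 1 = Q 1 := by rw [hPy, hQy, hx]
    have h0 : P 0 = Q 0 := by rw [h1] at hPx; linarith
    ext i
    fin_cases i <;> assumption
  subst hPQ
  -- `P` is the image of an endpoint of `p`
  have hend : P = f p.1 ∨ P = f p.2 := by
    rcases hp with hp | ⟨hp, hplt⟩
    · rw [← hp, segment_same] at hP
      exact Or.inl hP
    rcases hq with hq | ⟨hq, hqlt⟩
    · rw [← hq, segment_same] at hQ
      by_contra hc
      push Not at hc
      obtain rfl : P = f q.1 := hQ
      exact hf.2.2 p.1 p.2 q.1 hp (fun h => hc.1 (by rw [h])) (fun h => hc.2 (by rw [h])) hP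
    · have hne : ({p.1, p.2} : Set V) ≠ {q.1, q.2} := by
        intro h
        rw [Set.pair_eq_pair_iff] at h
        rcases h with ⟨h1, h2⟩ | ⟨h1, h2⟩
        · exact hpq (Prod.ext h1 h2)
        · rw [h1, h2] at hplt; exact lt_asymm hplt hqlt
      obtain ⟨w, ⟨hw, -⟩, rfl⟩ := hf.2.1 _ _ _ _ hp hq hne ⟨hP, hQ⟩
      rcases hw with rfl | rfl
      · exact Or.inl rfl
      · exact Or.inr rfl
  rcases hend with rfl | rfl
  · exact Or.inl hPx.symm
  · exact Or.inr hPx.symm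

end Projection

section Chains

/-- Twice the signed area of the triangle `p q r`: when `q` lies to the right of `p`, it is positive
if and only if `r` lies above the line `p q`. -/
def orient (p q r : ℝ × ℝ) : ℝ := (q.1 - p.1) * (r.2 - p.2) - (q.2 - p.2) * (r.1 - p.1)

/-- A concave arc, which is the graph over the open interval `J` of a function `g` with continuous
nonconstant derivative `m`. -/
structure IsArc (J : Set ℝ) (g m : ℝ → ℝ) : Prop where
  isOpen : IsOpen J
  ordConnected : J.OrdConnected
  continuousOn : ContinuousOn g J
  continuousOn_slope : ContinuousOn m J
  le_tangent : ∀ x ∈ J, ∀ y ∈ J, g y ≤ g x + m x * (y - x)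
  exists_slope_lt : ∃ x ∈ J, ∃ y ∈ J, m y < m x

/-- The arc turns immediately to the right of the abscissa `x`. -/
def TurnsRight (J : Set ℝ) (m : ℝ → ℝ) (x : ℝ) : Prop := x ∈ J ∧ ∀ y ∈ J, x < y → m y < m x

namespace IsArc

variable {J : Set ℝ} {g m : ℝ → ℝ} (hJ : IsArc J g m)
include hJ

theorem slope_anti {x y : ℝ} (hx : x ∈ J) (hy : y ∈ J) (hxy : x ≤ y) : m y ≤ m x := by
  rcases hxy.eq_or_lt with rfl | hlt
  · rfl
  · have h1 := hJ.le_tangent x hx y hy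
    have h2 := hJ.le_tangent y hy x hx
    by_contra! h
    nlinarith [mul_pos (sub_pos.mpr h) (sub_pos.mpr hlt)]

theorem lt_of_slope_lt {x y : ℝ} (hx : x ∈ J) (hy : y ∈ J) (h : m y < m x) : x < y := by
  by_contra! hxy
  exact absurd (hJ.slope_anti hy hx hxy) (not_le.mpr h)

theorem lt_tangent {x y : ℝ} (hx : x ∈ J) (hy : y ∈ J) (h : m x ≠ m y) :
    g y < g x + m x * (y - x) := by
  rcases lt_or_gt_of_ne h with h | h
  · have hyx := hJ.lt_of_slope_lt hy hx h
    obtain ⟨z, hz, hmz⟩ := intermediate_value_Ioo' hyx.le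
      (hJ.continuousOn_slope.mono (hJ.ordConnected.out hy hx))
      (show (m x + m y) / 2 ∈ Ioo (m x) (m y) from ⟨by linarith, by linarith⟩)
    have hzJ := hJ.ordConnected.out hy hx (Ioo_subset_Icc_self hz)
    have h1 := hJ.le_tangent x hx z hzJ
    have h2 := hJ.le_tangent z hzJ y hy
    nlinarith [mul_pos (sub_pos.mpr hz.1) (show 0 < m z - m x by linarith)]
  · have hxy := hJ.lt_of_slope_lt hx hy h
    obtain ⟨z, hz, hmz⟩ := intermediate_value_Ioo' hxy.le
      (hJ.continuousOn_slope.mono (hJ.ordConnected.out hx hy))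
      (show (m x + m y) / 2 ∈ Ioo (m y) (m x) from ⟨by linarith, by linarith⟩)
    have hzJ := hJ.ordConnected.out hx hy (Ioo_subset_Icc_self hz)
    have h1 := hJ.le_tangent x hx z hzJ
    have h2 := hJ.le_tangent z hzJ y hy
    nlinarith [mul_pos (sub_pos.mpr hz.2) (show 0 < m x - m z by linarith)]

theorem exists_turnsRight {x y : ℝ} (hx : x ∈ J) (hy : y ∈ J) (h : m y < m x) :
    ∃ z ∈ Ioo x y, TurnsRight J m z := by
  have hxy := hJ.lt_of_slope_lt hx hy h
  have hc := hJ.continuousOn_slope.mono (hJ.ordConnected.out hx hy)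
  obtain ⟨c, hcy, hcx⟩ := exists_between h
  have hK : IsCompact (Icc x y ∩ m ⁻¹' Ici c) :=
    isCompact_Icc.of_isClosed_subset (hc.preimage_isClosed_of_isClosed isClosed_Icc isClosed_Ici)
      inter_subset_left
  obtain ⟨z, ⟨hz, hmz⟩, hmax⟩ := hK.exists_isMaxOn ⟨x, ⟨le_rfl, hxy.le⟩, hcx.le⟩
    (continuousOn_id (α := ℝ))
  simp only [mem_preimage, mem_Ici] at hmz
  have hzJ := hJ.ordConnected.out hx hy hz
  have hzy : z < y := by
    refine lt_of_le_of_ne hz.2 ?_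
    rintro rfl
    linarith
  have hlt : ∀ s ∈ J, z < s → m s < c := by
    intro s hs hzs
    by_contra! hcs
    have hsy : s ≤ y := by
      by_contra! hys
      linarith [hJ.slope_anti hy hs hys.le]
    exact absurd (hmax ⟨⟨hz.1.trans hzs.le, hsy⟩, hcs⟩) (not_le.mpr hzs)
  have hmzc : m z = c := by
    refine le_antisymm ?_ hmz
    by_contra! hcz
    obtain ⟨s, hs, hms⟩ := intermediate_value_Ioo' hzy.le
      (hJ.continuousOn_slope.mono (hJ.ordConnected.out hzJ hy)) (show c ∈ Ioo _ _ from ⟨hcy, hcz⟩)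
    exact absurd (hlt s (hJ.ordConnected.out hzJ hy (Ioo_subset_Icc_self hs)) hs.1)
      (by rw [hms]; exact lt_irrefl _)
  refine ⟨z, ⟨lt_of_le_of_ne hz.1 ?_, hzy⟩, hzJ, fun s hs hzs => by rw [hmzc]; exact hlt s hs hzs⟩
  rintro rfl
  linarith

end IsArc

/-- The segment from `p` to the point `q` to its right passes below some point of the graph of
`g`. -/
def Dips (g : ℝ → ℝ) (p q : ℝ × ℝ) : Prop := ∃ x ∈ Ioo p.1 q.1, 0 < orient p q (x, g x)

/-- The points of the list move to the right, turn to the right, and successive segments dip below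
the graph of `g`. -/
structure DippingChain (g : ℝ → ℝ) (L : List (ℝ × ℝ)) : Prop where
  lt : L.Pairwise fun p q => p.1 < q.1
  dips : L.Pairwise (Dips g)
  concave : L.Triplewise fun p q r => orient p q r < 0

theorem DippingChain.sublist {g : ℝ → ℝ} {L L' : List (ℝ × ℝ)} (h : DippingChain g L)
    (hL : L'.Sublist L) : DippingChain g L' where
  lt := h.lt.sublist hL
  dips := h.dips.sublist hL
  concave := by
    have hc := h.concave
    clear h
    induction hL with
    | slnil => exact hc
    | cons a _ ih => exact ih (List.triplewise_cons.mp hc).2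
    | cons_cons a hs ih =>
      rw [List.triplewise_cons] at hc ⊢
      exact ⟨hc.1.sublist hs, ih hc.2⟩

theorem dippingChain_cons {g : ℝ → ℝ} {a : ℝ × ℝ} {L : List (ℝ × ℝ)} :
    DippingChain g (a :: L) ↔ (∀ q ∈ L, a.1 < q.1) ∧ (∀ q ∈ L, Dips g a q) ∧
      (L.Pairwise fun q r => orient a q r < 0) ∧ DippingChain g L := by
  constructor
  · intro h
    have h1 := h.lt
    have h2 := h.dips
    have h3 := h.concave
    rw [List.pairwise_cons] at h1 h2
    rw [List.triplewise_cons] at h3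
    exact ⟨h1.1, h2.1, h3.1, h1.2, h2.2, h3.2⟩
  · rintro ⟨h1, h2, h3, h⟩
    exact ⟨List.pairwise_cons.mpr ⟨h1, h.lt⟩, List.pairwise_cons.mpr ⟨h2, h.dips⟩,
      List.triplewise_cons.mpr ⟨h3, h.concave⟩⟩

/-- The point lies strictly above the graph of `g` and the arc turns below it. -/
def IsGood (J : Set ℝ) (g m : ℝ → ℝ) (p : ℝ × ℝ) : Prop := TurnsRight J m p.1 ∧ g p.1 < p.2

theorem continuous_orient {X : Type*} [TopologicalSpace X] {p q r : X → ℝ × ℝ} (hp : Continuous p)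
    (hq : Continuous q) (hr : Continuous r) : Continuous fun x => orient (p x) (q x) (r x) := by
  unfold orient; fun_prop

open Filter Topology

theorem Dips.eventually_left {g : ℝ → ℝ} {t y : ℝ × ℝ} (h : Dips g t y) :
    ∀ᶠ z in 𝓝 t, Dips g z y := by
  obtain ⟨x, hx, h⟩ := h
  filter_upwards [continuous_fst.continuousAt.eventually_lt_const hx.1,
    (continuous_orient continuous_id continuous_const continuous_const).continuousAt
      |>.eventually_const_lt
      h] with z h1 h2
  exact ⟨x, ⟨h1, hx.2⟩, h2⟩

theorem Dips.eventually_right {g : ℝ → ℝ} {t y : ℝ × ℝ} (h : Dips g y t) :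
    ∀ᶠ z in 𝓝 t, Dips g y z := by
  obtain ⟨x, hx, h⟩ := h
  filter_upwards [continuous_fst.continuousAt.eventually_const_lt hx.2,
    (continuous_orient continuous_const continuous_id continuous_const).continuousAt
      |>.eventually_const_lt
      h] with z h1 h2
  exact ⟨x, ⟨hx.1, h1⟩, h2⟩

theorem eventually_orient_neg {p q r : ℝ × ℝ → ℝ × ℝ} (hp : Continuous p)
    (hq : Continuous q) (hr : Continuous r) {t : ℝ × ℝ} (h : orient (p t) (q t) (r t) < 0) :
    ∀ᶠ z in 𝓝 t, orient (p z) (q z) (r z) < 0 :=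
  (continuous_orient hp hq hr).continuousAt.eventually_lt_const h

theorem eventually_orient_pos {p q r : ℝ × ℝ → ℝ × ℝ} (hp : Continuous p)
    (hq : Continuous q) (hr : Continuous r) {t : ℝ × ℝ} (h : 0 < orient (p t) (q t) (r t)) :
    ∀ᶠ z in 𝓝 t, 0 < orient (p z) (q z) (r z) :=
  (continuous_orient hp hq hr).continuousAt.eventually_const_lt h

theorem List.eventually_pairwise {α X : Type*} {F : Filter X} {R : X → α → α → Prop} {L : List α}
    (h : L.Pairwise fun a b => ∀ᶠ x in F, R x a b) : ∀ᶠ x in F, L.Pairwise (R x) := by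
  induction h with
  | nil => simp
  | @cons a L ha _ ih =>
    have : ∀ᶠ x in F, ∀ b ∈ L, R x a b :=
      (Filter.eventually_all_finite (List.finite_toSet L)).mpr ha
    filter_upwards [this, ih] with x h1 h2
    exact List.pairwise_cons.mpr ⟨h1, h2⟩

end Chains

section Insertion

open Filter Topology

namespace IsArc

variable {J : Set ℝ} {g m : ℝ → ℝ} (hJ : IsArc J g m)
include hJ

theorem lt_tangent_of_dips_right {b t : ℝ × ℝ} (hb : b.1 ∈ J) (ht : t.1 ∈ J) (htg : t.2 = g t.1)
    (h : Dips g b t) : b.2 < t.2 + m t.1 * (b.1 - t.1) := by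
  obtain ⟨x, hx, h⟩ := h
  have h1 := hJ.le_tangent t.1 ht x (hJ.ordConnected.out hb ht (Ioo_subset_Icc_self hx))
  have hbt : b.1 < t.1 := hx.1.trans hx.2
  rw [← htg] at h1
  unfold orient at h
  simp only at h
  have h2 : 0 < (t.1 - x) * (t.2 + m t.1 * (b.1 - t.1) - b.2) := by
    nlinarith [mul_le_mul_of_nonneg_left h1 (sub_pos.mpr hbt).le]
  have := pos_of_mul_pos_right h2 (sub_pos.mpr hx.2).le
  linarith

theorem lt_tangent_of_dips_left {t y : ℝ × ℝ} (hy : y.1 ∈ J) (ht : t.1 ∈ J) (htg : t.2 = g t.1)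
    (h : Dips g t y) : y.2 < t.2 + m t.1 * (y.1 - t.1) := by
  obtain ⟨x, hx, h⟩ := h
  have h1 := hJ.le_tangent t.1 ht x (hJ.ordConnected.out ht hy (Ioo_subset_Icc_self hx))
  have hbt : t.1 < y.1 := hx.1.trans hx.2
  rw [← htg] at h1
  unfold orient at h
  simp only at h
  have h2 : 0 < (x - t.1) * (t.2 + m t.1 * (y.1 - t.1) - y.2) := by
    nlinarith [mul_le_mul_of_nonneg_left h1 (sub_pos.mpr hbt).le]
  have := pos_of_mul_pos_right h2 (sub_pos.mpr hx.1).le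
  linarith

theorem dips_of_mem {x y : ℝ} (hx : x ∈ J) (hy : y ∈ J) (h : m y < m x) :
    Dips g (x, g x) (y, g y) := by
  have hxy := hJ.lt_of_slope_lt hx hy h
  obtain ⟨z, hz, hmz⟩ := intermediate_value_Ioo' hxy.le
    (hJ.continuousOn_slope.mono (hJ.ordConnected.out hx hy))
    (show (m x + m y) / 2 ∈ Ioo (m y) (m x) from ⟨by linarith, by linarith⟩)
  have hzJ := hJ.ordConnected.out hx hy (Ioo_subset_Icc_self hz)
  refine ⟨z, hz, ?_⟩
  have h1 := hJ.lt_tangent hzJ hx (by linarith)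
  have h2 := hJ.le_tangent z hzJ y hy
  have h3 := sub_pos.mpr hz.1
  have h4 := sub_pos.mpr hz.2
  simp only [orient]
  nlinarith [mul_lt_mul_of_pos_left h1 h4, mul_le_mul_of_nonneg_left h2 h3.le]

theorem exists_insert {b t : ℝ × ℝ} {Y : List (ℝ × ℝ)} (hb : b.1 ∈ J) (ht : TurnsRight J m t.1)
    (htg : t.2 = g t.1) (hY : ∀ y ∈ Y, y.1 ∈ J) (h : DippingChain g (b :: t :: Y))
    {P : ℝ × ℝ → Prop} (hP : ∀ᶠ z in 𝓝 t, P z) :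
    ∃ z, t.1 < z.1 ∧ IsGood J g m z ∧ P z ∧ DippingChain g (b :: t :: z :: Y) := by
  obtain ⟨hb1, hb2, hb3, h'⟩ := dippingChain_cons.mp h
  obtain ⟨ht1, ht2, ht3, hc⟩ := dippingChain_cons.mp h'
  obtain ⟨hb3, hb4⟩ := List.pairwise_cons.mp hb3
  have hbt := hb1 t (by simp)
  have hbT := hJ.lt_tangent_of_dips_right hb ht.1 htg (hb2 t (by simp))
  have hyT : ∀ y ∈ Y, y.2 < t.2 + m t.1 * (y.1 - t.1) := fun y hy =>
    hJ.lt_tangent_of_dips_left (hY y hy) ht.1 htg (ht2 y hy)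
  have hfin := List.finite_toSet Y
  -- conditions that are open around `t`
  have hopen : ∀ᶠ z in 𝓝 t, P z ∧ Dips g b z ∧
      (∀ y ∈ Y, z.1 < y.1 ∧ Dips g z y ∧ orient b z y < 0) ∧
      Y.Pairwise (fun y y' => orient z y y' < 0) := by
    refine hP.and ((hb2 t (by simp)).eventually_right.and
      (((Filter.eventually_all_finite hfin).mpr fun y hy => ?_).and
      (List.eventually_pairwise (ht3.imp fun {y y'} hyy =>
        eventually_orient_neg continuous_id continuous_const continuous_const hyy))))
    exact (continuous_fst.continuousAt.eventually_lt_const (ht1 y hy)).and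
      ((ht2 y hy).eventually_left.and
        (eventually_orient_neg continuous_const continuous_id continuous_const (hb3 y hy)))
  have hJt : J ∈ 𝓝 t.1 := hJ.isOpen.mem_nhds ht.1
  have hgc : ContinuousAt g t.1 := hJ.continuousOn.continuousAt hJt
  have hmc : ContinuousAt m t.1 := hJ.continuousOn_slope.continuousAt hJt
  have hcurve : Tendsto (fun s => (s, g s)) (𝓝 t.1) (𝓝 t) := by
    have : ContinuousAt (fun s => (s, g s)) t.1 := continuousAt_id.prodMk hgc
    rwa [ContinuousAt, ← htg] at this
  have hs1 := hcurve.eventually hopen.eventually_nhds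
  have hs2 : ∀ᶠ s in 𝓝 t.1, ∀ y ∈ Y, y.2 < g s + m s * (y.1 - s) := by
    refine (Filter.eventually_all_finite hfin).mpr fun y hy => ?_
    have : ContinuousAt (fun s => g s + m s * (y.1 - s)) t.1 := by fun_prop
    refine this.eventually_const_lt ?_
    simpa only [← htg] using hyT y hy
  obtain ⟨l, u, htlu, hlu⟩ := mem_nhds_iff_exists_Ioo_subset.mp
    ((hs1.and hs2).and (Filter.eventually_mem_set.mpr hJt))
  obtain ⟨w, hw1, hw2⟩ := exists_between htlu.2
  have hwJ : w ∈ J := (hlu ⟨htlu.1.trans hw1, hw2⟩).2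
  obtain ⟨s, hs, hsR⟩ := hJ.exists_turnsRight ht.1 hwJ (ht.2 w hwJ hw1)
  obtain ⟨⟨hs1, hs2⟩, -⟩ := hlu ⟨htlu.1.trans hs.1, hs.2.trans hw2⟩
  have hts := hs.1
  have htan := hJ.le_tangent t.1 ht.1 s hsR.1
  have htan' := hJ.le_tangent s hsR.1 t.1 ht.1
  rw [← htg] at htan htan'
  -- conditions that are open around a point of the arc close to `t`
  have c1 : orient b t (s, g s) < 0 := by
    simp only [orient]
    nlinarith [mul_le_mul_of_nonneg_left htan (sub_pos.mpr hbt).le,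
      mul_lt_mul_of_pos_left hbT (sub_pos.mpr hts)]
  have c2 : ∀ y ∈ Y, orient t (s, g s) y < 0 := by
    intro y hy
    have hsy : s < y.1 := ((mem_of_mem_nhds hs1).2.2.1 y hy).1
    simp only [orient]
    nlinarith [mul_lt_mul_of_pos_left (hs2 y hy) (sub_pos.mpr hts),
      mul_le_mul_of_nonneg_left htan' (sub_pos.mpr hsy).le]
  have c3 : Dips g t (s, g s) := by
    have := hJ.dips_of_mem ht.1 hsR.1 (ht.2 s hsR.1 hts)
    rwa [← htg] at this
  have hall : ∀ᶠ z in 𝓝 (s, g s), (P z ∧ Dips g b z ∧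
      (∀ y ∈ Y, z.1 < y.1 ∧ Dips g z y ∧ orient b z y < 0) ∧
      Y.Pairwise (fun y y' => orient z y y' < 0)) ∧ orient b t z < 0 ∧
      (∀ y ∈ Y, orient t z y < 0) ∧ Dips g t z :=
    hs1.and ((eventually_orient_neg continuous_const continuous_const continuous_id c1).and
      (((Filter.eventually_all_finite hfin).mpr fun y hy =>
        eventually_orient_neg continuous_const continuous_id continuous_const (c2 y hy)).and
        c3.eventually_right))
  have hlift : Tendsto (fun δ : ℝ => (s, g s + δ)) (𝓝[>] 0) (𝓝 (s, g s)) := by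
    have : ContinuousAt (fun δ : ℝ => (s, g s + δ)) 0 := by fun_prop
    have h2 := this.tendsto
    simp only [add_zero] at h2
    exact h2.mono_left nhdsWithin_le_nhds
  obtain ⟨δ, ⟨⟨hPz, hbz, hzY, hzYY⟩, hbtz, htzY, htz⟩, hδ⟩ :=
    ((hlift.eventually hall).and self_mem_nhdsWithin).exists
  refine ⟨(s, g s + δ), hts, ⟨hsR, by simpa using hδ⟩, hPz, ?_⟩
  rw [dippingChain_cons, dippingChain_cons, dippingChain_cons]
  simp only [List.mem_cons, forall_eq_or_imp, List.pairwise_cons]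
  refine ⟨⟨hbt, hbt.trans hts, fun y hy => hb1 y (by simp [hy])⟩,
    ⟨hb2 t (by simp), hbz, fun y hy => hb2 y (by simp [hy])⟩,
    ⟨⟨hbtz, hb3⟩, fun y hy => (hzY y hy).2.2, hb4⟩, ⟨hts, ht1⟩, ⟨htz, ht2⟩, ⟨htzY, ht3⟩,
    fun y hy => (hzY y hy).1, fun y hy => (hzY y hy).2.1, hzYY, hc⟩

end IsArc

/-- A dipping chain of good points. -/
structure GoodChain (J : Set ℝ) (g m : ℝ → ℝ) (L : List (ℝ × ℝ)) : Prop extends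
    DippingChain g L where
  good : ∀ p ∈ L, IsGood J g m p

theorem GoodChain.sublist {J : Set ℝ} {g m : ℝ → ℝ} {L L' : List (ℝ × ℝ)}
    (h : GoodChain J g m L) (hL : L'.Sublist L) : GoodChain J g m L' :=
  ⟨h.toDippingChain.sublist hL, fun p hp => h.good p (hL.subset hp)⟩

namespace IsArc

variable {J : Set ℝ} {g m : ℝ → ℝ} (hJ : IsArc J g m)
include hJ

theorem exists_replacement {b v x : ℝ × ℝ} {X : List (ℝ × ℝ)}
    (h : GoodChain J g m (b :: v :: x :: X)) (k : ℕ) :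
    ∃ Z : List (ℝ × ℝ), Z.length = k ∧ GoodChain J g m (b :: Z ++ x :: X) ∧
      (b :: Z ++ [x]).Pairwise (fun y y' => 0 < orient y y' v) ∧
      ∀ z ∈ Z, orient b v z < 0 ∧ orient v x z < 0 := by
  obtain ⟨hb1, hb2, hb3, h'⟩ := dippingChain_cons.mp h.toDippingChain
  obtain ⟨hv1, hv2, hv3, hc⟩ := dippingChain_cons.mp h'
  obtain ⟨hb3, hb4⟩ := List.pairwise_cons.mp hb3
  have hbg := h.good b (by simp)
  have hvg := h.good v (by simp)
  have hXg : ∀ y ∈ x :: X, IsGood J g m y := fun y hy => h.good y (by simp at hy ⊢; tauto)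
  have hbv := hb1 v (by simp)
  have hvx := hv1 x (by simp)
  set t : ℝ × ℝ := (v.1, g v.1) with ht
  have htv : g v.1 < v.2 := hvg.2
  have d1 : Dips g b t := by
    obtain ⟨s, hs, hd⟩ := hb2 v (by simp)
    refine ⟨s, hs, ?_⟩
    simp only [orient, ht] at hd ⊢
    nlinarith [mul_pos (sub_pos.mpr hs.1) (sub_pos.mpr htv)]
  have d2 : ∀ y ∈ x :: X, Dips g t y := by
    intro y hy
    obtain ⟨s, hs, hd⟩ := hv2 y hy
    refine ⟨s, hs, ?_⟩
    simp only [orient, ht] at hd ⊢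
    nlinarith [mul_pos (sub_pos.mpr hs.2) (sub_pos.mpr htv)]
  have hbT := hJ.lt_tangent_of_dips_right (t := t) hbg.1.1 hvg.1.1 rfl d1
  have chain : DippingChain g (b :: t :: x :: X) := by
    refine dippingChain_cons.mpr ⟨?_, ?_, List.pairwise_cons.mpr ⟨?_, hb4⟩,
      dippingChain_cons.mpr ⟨hv1, d2, ?_, hc⟩⟩
    · intro q hq
      rcases List.mem_cons.mp hq with rfl | hq
      · exact hbv
      · exact hb1 q (List.mem_cons_of_mem _ hq)
    · intro q hq
      rcases List.mem_cons.mp hq with rfl | hq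
      · exact d1
      · exact hb2 q (List.mem_cons_of_mem _ hq)
    · intro y hy
      have hyT := hJ.lt_tangent_of_dips_left (t := t) (hXg y hy).1.1 hvg.1.1 rfl (d2 y hy)
      have hvy := hv1 y hy
      simp only [orient, ht] at hbT hyT ⊢
      nlinarith [mul_lt_mul_of_pos_left hbT (sub_pos.mpr hvy),
        mul_lt_mul_of_pos_left hyT (sub_pos.mpr hbv)]
    · have := hv3.and h'.lt.of_cons
      refine this.imp ?_
      rintro y y' ⟨h1, h2⟩
      simp only [orient, ht] at h1 ⊢
      nlinarith [mul_pos (sub_pos.mpr h2) (sub_pos.mpr htv)]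
  have o1 : 0 < orient b t v := by
    simp only [orient, ht]
    nlinarith [mul_pos (sub_pos.mpr hbv) (sub_pos.mpr htv)]
  have o2 : orient b v t < 0 := by
    simp only [orient, ht]
    nlinarith [mul_pos (sub_pos.mpr hbv) (sub_pos.mpr htv)]
  have o3 : orient v x t < 0 := by
    simp only [orient, ht]
    nlinarith [mul_pos (sub_pos.mpr hvx) (sub_pos.mpr htv)]
  have o4 : 0 < orient t x v := by
    simp only [orient, ht]
    nlinarith [mul_pos (sub_pos.mpr hvx) (sub_pos.mpr htv)]
  have o5 : 0 < orient b x v := by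
    have := hb3 x (by simp)
    simp only [orient] at this ⊢
    linarith
  suffices hk : ∃ Z : List (ℝ × ℝ), Z.length = k ∧ DippingChain g (b :: t :: (Z ++ x :: X)) ∧
      (∀ z ∈ Z, IsGood J g m z) ∧
      (b :: t :: (Z ++ [x])).Pairwise (fun y y' => 0 < orient y y' v) ∧
      ∀ z ∈ Z, orient b v z < 0 ∧ orient v x z < 0 by
    obtain ⟨Z, hZ, h1, h2, h3, h4⟩ := hk
    have hs : ∀ Y, (b :: Y).Sublist (b :: t :: Y) := fun Y =>
      List.Sublist.cons_cons _ (List.sublist_cons_self _ _)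
    refine ⟨Z, hZ, ⟨h1.sublist (hs _), ?_⟩, h3.sublist (hs _), h4⟩
    intro p hp
    simp only [List.cons_append, List.mem_cons, List.mem_append] at hp
    rcases hp with rfl | hp | hp
    · exact hbg
    · exact h2 p hp
    · exact hXg p (List.mem_cons.mpr hp)
  clear_value t
  induction k with
  | zero => exact ⟨[], rfl, by simpa using chain, by simp, by simp [o1, o4, o5], by simp⟩
  | succ k ih =>
    obtain ⟨Z, hZ, h1, h2, h3, h4⟩ := ih
    have ht1 : t.1 = v.1 := by rw [ht]
    have ht2 : t.2 = g t.1 := by rw [ht]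
    rw [List.pairwise_cons, List.pairwise_cons] at h3
    obtain ⟨hp1, hp2, hp3⟩ := h3
    have hopen : ∀ᶠ z in 𝓝 t, 0 < orient b z v ∧ (orient b v z < 0 ∧ orient v x z < 0) ∧
        ∀ y ∈ Z ++ [x], 0 < orient z y v :=
      (eventually_orient_pos continuous_const continuous_id continuous_const o1).and
        (((eventually_orient_neg continuous_const continuous_const continuous_id o2).and
          (eventually_orient_neg continuous_const continuous_const continuous_id o3)).and
          ((Filter.eventually_all_finite (List.finite_toSet _)).mpr fun y hy =>
            eventually_orient_pos continuous_id continuous_const continuous_const (hp2 y hy)))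
    obtain ⟨z, hz1, hz2, ⟨hz3, hz4, hz5⟩, hz6⟩ :=
      hJ.exists_insert hbg.1.1 (by rw [ht1]; exact hvg.1)
      ht2 (by
        intro y hy
        rcases List.mem_append.mp hy with hy | hy
        · exact (h2 y hy).1.1
        · exact (hXg y hy).1.1) h1 hopen
    refine ⟨z :: Z, by simp [hZ], by simpa using hz6, ?_, ?_, ?_⟩
    · exact List.forall_mem_cons.mpr ⟨hz2, h2⟩
    · simp only [List.cons_append, List.pairwise_cons, List.mem_cons, forall_eq_or_imp]
      refine ⟨⟨o1, hz3, fun y hy => hp1 y (List.mem_cons_of_mem _ hy)⟩, ⟨?_, hp2⟩, hz5, hp3⟩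
      rw [ht1] at hz1
      simp only [orient, ht]
      nlinarith [mul_pos (sub_pos.mpr hz1) (sub_pos.mpr htv)]
    · intro y hy
      rcases List.mem_cons.mp hy with rfl | hy
      · exact hz4
      · exact h4 y hy

theorem exists_goodChain (k : ℕ) :
    ∃ (b c : ℝ × ℝ) (Z : List (ℝ × ℝ)), Z.length = k ∧ GoodChain J g m (b :: Z ++ [c]) := by
  obtain ⟨x, hx, y, hy, hxy⟩ := hJ.exists_slope_lt
  obtain ⟨p, hp, hpR⟩ := hJ.exists_turnsRight hx hy hxy
  obtain ⟨q, hq, hqR⟩ := hJ.exists_turnsRight hpR.1 hy (hpR.2 y hy hp.2)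
  obtain ⟨r, hr, hrR⟩ := hJ.exists_turnsRight hqR.1 hy (hqR.2 y hy hq.2)
  have hpq := hq.1
  have hqr := hr.1
  have hd : ∀ p q : ℝ, TurnsRight J m p → TurnsRight J m q → p < q →
      ∀ᶠ δ in 𝓝[>] (0 : ℝ), Dips g (p, g p + δ) (q, g q + δ) := by
    intro p q hp hq hpq
    obtain ⟨s, hs, h⟩ := hJ.dips_of_mem hp.1 hq.1 (hp.2 q hq.1 hpq)
    have hc : ContinuousAt (fun δ : ℝ => orient (p, g p + δ) (q, g q + δ) (s, g s)) 0 := by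
      unfold orient; fun_prop
    filter_upwards [nhdsWithin_le_nhds (hc.eventually_const_lt (by simpa using h))] with δ hδ
    exact ⟨s, hs, hδ⟩
  obtain ⟨δ, h1, h2, h3, hδ⟩ := ((hd p q hpR hqR hpq).and ((hd p r hpR hrR (hpq.trans hqr)).and
    ((hd q r hqR hrR hqr).and self_mem_nhdsWithin))).exists
  have hδ : 0 < δ := hδ
  have ho : orient (p, g p + δ) (q, g q + δ) (r, g r + δ) < 0 := by
    have e1 := hJ.lt_tangent hqR.1 hpR.1 (hpR.2 q hqR.1 hpq).ne
    have e2 := hJ.le_tangent q hqR.1 r hrR.1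
    simp only [orient]
    nlinarith [mul_lt_mul_of_pos_left e1 (sub_pos.mpr hqr),
      mul_le_mul_of_nonneg_left e2 (sub_pos.mpr hpq).le]
  obtain ⟨Z, hZ, h, -⟩ := hJ.exists_replacement (b := (p, g p + δ)) (v := (q, g q + δ))
    (x := (r, g r + δ)) (X := []) ⟨⟨by simp [hpq, hqr, hpq.trans hqr], by simp [h1, h2, h3],
      by simp [ho]⟩, by simp [IsGood, hpR, hqR, hrR, hδ]⟩ k
  exact ⟨_, _, Z, hZ, h⟩

end IsArc

end Insertion

section Region

theorem orient_swap (p q r : ℝ × ℝ) : orient q p r = -orient p q r := by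
  unfold orient; ring

theorem orient_rotate (p q r : ℝ × ℝ) : orient q r p = orient p q r := by
  unfold orient; ring

@[simp] theorem orient_self_left (p r : ℝ × ℝ) : orient p p r = 0 := by
  unfold orient; ring

@[simp] theorem orient_eq_left (p q : ℝ × ℝ) : orient p q p = 0 := by
  unfold orient; ring

@[simp] theorem orient_eq_right (p q : ℝ × ℝ) : orient p q q = 0 := by
  unfold orient; ring

theorem orient_combo (p q r s : ℝ × ℝ) {a b : ℝ} (h : a + b = 1) :
    orient p q (a • r + b • s) = a * orient p q r + b * orient p q s := by
  obtain rfl : a = 1 - b := by linarith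
  simp [orient]; ring

theorem orient_mul_orient (p q r s a b : ℝ × ℝ) :
    orient p q r * orient a b s = orient q r s * orient a b p + orient r p s * orient a b q +
      orient p q s * orient a b r := by
  unfold orient; ring

theorem convex_setOf_orient_nonpos (p q : ℝ × ℝ) : Convex ℝ {s | orient p q s ≤ 0} := by
  intro r hr s hs a b ha hb hab
  simp only [mem_ofPred_eq] at hr hs ⊢
  rw [orient_combo _ _ _ _ hab]
  nlinarith

theorem convex_setOf_orient_pos (p q : ℝ × ℝ) : Convex ℝ {s | 0 < orient p q s} := by
  intro r hr s hs a b ha hb hab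
  simp only [mem_ofPred_eq] at hr hs ⊢
  rw [orient_combo _ _ _ _ hab]
  rcases ha.eq_or_lt with rfl | ha
  · obtain rfl : b = 1 := by linarith
    simpa using hs
  · nlinarith [mul_pos ha hr, mul_nonneg hb hs.le]

theorem Convex.mem_of_orient {C : Set (ℝ × ℝ)} (hC : Convex ℝ C) {p q r s : ℝ × ℝ} (hp : p ∈ C)
    (hq : q ∈ C) (hr : r ∈ C) (h : 0 < orient p q r) (h₁ : 0 ≤ orient q r s)
    (h₂ : 0 ≤ orient r p s) (h₃ : 0 ≤ orient p q s) : s ∈ C := by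
  have hsum : orient q r s + orient r p s + orient p q s = orient p q r := by
    unfold orient; ring
  have := hC.sum_mem (t := Finset.univ (α := Fin 3))
    (w := ![orient q r s / orient p q r, orient r p s / orient p q r, orient p q s / orient p q r])
    (z := ![p, q, r]) (by
      intro i _
      fin_cases i <;> simp <;> positivity) (by
      simp [Fin.sum_univ_three]
      rw [← add_div, ← add_div, hsum, div_self h.ne']) (by
      intro i _
      fin_cases i <;> simpa)
  convert this using 1
  simp only [Fin.sum_univ_three]
  ext
  · simp
    field_simp
    unfold orient; ring
  · simp
    field_simp
    unfold orient; ring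

theorem mem_segment_of_orient {p q r : ℝ × ℝ} (hpq : p.1 < q.1) (h : orient p q r = 0)
    (h₁ : p.1 ≤ r.1) (h₂ : r.1 ≤ q.1) : r ∈ segment ℝ p q := by
  have hd := sub_pos.mpr hpq
  rw [segment_eq_image_lineMap]
  refine ⟨(r.1 - p.1) / (q.1 - p.1), ⟨div_nonneg (by linarith) hd.le, ?_⟩, ?_⟩
  · rw [div_le_one hd]; linarith
  · ext
    · simp [AffineMap.lineMap_apply]
      field_simp
      ring
    · simp [AffineMap.lineMap_apply]
      unfold orient at h
      field_simp
      linarith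

/-- The convex polygon whose upper boundary is the concave chain `L`, and whose lower boundary is
the segment joining the first and the last point of `L`. -/
def region (L : List (ℝ × ℝ)) : Set (ℝ × ℝ) :=
  {p | L.IsChain (fun a b => orient a b p ≤ 0) ∧
    ∀ a ∈ L.head?, ∀ c ∈ L.getLast?, a.1 ≤ p.1 ∧ p.1 ≤ c.1 ∧ 0 ≤ orient a c p}

theorem mem_region_cons {a c p : ℝ × ℝ} {L : List (ℝ × ℝ)} (hc : (a :: L).getLast? = some c) :
    p ∈ region (a :: L) ↔ (a :: L).IsChain (fun a b => orient a b p ≤ 0) ∧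
      a.1 ≤ p.1 ∧ p.1 ≤ c.1 ∧ 0 ≤ orient a c p := by
  simp [region, hc]

theorem convex_region (L : List (ℝ × ℝ)) : Convex ℝ (region L) := by
  rintro p ⟨hp, hp'⟩ q ⟨hq, hq'⟩ a b ha hb hab
  refine ⟨?_, fun s hs c hc => ?_⟩
  · rw [List.isChain_iff_forall_rel_of_append_cons_cons] at hp hq ⊢
    intro s t P Q h
    exact convex_setOf_orient_nonpos s t (hp h) (hq h) ha hb hab
  · obtain ⟨h1, h2, h3⟩ := hp' s hs c hc
    obtain ⟨k1, k2, k3⟩ := hq' s hs c hc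
    rw [orient_combo _ _ _ _ hab]
    obtain rfl : a = 1 - b := by linarith
    simp
    refine ⟨by nlinarith, by nlinarith, by positivity⟩

namespace DippingChain

variable {g : ℝ → ℝ} {L : List (ℝ × ℝ)}

theorem orient_nonpos (h : DippingChain g L) {P Q : List (ℝ × ℝ)} {s t : ℝ × ℝ}
    (hL : L = P ++ s :: t :: Q) {a : ℝ × ℝ} (ha : a ∈ L) : orient s t a ≤ 0 := by
  subst hL
  have hc := h.concave
  rw [List.triplewise_append] at hc
  obtain ⟨-, h2, h3, -⟩ := hc
  simp only [List.triplewise_cons, List.pairwise_cons] at h2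
  simp only [List.mem_append, List.mem_cons] at ha
  rcases ha with ha | rfl | rfl | ha
  · rw [orient_rotate]
    exact ((List.pairwise_cons.mp (h3 a ha)).1 t (by simp)).le
  · simp
  · simp
  · exact (h2.1.1 a ha).le

theorem fst_le_of_head (h : DippingChain g L) {a b : ℝ × ℝ} (hb : L.head? = some b) (ha : a ∈ L) :
    b.1 ≤ a.1 := by
  cases L with
  | nil => simp at ha
  | cons x L =>
    simp at hb
    subst hb
    rcases List.mem_cons.mp ha with rfl | ha
    · rfl
    · exact ((dippingChain_cons.mp h).1 a ha).le

theorem fst_le_of_getLast (h : DippingChain g L) {a c : ℝ × ℝ} (hc : L.getLast? = some c)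
    (ha : a ∈ L) : a.1 ≤ c.1 := by
  obtain ⟨M, rfl⟩ := List.getLast?_eq_some_iff.mp hc
  rcases List.mem_append.mp ha with ha | ha
  · exact ((List.pairwise_append.mp h.lt).2.2 a ha c (by simp)).le
  · simp at ha; rw [ha]

theorem mem_region (h : DippingChain g L) {a : ℝ × ℝ} (ha : a ∈ L) : a ∈ region L := by
  refine ⟨?_, fun b hb c hc => ⟨h.fst_le_of_head hb ha, h.fst_le_of_getLast hc ha, ?_⟩⟩
  · rw [List.isChain_iff_forall_rel_of_append_cons_cons]
    intro s t P Q hL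
    exact h.orient_nonpos hL ha
  · cases L with
    | nil => simp at ha
    | cons x L =>
      simp at hb
      subst hb
      obtain ⟨M, hM⟩ := List.getLast?_eq_some_iff.mp hc
      cases M with
      | nil => simp at hM; obtain ⟨rfl, rfl⟩ := hM; simp at ha ⊢
      | cons y M =>
        simp at hM
        obtain ⟨rfl, rfl⟩ := hM
        have := List.pairwise_append.mp (dippingChain_cons.mp h).2.2.1
        simp only [List.mem_cons, List.mem_append, List.not_mem_nil, or_false] at ha
        rcases ha with rfl | ha | rfl
        · simp
        · rw [← orient_rotate, orient_swap, ← orient_rotate, ← orient_rotate]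
          have := this.2.2 a ha c (by simp)
          have e : orient x a c = orient c x a := by unfold orient; ring
          linarith
        · simp

theorem region_subset {C : Set (ℝ × ℝ)} (hC : Convex ℝ C) :
    ∀ {B : List (ℝ × ℝ)} {b x : ℝ × ℝ}, DippingChain g (b :: x :: B) →
      (∀ a ∈ b :: x :: B, a ∈ C) → region (b :: x :: B) ⊆ C := by
  intro B
  induction B with
  | nil =>
    intro b x h hC' p hp
    rw [mem_region_cons (c := x) (by simp)] at hp
    obtain ⟨h1, h2, h3, h4⟩ := hp
    simp at h1
    exact hC.segment_subset (hC' b (by simp)) (hC' x (by simp))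
      (mem_segment_of_orient ((dippingChain_cons.mp h).1 x (by simp)) (le_antisymm h1 h4) h2 h3)
  | cons y B ih =>
    intro b x h hC' p hp
    obtain ⟨c, hc⟩ : ∃ c, (y :: B).getLast? = some c := ⟨_, List.getLast?_cons⟩
    rw [mem_region_cons (c := c) (by simpa [List.getLast?_cons] using hc)] at hp
    obtain ⟨h1, h2, h3, h4⟩ := hp
    simp only [List.isChain_cons_cons] at h1
    rcases le_total (orient b y p) 0 with hle | hle
    · refine ih (b := b) (x := y) (h.sublist ?_) (fun a ha => hC' a ?_) ?_
      · exact List.Sublist.cons_cons _ (List.sublist_cons_self _ _)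
      · simp at ha ⊢; tauto
      · rw [mem_region_cons (c := c) (by simpa [List.getLast?_cons] using hc)]
        refine ⟨?_, h2, h3, h4⟩
        rw [List.isChain_cons_cons]
        exact ⟨hle, h1.2.2⟩
    · have ho : orient b x y < 0 := by
        have := (dippingChain_cons.mp h).2.2.1
        exact (List.pairwise_cons.mp this).1 y (by simp)
      refine hC.mem_of_orient (p := b) (q := y) (r := x) (hC' b (by simp)) (hC' y (by simp))
        (hC' x (by simp)) ?_ ?_ ?_ hle
      · have : orient b y x = - orient b x y := by unfold orient; ring
        linarith
      · rw [orient_swap]; linarith [h1.2.1]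
      · rw [orient_swap]; linarith [h1.1]

end DippingChain

theorem fst_le_of_orient {b v x p : ℝ × ℝ} (h₁ : b.1 < v.1) (h₂ : v.1 < x.1)
    (h : orient b v x < 0) (hb : orient b v p ≤ 0) (hx : 0 ≤ orient v x p) : v.1 ≤ p.1 := by
  have e : (x.1 - v.1) * orient b v p - (v.1 - b.1) * orient v x p =
    (p.1 - v.1) * orient b v x := by unfold orient; ring
  by_contra! hlt
  nlinarith [mul_pos_of_neg_of_neg (sub_neg.mpr hlt) h,
    mul_nonneg (sub_pos.mpr h₁).le hx, mul_nonneg (sub_pos.mpr h₂).le (neg_nonneg.mpr hb)]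

theorem le_fst_of_orient {v x y p : ℝ × ℝ} (h₁ : v.1 < x.1) (h₂ : x.1 < y.1)
    (h : orient v x y < 0) (hy : orient x y p ≤ 0) (hx : 0 ≤ orient v x p) : p.1 ≤ x.1 := by
  have e : (x.1 - v.1) * orient x y p - (y.1 - x.1) * orient v x p =
    -((p.1 - x.1) * orient v x y) := by unfold orient; ring
  by_contra! hlt
  nlinarith [mul_neg_of_pos_of_neg (sub_pos.mpr hlt) h,
    mul_nonneg (sub_pos.mpr h₂).le hx, mul_nonneg (sub_pos.mpr h₁).le (neg_nonneg.mpr hy)]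

theorem DippingChain.region_split {g : ℝ → ℝ} {b v x p : ℝ × ℝ} {A B : List (ℝ × ℝ)}
    (h : DippingChain g (b :: v :: A ++ x :: B)) (hp : p ∈ region (b :: v :: A ++ x :: B)) :
    p ∈ region (v :: A ++ [x]) ∨ p ∈ region (b :: v :: x :: B) := by
  obtain ⟨c, hc⟩ : ∃ c, (x :: B).getLast? = some c := ⟨_, List.getLast?_cons⟩
  have hc' : ∀ M, (M ++ x :: B).getLast? = some c := fun M => by
    rw [List.getLast?_append, hc]; rfl
  simp only [List.cons_append] at h hp ⊢
  rw [mem_region_cons (c := c) (by simpa using hc' (b :: v :: A))] at hp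
  obtain ⟨h1, h2, h3, h4⟩ := hp
  rw [List.isChain_cons_cons, ← List.cons_append, List.isChain_split] at h1
  obtain ⟨h11, h12, h13⟩ := h1
  obtain ⟨hb1, hb2, hb3, h'⟩ := dippingChain_cons.mp h
  obtain ⟨hv1, hv2, hv3, -⟩ := dippingChain_cons.mp h'
  have hbv := hb1 v (by simp)
  have hvx := hv1 x (by simp)
  rcases le_total 0 (orient v x p) with ho | ho
  · left
    rw [mem_region_cons (c := x) (by rw [← List.cons_append, List.getLast?_append]; simp)]
    refine ⟨h12, fst_le_of_orient hbv hvx ((List.pairwise_cons.mp hb3).1 x (by simp)) h11 ho, ?_,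
      ho⟩
    cases B with
    | nil => simp at hc; rw [hc]; exact h3
    | cons y B =>
      rw [List.isChain_cons_cons] at h13
      have h5 := (List.pairwise_append.mp hv3).2.1
      have h6 := h'.lt.of_cons
      exact le_fst_of_orient hvx ((List.pairwise_cons.mp (List.pairwise_append.mp h6).2.1).1 y
        (by simp)) ((List.pairwise_cons.mp h5).1 y (by simp)) h13.1 ho
  · right
    rw [mem_region_cons (c := c) (by simpa using hc' [b, v])]
    refine ⟨?_, h2, h3, h4⟩
    rw [List.isChain_cons_cons, List.isChain_cons_cons]
    exact ⟨h11, ho, h13⟩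

end Region

section Realization

variable {U : Type*}

namespace Peel

variable {L : List U} {I : Set U} {E : Set (Sym2 U)}

theorem mem_of_mem_edge (h : Peel L I E) : ∀ {u v : U}, s(u, v) ∈ E → u ∈ L ∨ u ∈ I := by
  induction h with
  | edge _ =>
    intro u v huv
    have : s(u, v) = _ := huv
    rw [Sym2.eq_iff] at this
    rcases this with ⟨rfl, -⟩ | ⟨rfl, -⟩ <;> simp
  | chord h₁ h₂ hA hd m₁ m₂ hL hI hE ih₁ ih₂ =>
    subst hL hI hE
    rintro u v (huv | huv)
    · have := ih₁ huv
      simp at this ⊢; tauto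
    · have := ih₂ huv
      simp at this ⊢; tauto
  | corner h hv hvI hL hI hE ih =>
    subst hL hI hE
    rintro u w (huv | ⟨y, hy, e⟩)
    · have := ih huv
      simp at this ⊢; tauto
    · rw [Sym2.eq_iff] at e
      rcases e with ⟨rfl, rfl⟩ | ⟨rfl, rfl⟩
      · simp
      · simp at hy ⊢; tauto

theorem ne_of_mem_edge (h : Peel L I E) : ∀ {u v : U}, s(u, v) ∈ E → u ≠ v := by
  induction h with
  | edge h =>
    intro u v huv
    have : s(u, v) = _ := huv
    rw [Sym2.eq_iff] at this
    rcases this with ⟨rfl, rfl⟩ | ⟨rfl, rfl⟩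
    · exact h
    · exact h.symm
  | chord h₁ h₂ hA hd m₁ m₂ hL hI hE ih₁ ih₂ =>
    subst hE
    rintro u v (huv | huv)
    · exact ih₁ huv
    · exact ih₂ huv
  | corner h hv hvI hL hI hE ih =>
    subst hE
    rintro u w (huv | ⟨y, hy, e⟩)
    · exact ih huv
    · rw [Sym2.eq_iff] at e
      rcases e with ⟨rfl, rfl⟩ | ⟨rfl, rfl⟩ <;> rintro rfl <;> exact hv (by simp at hy ⊢; tauto)

theorem nodup_disjoint (h : Peel L I E) : L.Nodup ∧ ∀ a ∈ L, a ∉ I := by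
  induction h with
  | edge h => simp [h]
  | @chord b v x A B L I₁ I₂ I E₁ E₂ E h₁ h₂ hA hd m₁ m₂ hL hI hE ih₁ ih₂ =>
    subst hL hI hE
    obtain ⟨n₁, d₁⟩ := ih₁
    obtain ⟨n₂, d₂⟩ := ih₂
    have hvx : ∀ a, a = v ∨ a = x → a ∉ I₁ ∧ a ∉ I₂ := by
      rintro a (rfl | rfl)
      · exact ⟨d₁ _ (by simp), d₂ _ (by simp)⟩
      · exact ⟨d₁ _ (by simp), d₂ _ (by simp)⟩
    have hb : b ∉ v :: A ++ [x] := by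
      intro hb
      have := hd b (Or.inl hb) (Or.inl (by simp))
      simp at n₂; tauto
    have hAB : ∀ a ∈ A, a ∉ B := by
      intro a ha haB
      rcases hd a (Or.inl (by simp [ha])) (Or.inl (by simp [haB])) with rfl | rfl
      · simp at n₁; tauto
      · simp [List.nodup_append] at n₁; tauto
    refine ⟨?_, ?_⟩
    · simp [List.nodup_append] at n₁ n₂ hb ⊢
      refine ⟨by tauto, by tauto, by tauto, by tauto, fun a ha => ⟨by tauto, ?_⟩⟩
      rintro c hc rfl
      exact hAB a ha hc
    · rintro a ha (hI | hI)
      · have ha' : a ∈ v :: A ++ [x] ∨ a ∈ b :: v :: x :: B := by simp at ha ⊢; tauto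
        rcases ha' with ha' | ha'
        · exact d₁ a ha' hI
        · exact (hvx a (hd a (Or.inr hI) (Or.inl ha'))).1 hI
      · have ha' : a ∈ v :: A ++ [x] ∨ a ∈ b :: v :: x :: B := by simp at ha ⊢; tauto
        rcases ha' with ha' | ha'
        · exact (hvx a (hd a (Or.inl ha') (Or.inr hI))).2 hI
        · exact d₂ a ha' hI
  | @corner b v x Z X L I I' E E' h hv hvI hL hI hE ih =>
    subst hL hI hE
    obtain ⟨n, d⟩ := ih
    simp [List.nodup_append] at n hv d ⊢
    refine ⟨by tauto, by tauto, by tauto, ⟨d.2 x (by tauto), fun h => (n.2.2.2 x h).1 rfl⟩,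
      fun a ha =>
      ⟨d.2 a (by tauto), fun haZ => (n.2.2.2 a haZ).2 a ha rfl⟩⟩

end Peel

/-- The union of the images of the vertices of `W` and of the segments representing the edges
of `E`. -/
def drawn (F : U → ℝ × ℝ) (W : Set U) (E : Set (Sym2 U)) : Set (ℝ × ℝ) :=
  F '' W ∪ {p | ∃ u v, s(u, v) ∈ E ∧ p ∈ segment ℝ (F u) (F v)}

/-- `F` draws the vertices `L` and `I` and the edges `E` without crossings inside the polygon
spanned by `L`, and every face inside this polygon meets the graph of `g` over `J`. -/
structure Realizes (J : Set ℝ) (g : ℝ → ℝ) (L : List U) (I : Set U) (E : Set (Sym2 U))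
    (F : U → ℝ × ℝ) : Prop where
  injOn : InjOn F {a | a ∈ L ∨ a ∈ I}
  mem_region : ∀ a, a ∈ L ∨ a ∈ I → F a ∈ region (L.map F)
  notMem_segment : ∀ u v w, s(u, v) ∈ E → w ∈ L ∨ w ∈ I → w ≠ u → w ≠ v →
    F w ∉ segment ℝ (F u) (F v)
  disjoint : ∀ u v u' v', s(u, v) ∈ E → s(u', v') ∈ E → s(u, v) ≠ s(u', v') →
    Disjoint (openSegment ℝ (F u) (F v)) (openSegment ℝ (F u') (F v'))
  face : ∀ p ∈ region (L.map F), p ∉ drawn F {a | a ∈ L ∨ a ∈ I} E →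
    ∃ C ⊆ region (L.map F), IsPreconnected C ∧ p ∈ C ∧
      Disjoint C (drawn F {a | a ∈ L ∨ a ∈ I} E) ∧ ∃ x ∈ J, (x, g x) ∈ C

theorem drawn_congr {F F' : U → ℝ × ℝ} {W : Set U} {E : Set (Sym2 U)} (h : EqOn F F' W)
    (hE : ∀ u v, s(u, v) ∈ E → u ∈ W ∧ v ∈ W) : drawn F W E = drawn F' W E := by
  unfold drawn
  rw [h.image_eq]
  congr 1
  ext p
  simp only [mem_ofPred_eq]
  refine exists_congr fun u => exists_congr fun v => and_congr_right fun huv => ?_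
  rw [h (hE u v huv).1, h (hE u v huv).2]

namespace Realizes

variable {J : Set ℝ} {g : ℝ → ℝ} {L : List U} {I : Set U} {E : Set (Sym2 U)} {F F' : U → ℝ × ℝ}

theorem congr (hP : Peel L I E) (h : Realizes J g L I E F)
    (hF : EqOn F F' {a | a ∈ L ∨ a ∈ I}) : Realizes J g L I E F' := by
  have hE : ∀ u v, s(u, v) ∈ E → u ∈ {a | a ∈ L ∨ a ∈ I} ∧ v ∈ {a | a ∈ L ∨ a ∈ I} :=
    fun u v huv => ⟨hP.mem_of_mem_edge huv, hP.mem_of_mem_edge (Sym2.eq_swap ▸ huv)⟩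
  have hmap : L.map F = L.map F' := List.map_congr_left fun a ha => hF (Or.inl ha)
  refine ⟨h.injOn.congr hF, ?_, ?_, ?_, ?_⟩
  · intro a ha
    rw [← hF ha, ← hmap]
    exact h.mem_region a ha
  · intro u v w huv hw
    rw [← hF hw, ← hF (hE u v huv).1, ← hF (hE u v huv).2]
    exact h.notMem_segment u v w huv hw
  · intro u v u' v' huv huv'
    rw [← hF (hE u v huv).1, ← hF (hE u v huv).2, ← hF (hE u' v' huv').1, ← hF (hE u' v' huv').2]
    exact h.disjoint u v u' v' huv huv'
  · rw [← hmap, ← drawn_congr hF hE]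
    exact h.face

theorem segment_subset (hP : Peel L I E) (h : Realizes J g L I E F) {u v : U} (huv : s(u, v) ∈ E) :
    segment ℝ (F u) (F v) ⊆ region (L.map F) :=
  (convex_region _).segment_subset (h.mem_region u (hP.mem_of_mem_edge huv))
    (h.mem_region v (hP.mem_of_mem_edge (Sym2.eq_swap ▸ huv)))

theorem drawn_subset (hP : Peel L I E) (h : Realizes J g L I E F) :
    drawn F {a | a ∈ L ∨ a ∈ I} E ⊆ region (L.map F) := by
  rintro p (⟨a, ha, rfl⟩ | ⟨u, v, huv, hp⟩)
  · exact h.mem_region a ha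
  · exact h.segment_subset hP huv hp

theorem notMem_openSegment (hP : Peel L I E) (h : Realizes J g L I E F) {u v w : U}
    (huv : s(u, v) ∈ E) (hw : w ∈ L ∨ w ∈ I) : F w ∉ openSegment ℝ (F u) (F v) := by
  intro hm
  have hu := hP.mem_of_mem_edge huv
  have hv := hP.mem_of_mem_edge (Sym2.eq_swap ▸ huv)
  have hne : F u ≠ F v := fun e => hP.ne_of_mem_edge huv (h.injOn hu hv e)
  rcases eq_or_ne w u with rfl | hwu
  · exact hne (left_mem_openSegment_iff.mp hm)
  rcases eq_or_ne w v with rfl | hwv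
  · exact hne (right_mem_openSegment_iff.mp hm)
  exact h.notMem_segment u v w huv hw hwu hwv (openSegment_subset_segment _ _ _ hm)

theorem of_edge {b c : U} (hL : DippingChain g ([b, c].map F)) :
    Realizes J g [b, c] ∅ {s(b, c)} F := by
  have hlt : (F b).1 < (F c).1 := (dippingChain_cons.mp hL).1 _ (by simp)
  have hne : F b ≠ F c := fun h => by rw [h] at hlt; exact lt_irrefl _ hlt
  refine ⟨?_, ?_, ?_, ?_, ?_⟩
  · rintro a ha a' ha' h
    simp at ha ha'
    rcases ha with rfl | rfl <;> rcases ha' with rfl | rfl <;> simp_all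
  · intro a ha
    simp only [mem_empty_iff_false, or_false] at ha
    exact hL.mem_region (List.mem_map_of_mem ha)
  · intro u v w huv hw h1 h2
    have : s(u, v) = s(b, c) := huv
    rw [Sym2.eq_iff] at this
    simp at hw
    rcases this with ⟨rfl, rfl⟩ | ⟨rfl, rfl⟩ <;> tauto
  · intro u v u' v' huv huv' hne
    exact absurd (huv.trans huv'.symm) hne
  · intro p hp hpd
    refine absurd (Or.inr ⟨b, c, rfl, ?_⟩) hpd
    exact DippingChain.region_subset (convex_segment _ _) (B := []) hL
      (by simp [left_mem_segment, right_mem_segment]) hp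

theorem of_chord {b v x : U} {A B : List U} {I₁ I₂ : Set U} {E₁ E₂ : Set (Sym2 U)}
    (hP₁ : Peel (v :: A ++ [x]) I₁ E₁) (hP₂ : Peel (b :: v :: x :: B) I₂ E₂)
    (hd : ∀ a, a ∈ v :: A ++ [x] ∨ a ∈ I₁ → a ∈ b :: v :: x :: B ∨ a ∈ I₂ → a = v ∨ a = x)
    (m₁ : s(v, x) ∈ E₁) (m₂ : s(v, x) ∈ E₂)
    (hL : DippingChain g ((b :: v :: A ++ x :: B).map F))
    (h₁ : Realizes J g (v :: A ++ [x]) I₁ E₁ F) (h₂ : Realizes J g (b :: v :: x :: B) I₂ E₂ F) :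
    Realizes J g (b :: v :: A ++ x :: B) (I₁ ∪ I₂) (E₁ ∪ E₂) F := by
  have hsub₁ : region ((v :: A ++ [x]).map F) ⊆ region ((b :: v :: A ++ x :: B).map F) := by
    have hmem : ∀ a ∈ (v :: A ++ [x]).map F, a ∈ region ((b :: v :: A ++ x :: B).map F) := by
      intro a ha
      obtain ⟨c, hc, rfl⟩ := List.mem_map.mp ha
      refine hL.mem_region (List.mem_map_of_mem ?_)
      simp at hc ⊢
      tauto
    have hch : DippingChain g ((v :: A ++ [x]).map F) := by
      refine hL.sublist (List.Sublist.map _ ?_)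
      simp
    cases A <;> exact DippingChain.region_subset (convex_region _) hch hmem
  have hsub₂ : region ((b :: v :: x :: B).map F) ⊆ region ((b :: v :: A ++ x :: B).map F) := by
    have hch : DippingChain g ((b :: v :: x :: B).map F) := by
      refine hL.sublist (List.Sublist.map _ ?_)
      simp
    refine DippingChain.region_subset (convex_region _) hch fun a ha => ?_
    obtain ⟨c, hc, rfl⟩ := List.mem_map.mp (show a ∈ (b :: v :: x :: B).map F from ha)
    refine hL.mem_region (List.mem_map_of_mem ?_)
    simp at hc ⊢
    tauto
  have hinter : region ((v :: A ++ [x]).map F) ∩ region ((b :: v :: x :: B).map F) ⊆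
      segment ℝ (F v) (F x) := by
    rintro p ⟨hp₁, hp₂⟩
    rw [List.cons_append, List.map_cons,
      mem_region_cons (c := F x) (by simp [List.getLast?_cons])] at hp₁
    have ho : orient (F v) (F x) p ≤ 0 := by
      have := hp₂.1
      simp only [List.map_cons, List.isChain_cons_cons] at this
      exact this.2.1
    refine mem_segment_of_orient ?_ (le_antisymm ho hp₁.2.2.2) hp₁.2.1 hp₁.2.2.1
    have := hL.lt
    simp only [List.map_append, List.map_cons, List.cons_append, List.pairwise_cons] at this
    exact this.2.1 _ (by simp)
  have hvx₁ : ∀ {p}, p ∈ segment ℝ (F v) (F x) →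
      p ∈ drawn F {a | a ∈ v :: A ++ [x] ∨ a ∈ I₁} E₁ := fun hp => Or.inr ⟨v, x, m₁, hp⟩
  have hvx₂ : ∀ {p}, p ∈ segment ℝ (F v) (F x) →
      p ∈ drawn F {a | a ∈ b :: v :: x :: B ∨ a ∈ I₂} E₂ := fun hp => Or.inr ⟨v, x, m₂, hp⟩
  have hW : ∀ a, a ∈ b :: v :: A ++ x :: B ∨ a ∈ I₁ ∪ I₂ ↔
      (a ∈ v :: A ++ [x] ∨ a ∈ I₁) ∨ (a ∈ b :: v :: x :: B ∨ a ∈ I₂) := by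
    intro a
    simp only [List.mem_cons, List.mem_append, List.cons_append, List.not_mem_nil, or_false,
      mem_union]
    grind
  have hdrawn : drawn F {a | a ∈ b :: v :: A ++ x :: B ∨ a ∈ I₁ ∪ I₂} (E₁ ∪ E₂) =
      drawn F {a | a ∈ v :: A ++ [x] ∨ a ∈ I₁} E₁ ∪
        drawn F {a | a ∈ b :: v :: x :: B ∨ a ∈ I₂} E₂ := by
    ext p
    constructor
    · rintro (⟨a, ha, rfl⟩ | ⟨u, w, huw | huw, hp⟩)
      · rcases (hW a).mp ha with ha | ha
        · exact Or.inl (Or.inl ⟨a, ha, rfl⟩)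
        · exact Or.inr (Or.inl ⟨a, ha, rfl⟩)
      · exact Or.inl (Or.inr ⟨u, w, huw, hp⟩)
      · exact Or.inr (Or.inr ⟨u, w, huw, hp⟩)
    · rintro ((⟨a, ha, rfl⟩ | ⟨u, w, huw, hp⟩) | (⟨a, ha, rfl⟩ | ⟨u, w, huw, hp⟩))
      · exact Or.inl ⟨a, (hW a).mpr (Or.inl ha), rfl⟩
      · exact Or.inr ⟨u, w, Or.inl huw, hp⟩
      · exact Or.inl ⟨a, (hW a).mpr (Or.inr ha), rfl⟩
      · exact Or.inr ⟨u, w, Or.inr huw, hp⟩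
  -- a vertex of one part that lies in the segment `v x` is `v` or `x`
  have hend₁ : ∀ a, a ∈ v :: A ++ [x] ∨ a ∈ I₁ → F a ∈ segment ℝ (F v) (F x) → a = v ∨ a = x := by
    intro a ha h
    by_contra! hc
    exact h₁.notMem_segment v x a m₁ ha hc.1 hc.2 h
  have hend₂ : ∀ a, a ∈ b :: v :: x :: B ∨ a ∈ I₂ → F a ∈ segment ℝ (F v) (F x) →
      a = v ∨ a = x := by
    intro a ha h
    by_contra! hc
    exact h₂.notMem_segment v x a m₂ ha hc.1 hc.2 h
  have hv₁ : ∀ a, a = v ∨ a = x → a ∈ v :: A ++ [x] ∨ a ∈ I₁ := by rintro a (rfl | rfl) <;> simp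
  have hv₂ : ∀ a, a = v ∨ a = x → a ∈ b :: v :: x :: B ∨ a ∈ I₂ := by rintro a (rfl | rfl) <;> simp
  have hdisj : ∀ u w u' w', s(u, w) ∈ E₁ → s(u', w') ∈ E₂ → s(u, w) ≠ s(u', w') →
      Disjoint (openSegment ℝ (F u) (F w)) (openSegment ℝ (F u') (F w')) := by
    intro u w u' w' huw huw' hne
    rw [Set.disjoint_left]
    intro p hp hp'
    have hp1 := h₁.segment_subset hP₁ huw (openSegment_subset_segment _ _ _ hp)
    have hp2 := h₂.segment_subset hP₂ huw' (openSegment_subset_segment _ _ _ hp')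
    have hvx := hinter ⟨hp1, hp2⟩
    by_cases e₁ : s(u, w) = s(v, x)
    · have e₂ : s(v, x) ≠ s(u', w') := e₁ ▸ hne
      have hpo : p ∈ openSegment ℝ (F v) (F x) := by
        rw [Sym2.eq_iff] at e₁
        rcases e₁ with ⟨rfl, rfl⟩ | ⟨rfl, rfl⟩
        · exact hp
        · rwa [openSegment_symm]
      exact Set.disjoint_left.mp (h₂.disjoint v x u' w' m₂ huw' e₂) hpo hp'
    · rw [← insert_endpoints_openSegment] at hvx
      rcases hvx with rfl | rfl | hvx
      · exact h₁.notMem_openSegment hP₁ huw (hv₁ v (Or.inl rfl)) hp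
      · exact h₁.notMem_openSegment hP₁ huw (hv₁ x (Or.inr rfl)) hp
      · exact Set.disjoint_left.mp (h₁.disjoint u w v x huw m₁ e₁) hp hvx
  refine ⟨?_, ?_, ?_, ?_, ?_⟩
  · intro a ha a' ha' h
    rcases (hW a).mp ha with ha | ha <;> rcases (hW a').mp ha' with ha' | ha'
    · exact h₁.injOn ha ha' h
    · have := hend₁ a ha (hinter ⟨h₁.mem_region a ha, h ▸ h₂.mem_region a' ha'⟩)
      exact h₂.injOn (hv₂ a this) ha' h
    · have := hend₁ a' ha' (hinter ⟨h₁.mem_region a' ha', h ▸ h₂.mem_region a ha⟩)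
      exact h₂.injOn ha (hv₂ a' this) h
    · exact h₂.injOn ha ha' h
  · intro a ha
    rcases (hW a).mp ha with ha | ha
    · exact hsub₁ (h₁.mem_region a ha)
    · exact hsub₂ (h₂.mem_region a ha)
  · rintro u w a (huw | huw) ha hu hw h
    · have : a ∈ v :: A ++ [x] ∨ a ∈ I₁ := by
        rcases (hW a).mp ha with ha | ha
        · exact ha
        · exact hv₁ a (hend₂ a ha (hinter ⟨h₁.segment_subset hP₁ huw h, h₂.mem_region a ha⟩))
      exact h₁.notMem_segment u w a huw this hu hw h
    · have : a ∈ b :: v :: x :: B ∨ a ∈ I₂ := by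
        rcases (hW a).mp ha with ha | ha
        · exact hv₂ a (hend₁ a ha (hinter ⟨h₁.mem_region a ha, h₂.segment_subset hP₂ huw h⟩))
        · exact ha
      exact h₂.notMem_segment u w a huw this hu hw h
  · rintro u w u' w' (huw | huw) (huw' | huw') hne
    · exact h₁.disjoint u w u' w' huw huw' hne
    · exact hdisj u w u' w' huw huw' hne
    · exact (hdisj u' w' u w huw' huw hne.symm).symm
    · exact h₂.disjoint u w u' w' huw huw' hne
  · rw [hdrawn]
    intro p hp hpd
    have hp' : p ∈ region ((v :: A ++ [x]).map F) ∨ p ∈ region ((b :: v :: x :: B).map F) := by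
      have hs : (b :: v :: A ++ x :: B).map F = F b :: F v :: A.map F ++ F x :: B.map F := by simp
      rw [hs] at hL hp
      simpa using hL.region_split hp
    rcases hp' with hp' | hp'
    · obtain ⟨C, hC, hconn, hpC, hCd, hx⟩ := h₁.face p hp' fun h => hpd (Or.inl h)
      refine ⟨C, hC.trans hsub₁, hconn, hpC, ?_, hx⟩
      rw [Set.disjoint_union_right]
      refine ⟨hCd, Set.disjoint_left.mpr fun q hq hq' => ?_⟩
      exact Set.disjoint_left.mp hCd hq (hvx₁ (hinter ⟨hC hq, h₂.drawn_subset hP₂ hq'⟩))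
    · obtain ⟨C, hC, hconn, hpC, hCd, hx⟩ := h₂.face p hp' fun h => hpd (Or.inr h)
      refine ⟨C, hC.trans hsub₂, hconn, hpC, ?_, hx⟩
      rw [Set.disjoint_union_right]
      refine ⟨Set.disjoint_left.mpr fun q hq hq' => ?_, hCd⟩
      exact Set.disjoint_left.mp hCd hq (hvx₂ (hinter ⟨h₁.drawn_subset hP₁ hq', hC hq⟩))

end Realizes

end Realization

section Corner

theorem List.exists_consecutive_of_mem {α : Type*} {l : List α} {y : α} (hy : y ∈ l)
    (hl : 2 ≤ l.length) : ∃ P Q s t, l = P ++ s :: t :: Q ∧ (y = s ∨ y = t) := by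
  obtain ⟨P, Q, rfl⟩ := List.append_of_mem hy
  rcases Q with _ | ⟨t, Q⟩
  · rcases List.eq_nil_or_concat P with rfl | ⟨P', s, rfl⟩
    · simp at hl
    · exact ⟨P', [], s, y, by simp, Or.inr rfl⟩
  · exact ⟨P, Q, y, t, rfl, Or.inl rfl⟩

theorem List.exists_sign_change {α : Type*} (φ : α → ℝ) : ∀ (Z : List α) (b x : α), 0 ≤ φ b →
    φ x ≤ 0 → ∃ P Q y y', b :: Z ++ [x] = P ++ y :: y' :: Q ∧ 0 ≤ φ y ∧ φ y' ≤ 0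
  | [], b, x, hb, hx => ⟨[], [], b, x, rfl, hb, hx⟩
  | z :: Z, b, x, hb, hx => by
    rcases le_total (φ z) 0 with hz | hz
    · exact ⟨[], Z ++ [x], b, z, rfl, hb, hz⟩
    · obtain ⟨P, Q, y, y', h, hy, hy'⟩ := exists_sign_change φ Z z x hz hx
      exact ⟨b :: P, Q, y, y', by simpa using h, hy, hy'⟩

theorem mem_segment_of_orient_eq_zero {p q r s : ℝ × ℝ} (h : 0 < orient p q r)
    (h₁ : orient q r s = 0) (h₂ : 0 ≤ orient r p s) (h₃ : 0 ≤ orient p q s) :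
    s ∈ segment ℝ q r := by
  have hsum : orient q r s + orient r p s + orient p q s = orient p q r := by
    unfold orient; ring
  have e₁ : orient q r s * p.1 + orient r p s * q.1 + orient p q s * r.1 = orient p q r * s.1 := by
    unfold orient; ring
  have e₂ : orient q r s * p.2 + orient r p s * q.2 + orient p q s * r.2 = orient p q r * s.2 := by
    unfold orient; ring
  rw [h₁] at hsum e₁ e₂
  refine ⟨orient r p s / orient p q r, orient p q s / orient p q r, by positivity, by positivity,
    ?_, ?_⟩
  · rw [← add_div, div_eq_one_iff_eq h.ne']; linarith
  · ext
    · simp only [Prod.fst_add, Prod.smul_fst, smul_eq_mul]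
      field_simp
      linarith
    · simp only [Prod.snd_add, Prod.smul_snd, smul_eq_mul]
      field_simp
      linarith

theorem disjoint_openSegment_of_orient_ne_zero {p q r : ℝ × ℝ} (h : orient p q r ≠ 0) :
    Disjoint (openSegment ℝ p q) (openSegment ℝ p r) := by
  rw [Set.disjoint_left]
  rintro _ ⟨a, b, ha, hb, hab, rfl⟩ ⟨a', b', ha', hb', hab', e⟩
  have h1 := orient_combo p q p q hab
  rw [← e, orient_combo p q p r hab'] at h1
  simp [h, hb'.ne'] at h1

/-- The interior of the triangle `p q r`. -/
def triangle (p q r : ℝ × ℝ) : Set (ℝ × ℝ) :=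
  {s | 0 < orient p q s ∧ 0 < orient q r s ∧ 0 < orient r p s}

theorem convex_triangle (p q r : ℝ × ℝ) : Convex ℝ (triangle p q r) :=
  (convex_setOf_orient_pos p q).inter
    ((convex_setOf_orient_pos q r).inter (convex_setOf_orient_pos r p))

theorem triangle_subset {C : Set (ℝ × ℝ)} (hC : Convex ℝ C) {p q r : ℝ × ℝ} (hp : p ∈ C)
    (hq : q ∈ C) (hr : r ∈ C) : triangle p q r ⊆ C := by
  rintro s ⟨h1, h2, h3⟩
  refine hC.mem_of_orient hp hq hr ?_ h2.le h3.le h1.le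
  have hsum : orient q r s + orient r p s + orient p q s = orient p q r := by
    unfold orient; ring
  linarith

theorem mem_closure_triangle {p q r s c : ℝ × ℝ} (hc : c ∈ triangle p q r) (h₁ : 0 ≤ orient p q s)
    (h₂ : 0 ≤ orient q r s) (h₃ : 0 ≤ orient r p s) : s ∈ closure (triangle p q r) := by
  refine closure_mono ?_ (segment_subset_closure_openSegment (𝕜 := ℝ) (left_mem_segment ℝ s c))
  rintro _ ⟨a, b, ha, hb, hab, rfl⟩
  obtain ⟨k1, k2, k3⟩ := hc
  refine ⟨?_, ?_, ?_⟩ <;> rw [orient_combo _ _ _ _ hab] <;> positivity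

open Filter Topology in
theorem IsArc.exists_mem_triangle {J : Set ℝ} {g m : ℝ → ℝ} (hJ : IsArc J g m) {y y' v p : ℝ × ℝ}
    (hy : y.1 ∈ J) (hy' : y'.1 ∈ J) (hv : v.1 ∈ J) (hgy : g y.1 < y.2) (hd : Dips g y y')
    (hp : p ∈ triangle y y' v) : ∃ x ∈ J, (x, g x) ∈ triangle y y' v := by
  have hD : triangle y y' v ⊆ {q | q.1 ∈ J} :=
    triangle_subset (hJ.ordConnected.convex.linear_preimage (LinearMap.fst ℝ ℝ ℝ)) hy hy' hv
  have hcont : ContinuousOn (fun q : ℝ × ℝ => q.2 - g q.1) {q | q.1 ∈ J} :=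
    continuousOn_snd.sub (hJ.continuousOn.comp continuousOn_fst fun q hq => hq)
  have hΔ : 0 < orient y y' v := by
    obtain ⟨h1, h2, h3⟩ := hp
    have hsum : orient y' v p + orient v y p + orient y y' p = orient y y' v := by
      unfold orient; ring
    linarith
  have hz : orient y y' y' = 0 := by unfold orient; ring
  have hyΔ : y ∈ closure (triangle y y' v) := by
    refine mem_closure_triangle hp ?_ ?_ ?_
    · simp
    · rw [orient_rotate]; exact hΔ.le
    · unfold orient; ring_nf; rfl
  obtain ⟨x₀, hx₀, hdip⟩ := hd
  have hx₀J : x₀ ∈ J := hJ.ordConnected.out hy hy' ⟨hx₀.1.le, hx₀.2.le⟩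
  obtain ⟨a, b, ha, hb, hab, e⟩ : x₀ ∈ openSegment ℝ y.1 y'.1 := by
    rw [openSegment_eq_Ioo (hx₀.1.trans hx₀.2)]; exact hx₀
  set d := a • y + b • y' with hd
  have hd1 : d.1 = x₀ := e
  have hdΔ : d ∈ closure (triangle y y' v) := by
    refine mem_closure_triangle hp ?_ ?_ ?_
    · rw [hd, orient_combo _ _ _ _ hab, hz]; simp
    · rw [hd, orient_combo _ _ _ _ hab, orient_rotate, orient_eq_left]; nlinarith
    · have e1 : orient v y y = 0 := by simp
      have e2 : orient v y y' = orient y y' v := by unfold orient; ring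
      rw [hd, orient_combo _ _ _ _ hab, e1, e2]
      positivity
  have hd2 : d.2 < g x₀ := by
    have e1 : orient y y' d = 0 := by rw [hd, orient_combo _ _ _ _ hab, hz]; simp
    have hlt := sub_pos.mpr (hx₀.1.trans hx₀.2)
    rw [← hd1] at hdip
    unfold orient at e1 hdip
    simp only at hdip
    rw [← hd1]
    nlinarith
  have key : ∀ s ∈ closure (triangle y y' v), s.1 ∈ J →
      (𝓝[triangle y y' v] s).NeBot ∧ Tendsto (fun q : ℝ × ℝ => q.2 - g q.1) (𝓝[triangle y y' v] s)
        (𝓝 (s.2 - g s.1)) := fun s hs hsJ =>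
    ⟨mem_closure_iff_nhdsWithin_neBot.mp hs, ((hcont s hsJ).mono hD)⟩
  obtain ⟨h1, t1⟩ := key y hyΔ hy
  obtain ⟨h2, t2⟩ := key d hdΔ (hd1 ▸ hx₀J)
  obtain ⟨q1, hq1, m1⟩ :=
    ((t1.eventually_const_lt (sub_pos.mpr hgy)).and self_mem_nhdsWithin).exists
  obtain ⟨q2, hq2, m2⟩ := ((t2.eventually_lt_const (u := 0) (by rw [hd1]; linarith)).and
    self_mem_nhdsWithin).exists
  obtain ⟨q, hq, hq0⟩ := (convex_triangle y y' v).isPreconnected.intermediate_value m2 m1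
    (hcont.mono hD) (show (0 : ℝ) ∈ Icc _ _ from ⟨hq2.le, hq1.le⟩)
  refine ⟨q.1, hD hq, ?_⟩
  have : g q.1 = q.2 := by simp only at hq0; linarith
  rw [this]; exact hq

/-- Replacing the boundary vertices `Z` between `b` and `x` by the single vertex `v` enlarges the
region. -/
theorem region_corner_subset {g : ℝ → ℝ} {b v x : ℝ × ℝ} {Z X : List (ℝ × ℝ)}
    (hlo : DippingChain g (b :: Z ++ x :: X)) (hup : DippingChain g (b :: v :: x :: X))
    (hZ : ∀ z ∈ Z, orient b v z < 0 ∧ orient v x z < 0) :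
    region (b :: Z ++ x :: X) ⊆ region (b :: v :: x :: X) := by
  obtain ⟨c, hc⟩ : ∃ c, (x :: X).getLast? = some c := ⟨_, List.getLast?_cons⟩
  have hmem : ∀ a ∈ b :: Z ++ x :: X, a ∈ region (b :: v :: x :: X) := by
    intro a ha
    by_cases haZ : a ∈ Z
    · have h := hlo.mem_region ha
      rw [List.cons_append, mem_region_cons (c := c)
        (by rw [← List.cons_append, List.getLast?_append, hc]; rfl)] at h
      rw [mem_region_cons (c := c) (by simpa [List.getLast?_cons] using hc)]
      rw [← List.cons_append] at h
      refine ⟨?_, h.2⟩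
      simp only [List.isChain_cons_cons]
      exact ⟨(hZ a haZ).1.le, (hZ a haZ).2.le, (List.isChain_split.mp h.1).2⟩
    · refine hup.mem_region ?_
      simp at ha ⊢
      tauto
  cases Z <;> exact DippingChain.region_subset (convex_region _) hlo hmem

theorem eq_of_mem_region_of_mem_segment {b v x y q : ℝ × ℝ} {Z X : List (ℝ × ℝ)}
    (hvis : (b :: Z ++ [x]).Pairwise fun y y' => 0 < orient y y' v) (hy : y ∈ b :: Z ++ [x])
    (hq : q ∈ region (b :: Z ++ x :: X)) (hs : q ∈ segment ℝ v y) : q = y := by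
  obtain ⟨P, Q, s, t, hl, hst⟩ := List.exists_consecutive_of_mem hy (by simp)
  have h1 : orient s t q ≤ 0 := by
    have := List.isChain_iff_forall_rel_of_append_cons_cons.mp hq.1
    refine @this s t P (Q ++ X) ?_
    have e : b :: Z ++ x :: X = (b :: Z ++ [x]) ++ X := by simp
    rw [e, hl]; simp
  have h2 : 0 < orient s t v := by
    rw [hl] at hvis
    have := (List.pairwise_append.mp hvis).2.1
    simp only [List.pairwise_cons] at this
    exact this.1 t (by simp)
  have h3 : orient s t y = 0 := by
    rcases hst with rfl | rfl <;> unfold orient <;> ring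
  obtain ⟨α, β, hα, hβ, hab, rfl⟩ := hs
  rw [orient_combo _ _ _ _ hab, h3] at h1
  obtain rfl : α = 0 := by
    by_contra hne
    have : 0 < α := lt_of_le_of_ne hα (Ne.symm hne)
    nlinarith [mul_pos this h2]
  obtain rfl : β = 1 := by linarith
  simp

/-- A point of the region below `v` either lies in the region below `Z` or in a triangle spanned by
`v` and consecutive vertices of `Z`. -/
theorem mem_region_of_wedge {g : ℝ → ℝ} {b v x p y y' : ℝ × ℝ} {Z X P Q : List (ℝ × ℝ)}
    (hlo : DippingChain g (b :: Z ++ x :: X))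
    (hvis : (b :: Z ++ [x]).Pairwise fun y y' => 0 < orient y y' v)
    (hl : b :: Z ++ [x] = P ++ y :: y' :: Q) (hp : p ∈ region (b :: v :: x :: X))
    (h₁ : 0 ≤ orient v y p) (h₂ : orient v y' p ≤ 0) (h₃ : orient y y' p ≤ 0) :
    p ∈ region (b :: Z ++ x :: X) := by
  obtain ⟨c, hc⟩ : ∃ c, (x :: X).getLast? = some c := ⟨_, List.getLast?_cons⟩
  rw [mem_region_cons (c := c) (by simpa [List.getLast?_cons] using hc)] at hp
  rw [List.cons_append, mem_region_cons (c := c)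
    (by rw [← List.cons_append, List.getLast?_append, hc]; rfl), ← List.cons_append]
  refine ⟨?_, hp.2⟩
  obtain ⟨hp, -⟩ := hp
  simp only [List.isChain_cons_cons] at hp
  rw [List.isChain_split]
  refine ⟨?_, hp.2.2⟩
  rw [List.isChain_iff_forall_rel_of_append_cons_cons]
  intro s t P' Q' e
  have e' : b :: Z ++ x :: X = P' ++ s :: t :: (Q' ++ X) := by
    have : b :: Z ++ x :: X = (b :: Z ++ [x]) ++ X := by simp
    rw [this, e]; simp
  have hmem : ∀ a ∈ b :: Z ++ [x], a ∈ b :: Z ++ x :: X := by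
    intro a ha
    simp at ha ⊢
    tauto
  have hy := hlo.orient_nonpos e' (hmem y (by rw [hl]; simp))
  have hy' := hlo.orient_nonpos e' (hmem y' (by rw [hl]; simp))
  have hst : 0 < orient s t v := by
    rw [e] at hvis
    have := (List.pairwise_append.mp hvis).2.1
    simp only [List.pairwise_cons] at this
    exact this.1 t (by simp)
  have hyy' : 0 < orient y y' v := by
    rw [hl] at hvis
    have := (List.pairwise_append.mp hvis).2.1
    simp only [List.pairwise_cons] at this
    exact this.1 y' (by simp)
  have key := orient_mul_orient y y' v p s t
  have h₂' := orient_swap v y' p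
  by_contra! hpos
  nlinarith [mul_pos hyy' hpos, mul_nonneg (neg_nonneg.mpr h₂) (neg_nonneg.mpr hy),
    mul_nonneg h₁ (neg_nonneg.mpr hy'), mul_nonneg (neg_nonneg.mpr h₃) hst.le]

theorem notMem_triangle_of_mem_segment {v y y' w q : ℝ × ℝ} {l P Q : List (ℝ × ℝ)}
    (hvis : l.Pairwise fun y y' => 0 < orient y y' v) (hl : l = P ++ y :: y' :: Q) (hw : w ∈ l)
    (hq : q ∈ segment ℝ v w) : q ∉ triangle y y' v := by
  rintro ⟨h1, h2, h3⟩
  obtain ⟨a, b, ha, hb, hab, rfl⟩ := hq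
  subst hl
  rw [orient_combo _ _ _ _ hab] at h2 h3
  have e1 : orient y' v v = 0 := by unfold orient; ring
  have e2 : orient v y v = 0 := by simp
  rw [e1] at h2
  rw [e2] at h3
  obtain ⟨-, hv2, hv3⟩ := List.pairwise_append.mp hvis
  simp only [List.pairwise_cons] at hv2
  simp only [List.mem_append, List.mem_cons] at hw
  rcases hw with hw | rfl | rfl | hw
  · have := hv3 w hw y (by simp)
    have e : orient v y w = -orient w y v := by unfold orient; ring
    nlinarith [mul_nonneg hb this.le]
  · simp at h3
  · simp at h2
  · have := hv2.2.1 w hw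
    have e : orient y' v w = -orient y' w v := by unfold orient; ring
    nlinarith [mul_nonneg hb this.le]

end Corner

section Realization

variable {U : Type*} {J : Set ℝ} {g m : ℝ → ℝ}

theorem Realizes.of_corner {b v x : U} {Z X : List U} {I : Set U} {E : Set (Sym2 U)}
    {F : U → ℝ × ℝ} (hJ : IsArc J g m) (hP : Peel (b :: Z ++ x :: X) I E)
    (hv : v ∉ b :: Z ++ x :: X) (hvI : v ∉ I)
    (hlo : GoodChain J g m ((b :: Z ++ x :: X).map F))
    (hup : GoodChain J g m ((b :: v :: x :: X).map F))
    (hvis : ((b :: Z ++ [x]).map F).Pairwise fun y y' => 0 < orient y y' (F v))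
    (hZ : ∀ z ∈ Z.map F, orient (F b) (F v) z < 0 ∧ orient (F v) (F x) z < 0)
    (h : Realizes J g (b :: Z ++ x :: X) I E F) :
    Realizes J g (b :: v :: x :: X) (I ∪ {z | z ∈ Z})
      (E ∪ {e | ∃ y ∈ b :: Z ++ [x], e = s(v, y)}) F := by
  have elo : (b :: Z ++ x :: X).map F = F b :: Z.map F ++ F x :: X.map F := by simp
  have eup : (b :: v :: x :: X).map F = F b :: F v :: F x :: X.map F := by simp
  have est : (b :: Z ++ [x]).map F = F b :: Z.map F ++ [F x] := by simp
  have hsub : region ((b :: Z ++ x :: X).map F) ⊆ region ((b :: v :: x :: X).map F) := by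
    rw [elo] at hlo ⊢
    rw [eup] at hup ⊢
    exact region_corner_subset hlo.toDippingChain hup.toDippingChain hZ
  have hst : ∀ y ∈ b :: Z ++ [x], y ∈ b :: Z ++ x :: X := by
    intro y hy
    simp at hy ⊢
    tauto
  have hA : ∀ y ∈ b :: Z ++ [x], ∀ q ∈ segment ℝ (F v) (F y),
      q ∈ region ((b :: Z ++ x :: X).map F) → q = F y := by
    intro y hy q hq hqr
    rw [elo] at hqr
    rw [est] at hvis
    exact eq_of_mem_region_of_mem_segment hvis (est ▸ List.mem_map_of_mem hy) hqr hq
  have hvlo : F v ∉ region ((b :: Z ++ x :: X).map F) := by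
    intro hmem
    have h1 := hA b (by simp) (F v) (left_mem_segment _ _ _) hmem
    have h2 := hup.lt
    rw [eup, List.pairwise_cons] at h2
    have := h2.1 (F v) (by simp)
    rw [h1] at this
    exact lt_irrefl _ this
  have hW : ∀ a, a ∈ b :: v :: x :: X ∨ a ∈ I ∪ {z | z ∈ Z} ↔
      a = v ∨ (a ∈ b :: Z ++ x :: X ∨ a ∈ I) := by
    intro a
    simp only [List.mem_cons, List.mem_append, List.cons_append, mem_union, mem_ofPred_eq]
    tauto
  have hne : ∀ a, a ∈ b :: Z ++ x :: X ∨ a ∈ I → F a ≠ F v := by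
    intro a ha e
    exact hvlo (e ▸ h.mem_region a ha)
  have hstar : ∀ y ∈ b :: Z ++ [x], ∀ a, a ∈ b :: v :: x :: X ∨ a ∈ I ∪ {z | z ∈ Z} → a ≠ v →
      a ≠ y → F a ∉ segment ℝ (F v) (F y) := by
    intro y hy a ha hav hay hmem
    have ha' := ((hW a).mp ha).resolve_left hav
    exact hay (h.injOn ha' (Or.inl (hst y hy)) (hA y hy _ hmem (h.mem_region a ha')))
  have hold : ∀ u w, s(u, w) ∈ E → ∀ y ∈ b :: Z ++ [x],
      Disjoint (openSegment ℝ (F u) (F w)) (openSegment ℝ (F v) (F y)) := by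
    intro u w huw y hy
    rw [Set.disjoint_left]
    intro q hq hq'
    have := hA y hy q (openSegment_subset_segment _ _ _ hq')
      (h.segment_subset hP huw (openSegment_subset_segment _ _ _ hq))
    exact h.notMem_openSegment hP huw (Or.inl (hst y hy)) (this ▸ hq)
  have hnew : ∀ y ∈ b :: Z ++ [x], ∀ w ∈ b :: Z ++ [x], y ≠ w →
      Disjoint (openSegment ℝ (F v) (F y)) (openSegment ℝ (F v) (F w)) := by
    intro y hy w hw hyw
    apply disjoint_openSegment_of_orient_ne_zero
    rw [List.pairwise_map] at hvis
    let R : U → U → Prop := fun y w => orient (F v) (F y) (F w) ≠ 0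
    have hR : Std.Symm R := ⟨fun y w hyw e => hyw (by
      have : orient (F v) (F y) (F w) = - orient (F v) (F w) (F y) := by unfold orient; ring
      rw [this, e, neg_zero])⟩
    have hp : (b :: Z ++ [x]).Pairwise R := hvis.imp fun {y w} hyw => by
      rw [← orient_rotate] at hyw
      rw [← orient_rotate] at hyw
      exact hyw.ne'
    exact hp.forall hy hw hyw
  refine ⟨?_, ?_, ?_, ?_, ?_⟩
  · intro a ha a' ha' e
    rcases (hW a).mp ha with rfl | h₁ <;> rcases (hW a').mp ha' with rfl | h₂
    · rfl
    · exact absurd e.symm (hne _ h₂)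
    · exact absurd e (hne _ h₁)
    · exact h.injOn h₁ h₂ e
  · intro a ha
    rcases (hW a).mp ha with rfl | ha
    · exact hup.mem_region (List.mem_map_of_mem (by simp))
    · exact hsub (h.mem_region a ha)
  · rintro u w a (huw | ⟨y, hy, e⟩) ha hau haw
    · rcases (hW a).mp ha with rfl | ha
      · exact fun hmem => hvlo (h.segment_subset hP huw hmem)
      · exact h.notMem_segment u w a huw ha hau haw
    · rw [Sym2.eq_iff] at e
      rcases e with ⟨rfl, rfl⟩ | ⟨rfl, rfl⟩
      · exact hstar w hy a ha hau haw
      · rw [segment_symm]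
        exact hstar u hy a ha haw hau
  · have hopen : ∀ u w y, s(u, w) = s(v, y) →
        openSegment ℝ (F u) (F w) = openSegment ℝ (F v) (F y) := by
      intro u w y e
      rw [Sym2.eq_iff] at e
      rcases e with ⟨rfl, rfl⟩ | ⟨rfl, rfl⟩
      · rfl
      · exact openSegment_symm _ _ _
    rintro u w u' w' (huw | ⟨y, hy, e⟩) (huw' | ⟨y', hy', e'⟩) huu'
    · exact h.disjoint u w u' w' huw huw' huu'
    · rw [hopen _ _ _ e']
      exact hold u w huw y' hy'
    · rw [hopen _ _ _ e]
      exact (hold u' w' huw' y hy).symm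
    · rw [hopen _ _ _ e, hopen _ _ _ e']
      refine hnew y hy y' hy' ?_
      rintro rfl
      exact huu' (e.trans e'.symm)
  · have hdrawn : ∀ q, q ∈ drawn F {a | a ∈ b :: v :: x :: X ∨ a ∈ I ∪ {z | z ∈ Z}}
        (E ∪ {e | ∃ y ∈ b :: Z ++ [x], e = s(v, y)}) ↔
        q ∈ drawn F {a | a ∈ b :: Z ++ x :: X ∨ a ∈ I} E ∨
          ∃ y ∈ b :: Z ++ [x], q ∈ segment ℝ (F v) (F y) := by
      intro q
      constructor
      · rintro (⟨a, ha, rfl⟩ | ⟨u, w, huw | ⟨y, hy, e⟩, hq⟩)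
        · rcases (hW a).mp ha with rfl | ha
          · exact Or.inr ⟨b, by simp, left_mem_segment _ _ _⟩
          · exact Or.inl (Or.inl ⟨a, ha, rfl⟩)
        · exact Or.inl (Or.inr ⟨u, w, huw, hq⟩)
        · rw [Sym2.eq_iff] at e
          rcases e with ⟨rfl, rfl⟩ | ⟨rfl, rfl⟩
          · exact Or.inr ⟨w, hy, hq⟩
          · exact Or.inr ⟨u, hy, segment_symm ℝ (F u) (F w) ▸ hq⟩
      · rintro ((⟨a, ha, rfl⟩ | ⟨u, w, huw, hq⟩) | ⟨y, hy, hq⟩)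
        · exact Or.inl ⟨a, (hW a).mpr (Or.inr ha), rfl⟩
        · exact Or.inr ⟨u, w, Or.inl huw, hq⟩
        · exact Or.inr ⟨v, y, Or.inr ⟨y, hy, rfl⟩, hq⟩
    intro p hp hpd
    rw [hdrawn] at hpd
    push Not at hpd
    obtain ⟨hpd, hps⟩ := hpd
    obtain ⟨P, Q, y, y', hl, hy, hy'⟩ := List.exists_sign_change
      (fun y => orient (F v) (F y) p) Z b x
      (by
        have := hp.1
        simp only [List.map_cons, List.isChain_cons_cons] at this
        have h1 := this.1
        rw [orient_swap] at h1
        linarith)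
      (by
        have := hp.1
        simp only [List.map_cons, List.isChain_cons_cons] at this
        exact this.2.1)
    have hyst : y ∈ b :: Z ++ [x] := by rw [hl]; simp
    have hyst' : y' ∈ b :: Z ++ [x] := by rw [hl]; simp
    have hl' : (b :: Z ++ [x]).map F = P.map F ++ F y :: F y' :: Q.map F := by rw [hl]; simp
    rcases le_or_gt (orient (F y) (F y') p) 0 with hle | hgt
    · have hplo : p ∈ region ((b :: Z ++ x :: X).map F) := by
        rw [elo] at hlo ⊢
        rw [eup] at hp
        rw [est] at hvis hl'
        exact mem_region_of_wedge hlo.toDippingChain hvis hl' hp hy hy' hle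
      obtain ⟨C, hC, hconn, hpC, hCd, hx⟩ := h.face p hplo hpd
      refine ⟨C, hC.trans hsub, hconn, hpC, Set.disjoint_left.mpr fun q hq hqd => ?_, hx⟩
      rcases (hdrawn q).mp hqd with hqd | ⟨w, hw, hqw⟩
      · exact Set.disjoint_left.mp hCd hq hqd
      · refine Set.disjoint_left.mp hCd hq (Or.inl ⟨w, Or.inl (hst w hw), ?_⟩)
        exact (hA w hw q hqw (hC hq)).symm
    · have hΔ : 0 < orient (F y) (F y') (F v) := by
        rw [hl'] at hvis
        have := (List.pairwise_append.mp hvis).2.1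
        simp only [List.pairwise_cons] at this
        exact this.1 _ (by simp)
      have hy'' : 0 ≤ orient (F y') (F v) p := by rw [orient_swap]; linarith
      have h1 : 0 < orient (F v) (F y) p := by
        refine lt_of_le_of_ne hy fun e => hps y hyst ?_
        refine mem_segment_of_orient_eq_zero (p := F y') ?_ e.symm hgt.le hy''
        rwa [← orient_rotate] at hΔ
      have h2 : 0 < orient (F y') (F v) p := by
        refine lt_of_le_of_ne hy'' fun e => hps y' hyst' ?_
        rw [segment_symm]
        exact mem_segment_of_orient_eq_zero hΔ e.symm hy hgt.le
      have hpt : p ∈ triangle (F y) (F y') (F v) := ⟨hgt, h2, h1⟩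
      have hsubt : triangle (F y) (F y') (F v) ⊆ region ((b :: v :: x :: X).map F) :=
        triangle_subset (convex_region _) (hsub (h.mem_region y (Or.inl (hst y hyst))))
          (hsub (h.mem_region y' (Or.inl (hst y' hyst'))))
          (hup.mem_region (List.mem_map_of_mem (by simp)))
      have hgood : ∀ a ∈ b :: Z ++ [x], IsGood J g m (F a) := fun a ha =>
        hlo.good _ (List.mem_map_of_mem (hst a ha))
      refine ⟨_, hsubt, (convex_triangle _ _ _).isPreconnected, hpt,
        Set.disjoint_left.mpr fun q hq hqd => ?_, hJ.exists_mem_triangle (hgood y hyst).1.1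
        (hgood y' hyst').1.1 (hup.good (F v) (List.mem_map_of_mem (by simp))).1.1
        (hgood y hyst).2 ?_ hpt⟩
      · rcases (hdrawn q).mp hqd with hqd | ⟨w, hw, hqw⟩
        · have hql := (h.drawn_subset hP hqd).1
          rw [List.isChain_iff_forall_rel_of_append_cons_cons] at hql
          refine absurd (@hql (F y) (F y') (P.map F) (Q.map F ++ X.map F) ?_) (not_le.mpr hq.1)
          have e : b :: Z ++ x :: X = (b :: Z ++ [x]) ++ X := by simp
          rw [e, List.map_append, hl']
          simp
        · exact notMem_triangle_of_mem_segment hvis hl' (List.mem_map_of_mem hw) hqw hq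
      · have hd : ((b :: Z ++ [x]).map F).Pairwise (Dips g) := by
          refine hlo.dips.sublist (List.Sublist.map _ ?_)
          simp
        rw [hl'] at hd
        have := (List.pairwise_append.mp hd).2.1
        simp only [List.pairwise_cons] at this
        exact this.1 _ (by simp)

theorem List.exists_map_eq {α β : Type*} (F : α → β) : ∀ {Z : List α} {Y : List β}, Z.Nodup →
    Y.length = Z.length → ∃ F' : α → β, Z.map F' = Y ∧ ∀ a ∉ Z, F' a = F a
  | [], Y, _, h => ⟨F, by simp_all, by simp⟩
  | z :: Z, [], _, h => by simp at h
  | z :: Z, y :: Y, hn, h => by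
    classical
    obtain ⟨F', h1, h2⟩ := exists_map_eq F (List.nodup_cons.mp hn).2 (Y := Y) (by simpa using h)
    refine ⟨Function.update F' z y, ?_, fun a ha => ?_⟩
    · rw [List.map_cons, Function.update_self, ← h1]
      congr 1
      refine List.map_congr_left fun a ha => Function.update_of_ne ?_ _ _
      rintro rfl
      exact (List.nodup_cons.mp hn).1 ha
    · rw [List.mem_cons, not_or] at ha
      rw [Function.update_of_ne ha.1, h2 a ha.2]

theorem Peel.realize (hJ : IsArc J g m) {L : List U} {I : Set U} {E : Set (Sym2 U)}
    (h : Peel L I E) : ∀ F : U → ℝ × ℝ, GoodChain J g m (L.map F) →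
      ∃ F' : U → ℝ × ℝ, (∀ a ∉ I, F' a = F a) ∧ Realizes J g L I E F' := by
  induction h with
  | edge h => exact fun F hF => ⟨F, fun _ _ => rfl, Realizes.of_edge hF.toDippingChain⟩
  | @chord b v x A B L I₁ I₂ I E₁ E₂ E h₁ h₂ hA hd m₁ m₂ hL hI hE ih₁ ih₂ =>
    subst hL hI hE
    intro F hF
    have hW₁ : ∀ a, a ∈ v :: A ++ [x] ∨ a ∈ I₁ → a ∉ I₂ := by
      intro a ha ha₂
      refine h₂.nodup_disjoint.2 a ?_ ha₂
      rcases hd a ha (Or.inr ha₂) with rfl | rfl <;> simp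
    have hW₂ : ∀ a ∈ b :: v :: x :: B, a ∉ I₁ := by
      intro a ha ha₁
      refine h₁.nodup_disjoint.2 a ?_ ha₁
      rcases hd a (Or.inr ha₁) (Or.inl ha) with rfl | rfl <;> simp
    obtain ⟨F₁, hF₁, r₁⟩ := ih₁ F (hF.sublist (List.Sublist.map _ (by simp)))
    have e₂ : (b :: v :: x :: B).map F₁ = (b :: v :: x :: B).map F :=
      List.map_congr_left fun a ha => hF₁ a (hW₂ a ha)
    obtain ⟨F₂, hF₂, r₂⟩ := ih₂ F₁ (e₂ ▸ hF.sublist (List.Sublist.map _ (by simp)))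
    have hagree : ∀ a ∉ I₁ ∪ I₂, F₂ a = F a := fun a ha => by
      rw [mem_union, not_or] at ha
      rw [hF₂ a ha.2, hF₁ a ha.1]
    refine ⟨F₂, hagree, Realizes.of_chord h₁ h₂ hd m₁ m₂ ?_
      (r₁.congr h₁ fun a ha => (hF₂ a (hW₁ a ha)).symm) r₂⟩
    have hdisj := (Peel.chord h₁ h₂ hA hd m₁ m₂ rfl rfl rfl).nodup_disjoint.2
    rw [List.map_congr_left fun a ha => hagree a (hdisj a ha)]
    exact hF.toDippingChain
  | @corner b v x Z X L I I' E E' h hv hvI hL hI hE ih =>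
    have hPeel := Peel.corner h hv hvI hL hI hE
    subst hL hI hE
    intro F hF
    obtain ⟨Y, hYlen, hY, hvis, hbelow⟩ := hJ.exists_replacement
      (show GoodChain J g m (F b :: F v :: F x :: X.map F) from hF) Z.length
    obtain ⟨hn, hdis⟩ := h.nodup_disjoint
    obtain ⟨F₁, hF₁, hF₁'⟩ := List.exists_map_eq F (Z := Z) (Y := Y)
      (by simp [List.nodup_append] at hn; tauto) hYlen
    have hnZ : ∀ a ∈ b :: v :: x :: X, a ∉ Z := fun a ha haZ =>
      hPeel.nodup_disjoint.2 a ha (Or.inr haZ)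
    have hb : F₁ b = F b := hF₁' b (hnZ b (by simp))
    have hx : F₁ x = F x := hF₁' x (hnZ x (by simp))
    have hX : X.map F₁ = X.map F := List.map_congr_left fun a ha => hF₁' a (hnZ a (by simp [ha]))
    have elo : (b :: Z ++ x :: X).map F₁ = F b :: Y ++ F x :: X.map F := by
      simp [hb, hx, hX, hF₁]
    obtain ⟨F₂, hF₂, r⟩ := ih F₁ (elo ▸ hY)
    have hL₂ : ∀ a ∈ b :: Z ++ x :: X, F₂ a = F₁ a := fun a ha => hF₂ a (hdis a ha)
    have hb₂ : F₂ b = F b := (hL₂ b (by simp)).trans hb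
    have hx₂ : F₂ x = F x := (hL₂ x (by simp)).trans hx
    have hv₂ : F₂ v = F v := (hF₂ v hvI).trans (hF₁' v (hnZ v (by simp)))
    have hZ₂ : Z.map F₂ = Y := by
      rw [← hF₁]
      exact List.map_congr_left fun a ha => hL₂ a (by simp [ha])
    have hX₂ : X.map F₂ = X.map F := by
      rw [← hX]
      exact List.map_congr_left fun a ha => hL₂ a (by simp [ha])
    refine ⟨F₂, ?_, Realizes.of_corner hJ h hv hvI ?_ ?_ ?_ ?_ r⟩
    · intro a ha
      rw [mem_union, not_or] at ha
      rw [hF₂ a ha.1, hF₁' a ha.2]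
    · rw [List.map_congr_left hL₂, elo]
      exact hY
    · simpa [hb₂, hv₂, hx₂, hX₂] using hF
    · simpa [hb₂, hv₂, hx₂, hZ₂] using hvis
    · rw [hb₂, hv₂, hx₂, hZ₂]
      exact hbelow

end Realization

section SmoothConvexCurve

open Filter Topology

theorem exists_isArc {x y x' y' : ℝ → ℝ} (hx : ∀ t, HasDerivAt x (x' t) t)
    (hy : ∀ t, HasDerivAt y (y' t) t) (hx' : Continuous x') (hy' : Continuous y')
    (hconc : ∀ s t, x' t * (y s - y t) ≤ y' t * (x s - x t)) {t₀ : ℝ} (h₀ : 0 < x' t₀)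
    (hturn : ∃ᶠ t in 𝓝 t₀, x' t₀ * y' t ≠ y' t₀ * x' t) :
    ∃ J g m, IsArc J g m ∧ ∀ p ∈ J, ∃ t, x t = p ∧ y t = g p := by
  obtain ⟨l, u, ht₀, hN⟩ := mem_nhds_iff_exists_Ioo_subset.mp
    (hx'.continuousAt.preimage_mem_nhds (Ioi_mem_nhds h₀))
  set N := Ioo l u with hNdef
  have hxc : Continuous x := continuous_iff_continuousAt.mpr fun t => (hx t).continuousAt
  have hyc : Continuous y := continuous_iff_continuousAt.mpr fun t => (hy t).continuousAt
  have hmono : StrictMonoOn x N := by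
    refine strictMonoOn_of_deriv_pos (convex_Ioo _ _) hxc.continuousOn fun t ht => ?_
    rw [(hx t).deriv]
    exact hN (interior_subset ht)
  have hxs : ∀ t, HasStrictDerivAt x (x' t) t := fun t =>
    hasStrictDerivAt_of_hasDerivAt_of_continuousAt (Eventually.of_forall hx) hx'.continuousAt
  set i := Function.invFunOn x N
  have hi : ∀ p ∈ x '' N, i p ∈ N ∧ x (i p) = p := fun p hp =>
    ⟨Function.invFunOn_mem hp, Function.invFunOn_eq hp⟩
  have hi' : ∀ t ∈ N, i (x t) = t := fun t ht =>
    hmono.injOn (hi _ (mem_image_of_mem x ht)).1 ht (hi _ (mem_image_of_mem x ht)).2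
  have hJ : IsOpen (x '' N) := by
    rw [isOpen_iff_mem_nhds]
    rintro _ ⟨t, ht, rfl⟩
    rw [← (hxs t).map_nhds_eq (hN ht).ne']
    exact image_mem_map (isOpen_Ioo.mem_nhds ht)
  have himono : StrictMonoOn i (x '' N) := by
    rintro _ ⟨s, hs, rfl⟩ _ ⟨t, ht, rfl⟩ hst
    rw [hi' s hs, hi' t ht]
    exact (hmono.lt_iff_lt hs ht).mp hst
  have hic : ContinuousOn i (x '' N) := by
    intro p hp
    refine (himono.continuousAt_of_image_mem_nhds (hJ.mem_nhds hp) ?_).continuousWithinAt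
    have : i '' (x '' N) = N := by
      ext t
      constructor
      · rintro ⟨p, hp, rfl⟩
        exact (hi p hp).1
      · exact fun ht => ⟨x t, mem_image_of_mem x ht, hi' t ht⟩
    rw [this]
    exact isOpen_Ioo.mem_nhds (hi p hp).1
  refine ⟨x '' N, y ∘ i, fun p => y' (i p) / x' (i p), ⟨hJ, ?_, ?_, ?_, ?_, ?_⟩, ?_⟩
  · exact (isPreconnected_Ioo.image x hxc.continuousOn).ordConnected
  · exact hyc.comp_continuousOn hic
  · exact (hy'.comp_continuousOn hic).div (hx'.comp_continuousOn hic)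
      fun p hp => (hN (hi p hp).1).ne'
  · rintro _ ⟨t, ht, rfl⟩ _ ⟨s, hs, rfl⟩
    have hpos : 0 < x' t := hN ht
    simp only [Function.comp_apply, hi' t ht, hi' s hs]
    have := hconc s t
    rw [← sub_le_iff_le_add', div_mul_eq_mul_div, le_div_iff₀ hpos]
    linarith
  · obtain ⟨t, hne, ht⟩ := (hturn.and_eventually (isOpen_Ioo.mem_nhds ht₀)).exists
    have hpos : 0 < x' t := hN ht
    have hne' : y' t / x' t ≠ y' t₀ / x' t₀ := by
      rw [Ne, div_eq_div_iff hpos.ne' h₀.ne']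
      intro e
      exact hne (by linarith)
    rcases lt_or_gt_of_ne hne' with h | h
    · exact ⟨x t₀, mem_image_of_mem x ht₀, x t, mem_image_of_mem x ht,
        by simpa only [hi' t ht, hi' t₀ ht₀] using h⟩
    · exact ⟨x t, mem_image_of_mem x ht, x t₀, mem_image_of_mem x ht₀,
        by simpa only [hi' t ht, hi' t₀ ht₀] using h⟩
  · exact fun p hp => ⟨i p, (hi p hp).2, rfl⟩

/-- The determinant of two vectors of the plane. -/
def cross (u w : EuclideanSpace ℝ (Fin 2)) : ℝ := u 0 * w 1 - u 1 * w 0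

theorem continuous_cross {X : Type*} [TopologicalSpace X] {u w : X → EuclideanSpace ℝ (Fin 2)}
    (hu : Continuous u) (hw : Continuous w) : Continuous fun t => cross (u t) (w t) := by
  unfold cross; fun_prop

theorem cross_eq_zero_trans {u v w : EuclideanSpace ℝ (Fin 2)} (hv : v ≠ 0) (h₁ : cross u v = 0)
    (h₂ : cross v w = 0) : cross u w = 0 := by
  unfold cross at *
  have e0 : v 0 * (u 0 * w 1 - u 1 * w 0) = 0 := by linear_combination u 0 * h₂ + w 0 * h₁
  have e1 : v 1 * (u 0 * w 1 - u 1 * w 0) = 0 := by linear_combination u 1 * h₂ + w 1 * h₁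
  by_contra h
  refine hv ?_
  ext i
  fin_cases i
  · simpa [h] using e0
  · simpa [h] using e1

theorem sq_add_sq_ne_zero {u : EuclideanSpace ℝ (Fin 2)} (hu : u ≠ 0) : u 0 ^ 2 + u 1 ^ 2 ≠ 0 := by
  intro e
  refine hu ?_
  ext i
  fin_cases i
  · have : u 0 = 0 := by nlinarith [sq_nonneg (u 0), sq_nonneg (u 1)]
    simpa
  · have : u 1 = 0 := by nlinarith [sq_nonneg (u 0), sq_nonneg (u 1)]
    simpa

theorem collinear_of_cross_eq_zero {s : Set (EuclideanSpace ℝ (Fin 2))}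
    {u p : EuclideanSpace ℝ (Fin 2)} (hu : u ≠ 0) (h : ∀ q ∈ s, cross u (q - p) = 0) :
    Collinear ℝ s := by
  rw [collinear_iff_exists_forall_eq_smul_vadd]
  have hpos := sq_add_sq_ne_zero hu
  refine ⟨p, u, fun q hq => ⟨(u 0 * (q - p) 0 + u 1 * (q - p) 1) / (u 0 ^ 2 + u 1 ^ 2), ?_⟩⟩
  have hq := h q hq
  unfold cross at hq
  simp only [PiLp.sub_apply] at hq ⊢
  ext i
  fin_cases i
  · simp
    field_simp
    linear_combination - u 1 * hq
  · simp
    field_simp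
    linear_combination u 0 * hq

theorem interior_nonempty_of_not_collinear {K s : Set (EuclideanSpace ℝ (Fin 2))}
    (hK : Convex ℝ K) (hs : s ⊆ frontier K) (hsl : ¬ Collinear ℝ s) : (interior K).Nonempty := by
  rw [hK.interior_nonempty_iff_affineSpan_eq_top]
  by_contra hne
  refine hsl ?_
  have hsub : s ⊆ affineSpan ℝ K := hs.trans (frontier_subset_closure.trans
    (closure_minimal (subset_affineSpan ℝ K) (AffineSubspace.closed_of_finiteDimensional _)))
  have hne' : (affineSpan ℝ K).direction ≠ ⊤ := by
    intro e
    rcases s.eq_empty_or_nonempty with rfl | ⟨a, ha⟩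
    · exact hsl (collinear_empty ℝ _)
    · exact hne ((AffineSubspace.direction_eq_top_iff_of_nonempty ⟨a, hsub ha⟩).mp e)
  have hlt := Submodule.finrank_lt hne'
  rw [finrank_euclideanSpace_fin] at hlt
  rw [collinear_iff_finrank_le_one]
  have hle : vectorSpan ℝ s ≤ (affineSpan ℝ K).direction := by
    rw [← direction_affineSpan]
    exact AffineSubspace.direction_le (affineSpan_le.mpr hsub)
  have := Submodule.finrank_mono hle
  omega

theorem cross_eq_zero_of_forall {u : EuclideanSpace ℝ (Fin 2)} (hu : u ≠ 0)
    (φ : EuclideanSpace ℝ (Fin 2) →L[ℝ] ℝ) (h : φ u = 0) : ∃ c : ℝ, ∀ w, φ w = c * cross u w := by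
  have hφ : ∀ w,
      φ w = w 0 * φ (EuclideanSpace.single 0 1) + w 1 * φ (EuclideanSpace.single 1 1) := by
    intro w
    have : w = w 0 • EuclideanSpace.single (0 : Fin 2) (1 : ℝ) +
        w 1 • EuclideanSpace.single (1 : Fin 2) (1 : ℝ) := by
      ext i
      fin_cases i <;> simp
    conv_lhs => rw [this]
    simp
  have hpos : u 0 ^ 2 + u 1 ^ 2 ≠ 0 := sq_add_sq_ne_zero hu
  set f₀ := φ (EuclideanSpace.single 0 1)
  set f₁ := φ (EuclideanSpace.single 1 1)
  rw [hφ] at h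
  refine ⟨(u 0 * f₁ - u 1 * f₀) / (u 0 ^ 2 + u 1 ^ 2), fun w => ?_⟩
  rw [hφ, cross]
  field_simp
  linear_combination (u 0 * w 0 + u 1 * w 1) * h

/-- A smooth curve in the boundary of a convex set stays on one side of all its tangents. -/
theorem exists_sign_cross {K : Set (EuclideanSpace ℝ (Fin 2))} (hK : Convex ℝ K)
    {γ : ℝ → EuclideanSpace ℝ (Fin 2)} (hγ : ContDiff ℝ 1 γ) (hγ' : ∀ t, deriv γ t ≠ 0)
    (hγK : range γ ⊆ frontier K) (hγline : ¬ Collinear ℝ (range γ)) :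
    ∃ σ : ℝ, (σ = 1 ∨ σ = -1) ∧ ∀ s t, 0 ≤ σ * cross (deriv γ t) (γ s - γ t) := by
  have hint := interior_nonempty_of_not_collinear hK hγK hγline
  obtain ⟨k, hk⟩ := hint
  have hcont : Continuous (deriv γ) := hγ.continuous_deriv le_rfl
  have key : ∀ t, cross (deriv γ t) (k - γ t) ≠ 0 ∧
      ∀ s, 0 ≤ cross (deriv γ t) (k - γ t) * cross (deriv γ t) (γ s - γ t) := by
    intro t
    obtain ⟨φ, hφ⟩ := geometric_hahn_banach_open_point hK.interior isOpen_interior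
      (hγK (mem_range_self t)).2
    have hle : ∀ s, φ (γ s) ≤ φ (γ t) := by
      intro s
      have hs : γ s ∈ closure (interior K) := by
        rw [hK.closure_interior_eq_closure_of_nonempty_interior ⟨k, hk⟩]
        exact frontier_subset_closure (hγK (mem_range_self s))
      exact closure_minimal (fun a ha => (hφ a ha).le)
        (isClosed_le φ.continuous continuous_const) hs
    have hd : HasDerivAt (fun s => φ (γ s)) (φ (deriv γ t)) t :=
      φ.hasFDerivAt.comp_hasDerivAt t ((hγ.differentiable one_ne_zero) t).hasDerivAt
    have h0 : φ (deriv γ t) = 0 :=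
      IsLocalMax.hasDerivAt_eq_zero (Filter.Eventually.of_forall hle) hd
    obtain ⟨c, hc⟩ := cross_eq_zero_of_forall (hγ' t) φ h0
    have hkt : c * cross (deriv γ t) (k - γ t) < 0 := by
      rw [← hc, map_sub]; linarith [hφ k hk]
    refine ⟨fun e => by simp [e] at hkt, fun s => ?_⟩
    have hst : c * cross (deriv γ t) (γ s - γ t) ≤ 0 := by
      rw [← hc, map_sub]; linarith [hle s]
    have hc0 : 0 < c ^ 2 := by
      have : c ≠ 0 := by rintro rfl; simp at hkt
      positivity
    by_contra! hneg
    nlinarith [mul_nonneg_of_nonpos_of_nonpos hkt.le hst]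
  have hcc : Continuous fun t => cross (deriv γ t) (k - γ t) :=
    continuous_cross hcont (continuous_const.sub hγ.continuous)
  have hsign : (∀ t, 0 < cross (deriv γ t) (k - γ t)) ∨ ∀ t, cross (deriv γ t) (k - γ t) < 0 := by
    by_contra! h
    obtain ⟨⟨s, hs⟩, t, ht⟩ := h
    obtain ⟨r, hr⟩ := mem_range_of_exists_le_of_exists_ge hcc ⟨s, hs⟩ ⟨t, ht⟩
    exact (key r).1 hr
  rcases hsign with h | h
  · refine ⟨1, Or.inl rfl, fun s t => ?_⟩
    rw [one_mul]
    exact nonneg_of_mul_nonneg_right ((key t).2 s) (h t)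
  · refine ⟨-1, Or.inr rfl, fun s t => ?_⟩
    nlinarith [(key t).2 s, h t]

theorem exists_frequently_cross_ne_zero {γ : ℝ → EuclideanSpace ℝ (Fin 2)} (hγ : ContDiff ℝ 1 γ)
    (hγ' : ∀ t, deriv γ t ≠ 0) (hγline : ¬ Collinear ℝ (range γ)) :
    ∃ t₀, ∃ᶠ t in 𝓝 t₀, cross (deriv γ t₀) (deriv γ t) ≠ 0 := by
  by_contra! h
  have hcont : Continuous (deriv γ) := hγ.continuous_deriv le_rfl
  have hc : Continuous fun t => cross (deriv γ 0) (deriv γ t) :=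
    continuous_cross continuous_const hcont
  have hclopen : IsClopen {t | cross (deriv γ 0) (deriv γ t) = 0} := by
    refine ⟨isClosed_eq hc continuous_const, isOpen_iff_mem_nhds.mpr fun t₀ ht₀ => ?_⟩
    filter_upwards [h t₀] with t ht
    exact cross_eq_zero_trans (hγ' t₀) ht₀ ht
  have huniv := hclopen.eq_univ ⟨0, by simp only [cross, mem_ofPred_eq]; ring⟩
  refine hγline (collinear_of_cross_eq_zero (hγ' 0) (p := γ 0) ?_)
  have hcoord : ∀ i t, HasDerivAt (fun s => γ s i) (deriv γ t i) t := fun i t =>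
    (EuclideanSpace.proj (𝕜 := ℝ) i).hasFDerivAt.comp_hasDerivAt t
      ((hγ.differentiable one_ne_zero) t).hasDerivAt
  have hd : ∀ t, HasDerivAt (fun s => cross (deriv γ 0) (γ s - γ 0))
      (cross (deriv γ 0) (deriv γ t)) t := fun t => by
    unfold cross
    simp only [PiLp.sub_apply]
    exact (((hcoord 1 t).sub_const _).const_mul _).sub (((hcoord 0 t).sub_const _).const_mul _)
  rintro _ ⟨t, rfl⟩
  have := is_const_of_deriv_eq_zero (fun t => (hd t).differentiableAt) (fun t => by
    rw [(hd t).deriv]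
    exact (huniv ▸ mem_univ t : t ∈ {t | cross (deriv γ 0) (deriv γ t) = 0})) t 0
  rw [this]
  simp [cross]

theorem exists_isArc_of_curve {K : Set (EuclideanSpace ℝ (Fin 2))} (hK : Convex ℝ K)
    {γ : ℝ → EuclideanSpace ℝ (Fin 2)} (hγ : ContDiff ℝ 1 γ) (hγ' : ∀ t, deriv γ t ≠ 0)
    (hγK : range γ ⊆ frontier K) (hγline : ¬ Collinear ℝ (range γ)) :
    ∃ (T : (ℝ × ℝ) ≃L[ℝ] EuclideanSpace ℝ (Fin 2)) (J : Set ℝ) (g m : ℝ → ℝ),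
      IsArc J g m ∧ ∀ p ∈ J, T (p, g p) ∈ range γ := by
  obtain ⟨σ, hσ, hside⟩ := exists_sign_cross hK hγ hγ' hγK hγline
  obtain ⟨t₀, ht₀⟩ := exists_frequently_cross_ne_zero hγ hγ' hγline
  have hcont : Continuous (deriv γ) := hγ.continuous_deriv le_rfl
  have hcoord : ∀ i t, HasDerivAt (fun s => γ s i) (deriv γ t i) t := fun i t =>
    (EuclideanSpace.proj (𝕜 := ℝ) i).hasFDerivAt.comp_hasDerivAt t
      ((hγ.differentiable one_ne_zero) t).hasDerivAt
  have hσ2 : σ * σ = 1 := by rcases hσ with rfl | rfl <;> norm_num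
  set u := deriv γ t₀ with hu
  have hpos : 0 < u 0 ^ 2 + u 1 ^ 2 :=
    lt_of_le_of_ne (by positivity) (sq_add_sq_ne_zero (hγ' t₀)).symm
  obtain ⟨J, g, m, hJ, hg⟩ := exists_isArc
    (x := fun t => u 0 * γ t 0 + u 1 * γ t 1) (y := fun t => -σ * (u 0 * γ t 1 - u 1 * γ t 0))
    (x' := fun t => u 0 * deriv γ t 0 + u 1 * deriv γ t 1)
    (y' := fun t => -σ * (u 0 * deriv γ t 1 - u 1 * deriv γ t 0)) (t₀ := t₀)
    (fun t => ((hcoord 0 t).const_mul _).add ((hcoord 1 t).const_mul _))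
    (fun t => (((hcoord 1 t).const_mul _).sub ((hcoord 0 t).const_mul _)).const_mul _)
    (by fun_prop) (by fun_prop)
    (fun s t => by
      have := hside s t
      unfold cross at this
      simp only [PiLp.sub_apply] at this
      nlinarith [mul_nonneg hpos.le this])
    (by simp only [← hu]; nlinarith)
    (ht₀.mono fun t ht e => ht (by
      simp only [← hu] at e
      unfold cross
      have e' : σ * ((u 0 ^ 2 + u 1 ^ 2) * (u 0 * deriv γ t 1 - u 1 * deriv γ t 0)) = 0 := by
        linear_combination - e
      have hσ0 : σ ≠ 0 := by rintro rfl; simp at hσ2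
      simpa [hσ0, hpos.ne'] using e'))
  let S : EuclideanSpace ℝ (Fin 2) →ₗ[ℝ] ℝ × ℝ :=
    { toFun := fun w => (u 0 * w 0 + u 1 * w 1, -σ * (u 0 * w 1 - u 1 * w 0))
      map_add' := fun w w' => by
        ext
        · simp; ring
        · simp; ring
      map_smul' := fun c w => by
        ext
        · simp; ring
        · simp; ring }
  have hS : Function.Injective S := by
    rw [← LinearMap.ker_eq_bot, LinearMap.ker_eq_bot']
    intro w hw
    have e₁ : u 0 * w 0 + u 1 * w 1 = 0 := congrArg Prod.fst hw
    have e₂ : -σ * (u 0 * w 1 - u 1 * w 0) = 0 := congrArg Prod.snd hw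
    have e₃ : u 0 * w 1 - u 1 * w 0 = 0 := by
      linear_combination (-σ) * e₂ - (u 0 * w 1 - u 1 * w 0) * hσ2
    have e₄ : (u 0 ^ 2 + u 1 ^ 2) * w 0 = 0 := by linear_combination u 0 * e₁ - u 1 * e₃
    have e₅ : (u 0 ^ 2 + u 1 ^ 2) * w 1 = 0 := by linear_combination u 1 * e₁ + u 0 * e₃
    ext i
    fin_cases i
    · simpa [hpos.ne'] using e₄
    · simpa [hpos.ne'] using e₅
  let T := (LinearEquiv.ofInjectiveOfFinrankEq S hS (by simp)).toContinuousLinearEquiv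
  refine ⟨T.symm, J, g, m, hJ, fun p hp => ?_⟩
  obtain ⟨t, h1, h2⟩ := hg p hp
  refine ⟨t, ?_⟩
  rw [ContinuousLinearEquiv.eq_symm_apply]
  exact Prod.ext h1 h2

end SmoothConvexCurve

section Faces

variable {J : Set ℝ} {g m : ℝ → ℝ}

/-- Every point outside the region can be joined to the graph of `g` outside the region. -/
theorem IsArc.exists_isPreconnected_disjoint_region (hJ : IsArc J g m) {a c p : ℝ × ℝ}
    {Z : List (ℝ × ℝ)} (h : GoodChain J g m (a :: Z ++ [c])) (hp : p ∉ region (a :: Z ++ [c])) :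
    ∃ C, IsPreconnected C ∧ p ∈ C ∧ Disjoint C (region (a :: Z ++ [c])) ∧
      ∃ x ∈ J, (x, g x) ∈ C := by
  have haJ := h.good a (by simp)
  have hcJ := h.good c (by simp)
  have hac : a.1 < c.1 := by
    have := h.lt
    rw [List.cons_append, List.pairwise_cons] at this
    exact this.1 c (by simp)
  have hreg : ∀ q, q ∈ region (a :: Z ++ [c]) ↔ (a :: Z ++ [c]).IsChain
      (fun s t => orient s t q ≤ 0) ∧ a.1 ≤ q.1 ∧ q.1 ≤ c.1 ∧ 0 ≤ orient a c q := fun q =>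
    mem_region_cons (L := Z ++ [c]) (by simp [List.getLast?_cons])
  rw [hreg] at hp
  by_cases h1 : (a :: Z ++ [c]).IsChain fun s t => orient s t p ≤ 0
  · by_cases h2 : a.1 ≤ p.1
    · by_cases h3 : p.1 ≤ c.1
      · have h4 : orient a c p < 0 := by
          by_contra! h4
          exact hp ⟨h1, h2, h3, h4⟩
        refine ⟨_, (convex_setOf_orient_pos c a).isPreconnected, ?_, ?_, a.1, haJ.1.1, ?_⟩
        · rw [mem_ofPred_eq, orient_swap]; linarith
        · rw [Set.disjoint_left]
          intro q hq hq'
          rw [mem_ofPred_eq, orient_swap] at hq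
          linarith [((hreg q).mp hq').2.2.2]
        · have := mul_pos (sub_pos.mpr hac) (sub_pos.mpr haJ.2)
          simp only [mem_ofPred_eq, orient]
          nlinarith
      · obtain ⟨ε, hε, hball⟩ := Metric.isOpen_iff.mp hJ.isOpen c.1 hcJ.1.1
        refine ⟨{q | c.1 < q.1}, ((convex_Ioi c.1).linear_preimage
          (LinearMap.fst ℝ ℝ ℝ)).isPreconnected, not_le.mp h3, ?_, c.1 + ε / 2, hball ?_, ?_⟩
        · rw [Set.disjoint_left]
          exact fun q hq hq' => absurd ((hreg q).mp hq').2.2.1 (not_le.mpr hq)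
        · rw [Metric.mem_ball, Real.dist_eq, add_sub_cancel_left, abs_of_pos (by positivity)]
          linarith
        · simp only [mem_ofPred_eq]; linarith
    · obtain ⟨ε, hε, hball⟩ := Metric.isOpen_iff.mp hJ.isOpen a.1 haJ.1.1
      refine ⟨{q | q.1 < a.1}, ((convex_Iio a.1).linear_preimage
        (LinearMap.fst ℝ ℝ ℝ)).isPreconnected, not_le.mp h2, ?_, a.1 - ε / 2, hball ?_, ?_⟩
      · rw [Set.disjoint_left]
        exact fun q hq hq' => absurd ((hreg q).mp hq').2.1 (not_le.mpr hq)
      · rw [Metric.mem_ball, Real.dist_eq, abs_sub_comm, sub_sub_cancel,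
          abs_of_pos (by positivity)]
        linarith
      · simp only [mem_ofPred_eq]; linarith
  · rw [List.isChain_iff_forall_rel_of_append_cons_cons] at h1
    push Not at h1
    obtain ⟨s, t, P, Q, e, hst⟩ := h1
    have hd := h.dips
    have hs := h.good s (by rw [e]; simp)
    have ht := h.good t (by rw [e]; simp)
    rw [e] at hd
    have hd := (List.pairwise_append.mp hd).2.1
    rw [List.pairwise_cons] at hd
    obtain ⟨x, hx, hxo⟩ := hd.1 t (by simp)
    refine ⟨_, (convex_setOf_orient_pos s t).isPreconnected, hst, ?_, x,
      hJ.ordConnected.out hs.1.1 ht.1.1 ⟨hx.1.le, hx.2.le⟩, hxo⟩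
    rw [Set.disjoint_left]
    intro q hq hq'
    have := ((hreg q).mp hq').1
    rw [List.isChain_iff_forall_rel_of_append_cons_cons] at this
    exact absurd (this e) (not_le.mpr hq)

open MeasureTheory in
theorem volume_segment_eq_zero (p q : EuclideanSpace ℝ (Fin 2)) : volume (segment ℝ p q) = 0 := by
  have hne : affineSpan ℝ {p, q} ≠ ⊤ := by
    intro e
    have h1 := collinear_iff_finrank_le_one.mp (collinear_pair ℝ p q)
    rw [← direction_affineSpan, e, AffineSubspace.direction_top, finrank_top,
      finrank_euclideanSpace_fin] at h1
    omega
  refine measure_mono_null ?_ (Measure.addHaar_affineSubspace volume _ hne)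
  rw [← convexHull_pair (𝕜 := ℝ)]
  exact convexHull_subset_affineSpan _

theorem ContinuousLinearEquiv.segment_map {M N : Type*} [AddCommGroup M] [Module ℝ M]
    [TopologicalSpace M] [AddCommGroup N] [Module ℝ N] [TopologicalSpace N] (T : M ≃L[ℝ] N)
    (p q : M) : segment ℝ (T p) (T q) = T '' segment ℝ p q :=
  (image_segment ℝ T.toLinearEquiv.toLinearMap.toAffineMap p q).symm

theorem isClosed_drawingSet {V : Type*} [Finite V] (G : SimpleGraph V)
    (f : V → EuclideanSpace ℝ (Fin 2)) : IsClosed (drawingSet G f) := by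
  refine (finite_range f).isClosed.union (isClosed_iUnion_of_finite fun p =>
    isClosed_iUnion_of_finite fun _ => ?_)
  rw [← convexHull_pair (𝕜 := ℝ)]
  exact ((Set.toFinite _).isCompact_convexHull ℝ).isClosed

theorem Realizes.isPlanarDrawing {V : Type*} {G : SimpleGraph V} {U : Type*} {L : List U}
    {I : Set U} {E : Set (Sym2 U)} {F : U → ℝ × ℝ} (hP : Peel L I E) (h : Realizes J g L I E F)
    {ι : V → U} (hι : Function.Injective ι) (hW : ∀ w, ι w ∈ L ∨ ι w ∈ I)
    (hG : ∀ u v, G.Adj u v → s(ι u, ι v) ∈ E)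
    (T : (ℝ × ℝ) ≃L[ℝ] EuclideanSpace ℝ (Fin 2)) : IsPlanarDrawing G fun v => T (F (ι v)) := by
  refine ⟨fun u v e => hι (h.injOn (hW u) (hW v) (T.injective e)), ?_, ?_⟩
  · intro u v u' v' huv huv' hne
    have hne' : s(ι u, ι v) ≠ s(ι u', ι v') := by
      intro e
      rw [Sym2.eq_iff] at e
      rcases e with ⟨e₁, e₂⟩ | ⟨e₁, e₂⟩
      · exact hne (by rw [hι e₁, hι e₂])
      · exact hne (by rw [hι e₁, hι e₂, Set.pair_comm])
    have hend : ∀ {a u v}, G.Adj u v → F (ι a) ∈ segment ℝ (F (ι u)) (F (ι v)) →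
        a = u ∨ a = v := by
      intro a u v huv ha
      by_contra! hc
      exact h.notMem_segment _ _ _ (hG u v huv) (hW a) (fun e => hc.1 (hι e))
        (fun e => hc.2 (hι e)) ha
    simp only [ContinuousLinearEquiv.segment_map]
    rw [← Set.image_inter T.injective]
    rintro _ ⟨p, ⟨hp, hp'⟩, rfl⟩
    have hp₀ := hp
    have hp₀' := hp'
    rw [← insert_endpoints_openSegment] at hp hp'
    rcases hp with rfl | rfl | hp
    · exact ⟨u, ⟨by simp, hend huv' hp₀'⟩, rfl⟩
    · exact ⟨v, ⟨by simp, hend huv' hp₀'⟩, rfl⟩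
    rcases hp' with rfl | rfl | hp'
    · exact absurd hp (h.notMem_openSegment hP (hG u v huv) (hW u'))
    · exact absurd hp (h.notMem_openSegment hP (hG u v huv) (hW v'))
    · exact absurd hp' (Set.disjoint_left.mp
        (h.disjoint _ _ _ _ (hG u v huv) (hG u' v' huv') hne') hp)
  · intro u v w huv hwu hwv hmem
    rw [ContinuousLinearEquiv.segment_map, T.injective.mem_set_image] at hmem
    exact h.notMem_segment _ _ _ (hG u v huv) (hW w) (fun e => hwu (hι e))
      (fun e => hwv (hι e)) hmem

open MeasureTheory in
theorem volume_image_drawn_eq_zero {U : Type*} [Countable U] (F : U → ℝ × ℝ) (W : Set U)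
    (E : Set (Sym2 U)) (T : (ℝ × ℝ) ≃L[ℝ] EuclideanSpace ℝ (Fin 2)) :
    volume (T '' drawn F W E) = 0 := by
  have hsub : T '' drawn F W E ⊆
      range (fun u => T (F u)) ∪ ⋃ p : U × U, segment ℝ (T (F p.1)) (T (F p.2)) := by
    rintro _ ⟨q, ⟨a, -, rfl⟩ | ⟨u, v, -, hq⟩, rfl⟩
    · exact Or.inl ⟨a, rfl⟩
    · refine Or.inr (mem_iUnion.mpr ⟨(u, v), ?_⟩)
      rw [ContinuousLinearEquiv.segment_map]
      exact ⟨q, hq, rfl⟩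
  refine measure_mono_null hsub (measure_union_null ((countable_range _).measure_zero volume) ?_)
  exact measure_iUnion_null fun p => volume_segment_eq_zero _ _

end Faces

/-- Every planar graph has a straight-line drawing in which every face
(connected component of the complement of the drawing) is crossed by a given
smooth convex curve not lying on a line. -/
theorem every_face_crossed {V : Type*} [Fintype V] (G : SimpleGraph V)
    (hG : ∃ f : V → EuclideanSpace ℝ (Fin 2), IsPlanarDrawing G f)
    (K : Set (EuclideanSpace ℝ (Fin 2))) (hK : Convex ℝ K)
    (γ : ℝ → EuclideanSpace ℝ (Fin 2)) (hγ : ContDiff ℝ 1 γ)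
    (hγ' : ∀ t, deriv γ t ≠ 0)
    (hγK : Set.range γ ⊆ frontier K)
    (hγline : ¬ Collinear ℝ (Set.range γ)) :
    ∃ f : V → EuclideanSpace ℝ (Fin 2), IsPlanarDrawing G f ∧
      ∀ x ∉ drawingSet G f,
        (connectedComponentIn (drawingSet G f)ᶜ x ∩ Set.range γ).Nonempty := by
  obtain ⟨f₀, hf₀⟩ := hG
  obtain ⟨ε, hε⟩ := exists_injective_shear hf₀.1
  obtain ⟨n, M, I, E, hD, hM, hadj⟩ := exists_disc hε (hf₀.nonCrossing ε)
  have hP := hD.peel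
  obtain ⟨T, J, g, m, hJ, hT⟩ := exists_isArc_of_curve hK hγ hγ' hγK hγline
  obtain ⟨b, c, Z, hZ, hchain⟩ := hJ.exists_goodChain M.length
  obtain ⟨F₀, hF₀, -⟩ := List.exists_map_eq (fun _ => b) hP.nodup_disjoint.1
    (Y := b :: Z ++ [c]) (by simp [hZ])
  obtain ⟨F, hFI, hF⟩ := hP.realize hJ F₀ (hF₀ ▸ hchain)
  have hmap : (Sum.inr 0 :: M.map Sum.inl ++ [Sum.inr 1]).map F = b :: Z ++ [c] := by
    rw [← hF₀]
    exact List.map_congr_left fun a ha => hFI a (hP.nodup_disjoint.2 a ha)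
  have hW : ∀ w : V, Sum.inl w ∈ (Sum.inr 0 :: M.map Sum.inl ++ [Sum.inr 1] : List (V ⊕ ℕ)) ∨
      Sum.inl w ∈ I := fun w => (hM w).imp_left fun hw => by simp [hw]
  refine ⟨fun v => T (F (Sum.inl v)), hF.isPlanarDrawing hP Sum.inl_injective hW hadj T,
    fun x hx => ?_⟩
  set D := drawn F {a | a ∈ Sum.inr 0 :: M.map Sum.inl ++ [Sum.inr 1] ∨ a ∈ I} E with hDdef
  set f := fun v => T (F (Sum.inl v))
  have hsub : drawingSet G f ⊆ T '' D := by
    rintro _ (⟨w, rfl⟩ | hp)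
    · exact mem_image_of_mem T (Or.inl ⟨_, hW w, rfl⟩)
    · simp only [mem_iUnion] at hp
      obtain ⟨⟨u, v⟩, huv, hp⟩ := hp
      rw [ContinuousLinearEquiv.segment_map] at hp
      obtain ⟨q, hq, rfl⟩ := hp
      exact mem_image_of_mem T (Or.inr ⟨_, _, hadj u v huv, hq⟩)
  have hopen : IsOpen (connectedComponentIn (drawingSet G f)ᶜ x) :=
    (isClosed_drawingSet G f).isOpen_compl.connectedComponentIn
  obtain ⟨x', hx', hx'D⟩ : ∃ x' ∈ connectedComponentIn (drawingSet G f)ᶜ x, x' ∉ T '' D := by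
    by_contra! hc
    refine (hopen.measure_pos MeasureTheory.volume
      ⟨x, mem_connectedComponentIn (show x ∈ (drawingSet G f)ᶜ from hx)⟩).ne' ?_
    exact MeasureTheory.measure_mono_null hc (volume_image_drawn_eq_zero F _ E T)
  obtain ⟨p, rfl⟩ := T.surjective x'
  rw [T.injective.mem_set_image] at hx'D
  obtain ⟨C, hC, hpC, hCD, y, hy, hyC⟩ : ∃ C, IsPreconnected C ∧ p ∈ C ∧ Disjoint C D ∧
      ∃ y ∈ J, (y, g y) ∈ C := by
    by_cases hp : p ∈ region ((Sum.inr 0 :: M.map Sum.inl ++ [Sum.inr 1]).map F)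
    · obtain ⟨C, -, h⟩ := hF.face p hp hx'D
      exact ⟨C, h⟩
    · have hdr := hF.drawn_subset hP
      rw [hmap] at hp hdr
      obtain ⟨C, h1, h2, h3, h4⟩ := hJ.exists_isPreconnected_disjoint_region hchain hp
      exact ⟨C, h1, h2, h3.mono_right hdr, h4⟩
  have hCsub : T '' C ⊆ (drawingSet G f)ᶜ := by
    rintro _ ⟨q, hq, rfl⟩ hqd
    obtain ⟨q', hq', e⟩ := hsub hqd
    exact Set.disjoint_left.mp hCD hq (T.injective e ▸ hq')
  rw [connectedComponentIn_eq hx']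
  exact ⟨T (y, g y), (hC.image T T.continuous.continuousOn).subset_connectedComponentIn
    (mem_image_of_mem T hpC) hCsub (mem_image_of_mem T hyC), hT y hy⟩
end

section
/- Let K ⊆ ℝ² be a convex set and let γ : ℝ → ℝ² be continuously differentiable with deriv γ t ≠ 0 for every t, with Set.range γ contained in the frontier of K and with Set.range γ not collinear (¬Collinear ℝ (Set.range γ)). Then for every natural number n there exist points p : Fin n → ℝ² with p injective, p i ∈ Set.range γ for every i, and such that no three of the points are collinear: for all pairwise distinct i, j, k, ¬Collinear ℝ {p i, p j, p k}. (In words: every smooth convex curve not on a single line contains arbitrarily many points in general position.) -/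
open Set

/-- The linear functional `v ↦ d 0 * v 1 - d 1 * v 0` on the plane. -/
noncomputable def planeCross (d : EuclideanSpace ℝ (Fin 2)) :
    EuclideanSpace ℝ (Fin 2) →L[ℝ] ℝ :=
  d 0 • EuclideanSpace.proj 1 - d 1 • EuclideanSpace.proj 0

theorem planeCross_apply (d v : EuclideanSpace ℝ (Fin 2)) :
    planeCross d v = d 0 * v 1 - d 1 * v 0 := by
  simp [planeCross]

theorem exists_eq_smul_of_planeCross_eq_zero {d v : EuclideanSpace ℝ (Fin 2)} (hd : d ≠ 0)
    (h : planeCross d v = 0) : ∃ r : ℝ, v = r • d := by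
  rw [planeCross_apply] at h
  by_cases h0 : d 0 = 0
  · have h1 : d 1 ≠ 0 := by
      intro h1
      apply hd
      ext i
      fin_cases i <;> simp [h0, h1]
    refine ⟨v 1 / d 1, ?_⟩
    have : v 0 = 0 := by simpa [h0, h1] using h
    ext i
    fin_cases i <;> simp [h0, h1, this]
  · refine ⟨v 0 / d 0, ?_⟩
    ext i
    fin_cases i
    · simp [h0]
    · simp
      field_simp
      linarith

theorem planeCross_smul_self (d : EuclideanSpace ℝ (Fin 2)) (r : ℝ) :
    planeCross d (r • d) = 0 := by
  simp only [planeCross_apply, PiLp.smul_apply, smul_eq_mul]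
  ring

theorem planeCross_eq_zero_comm {d v : EuclideanSpace ℝ (Fin 2)} :
    planeCross d v = 0 ↔ planeCross v d = 0 := by
  simp only [planeCross_apply]
  constructor <;> intro h <;> linarith

theorem Collinear.planeCross_eq_zero {a b c : EuclideanSpace ℝ (Fin 2)}
    (h : Collinear ℝ {a, b, c}) : planeCross (b - a) (c - a) = 0 := by
  obtain ⟨v, hv⟩ := (collinear_iff_of_mem (p₀ := a) (by simp)).1 h
  obtain ⟨r, rfl⟩ := hv b (by simp)
  obtain ⟨s, rfl⟩ := hv c (by simp)
  simp only [planeCross_apply, vadd_eq_add, add_sub_cancel_right, PiLp.smul_apply, smul_eq_mul]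
  ring

/-- A regular `C¹` plane curve not lying on a line is not covered by finitely many lines. -/
theorem exists_forall_planeCross_ne_zero {γ : ℝ → EuclideanSpace ℝ (Fin 2)}
    (hγ : ContDiff ℝ 1 γ) (hγ' : ∀ t, deriv γ t ≠ 0) (hγline : ¬ Collinear ℝ (range γ))
    {ι : Type*} [Finite ι] (p d : ι → EuclideanSpace ℝ (Fin 2)) (hd : ∀ i, d i ≠ 0) :
    ∃ t, ∀ i, planeCross (d i) (γ t - p i) ≠ 0 := by
  by_contra! hcov
  have hγc : Continuous γ := hγ.continuous
  have hγ'c : Continuous (deriv γ) := hγ.continuous_deriv le_rfl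
  have hder (w q : EuclideanSpace ℝ (Fin 2)) (t : ℝ) :
      HasDerivAt (fun t ↦ planeCross w (γ t - q)) (planeCross w (deriv γ t)) t :=
    (planeCross w).hasFDerivAt.comp_hasDerivAt t
      (((hγ.differentiable one_ne_zero t).hasDerivAt).sub_const q)
  have hclosed (w : EuclideanSpace ℝ (Fin 2)) : IsClosed {t | planeCross w (deriv γ t) = 0} :=
    isClosed_eq ((planeCross w).continuous.comp hγ'c) continuous_const
  have hdense : Dense (⋃ i, interior {t | planeCross (d i) (γ t - p i) = 0}) := by
    apply dense_iUnion_interior_of_closed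
    · exact fun i ↦ isClosed_eq ((planeCross _).continuous.comp (hγc.sub continuous_const))
        continuous_const
    · exact eq_univ_of_forall fun t ↦ mem_iUnion.2 (hcov t)
  have hdir : ∀ t, ∃ i, planeCross (d i) (deriv γ t) = 0 := by
    have hsub : (⋃ i, interior {t | planeCross (d i) (γ t - p i) = 0}) ⊆
        ⋃ i, {t | planeCross (d i) (deriv γ t) = 0} := by
      refine iUnion_mono fun i t ht ↦ ?_
      have hev : (fun t ↦ planeCross (d i) (γ t - p i)) =ᶠ[nhds t] fun _ ↦ 0 :=
        mem_interior_iff_mem_nhds.1 ht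
      exact ((hder (d i) (p i) t).congr_of_eventuallyEq hev.symm).unique (hasDerivAt_const t 0)
    intro t
    have ht := closure_minimal hsub (isClosed_iUnion_of_finite fun i ↦ hclosed (d i)) (hdense t)
    simpa using ht
  have hcompl : {t | planeCross (deriv γ 0) (deriv γ t) = 0}ᶜ =
      ⋃ i : {i // planeCross (d i) (deriv γ 0) ≠ 0}, {t | planeCross (d i) (deriv γ t) = 0} := by
    ext t
    simp only [mem_compl_iff, mem_ofPred_eq, mem_iUnion]
    constructor
    · intro h
      obtain ⟨i, hi⟩ := hdir t
      refine ⟨⟨i, fun h0 ↦ h ?_⟩, hi⟩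
      obtain ⟨r, hr⟩ := exists_eq_smul_of_planeCross_eq_zero (hd i) hi
      rw [hr, map_smul, planeCross_eq_zero_comm.1 h0, smul_zero]
    · rintro ⟨⟨i, hi⟩, hit⟩ h
      obtain ⟨r, hr⟩ :=
        exists_eq_smul_of_planeCross_eq_zero (hγ' t) (planeCross_eq_zero_comm.1 h)
      exact hi (by rw [hr, map_smul, hit, smul_zero])
  have hclopen : IsClopen {t | planeCross (deriv γ 0) (deriv γ t) = 0} :=
    ⟨hclosed _, isClosed_compl_iff.1 (hcompl ▸ isClosed_iUnion_of_finite fun i ↦ hclosed _)⟩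
  have huniv := hclopen.eq_univ ⟨0, by simpa using planeCross_smul_self (deriv γ 0) 1⟩
  refine hγline ((collinear_iff_of_mem (mem_range_self 0)).2 ⟨deriv γ 0, ?_⟩)
  rintro _ ⟨t, rfl⟩
  have hconst := is_const_of_deriv_eq_zero
    (fun t ↦ (hder (deriv γ 0) (γ 0) t).differentiableAt)
    (fun t ↦ (hder (deriv γ 0) (γ 0) t).deriv.trans (eq_univ_iff_forall.1 huniv t)) t 0
  obtain ⟨r, hr⟩ := exists_eq_smul_of_planeCross_eq_zero (hγ' 0)
    (hconst.trans (by simp))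
  exact ⟨r, by rw [← hr]; simp⟩

/-- A regular `C¹` plane curve not lying on a line contains arbitrarily large finite sets in
general position. -/
theorem exists_finset_subset_range_general_position {γ : ℝ → EuclideanSpace ℝ (Fin 2)}
    (hγ : ContDiff ℝ 1 γ) (hγ' : ∀ t, deriv γ t ≠ 0) (hγline : ¬ Collinear ℝ (range γ)) (n : ℕ) :
    ∃ s : Finset (EuclideanSpace ℝ (Fin 2)), s.card = n ∧ ↑s ⊆ range γ ∧
      ∀ a ∈ s, ∀ b ∈ s, ∀ c ∈ s, a ≠ b → b ≠ c → a ≠ c → planeCross (b - a) (c - a) ≠ 0 := by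
  classical
  induction n with
  | zero => exact ⟨∅, by simp⟩
  | succ n ih =>
    obtain ⟨s, hcard, hs, hgen⟩ := ih
    obtain ⟨t, ht⟩ := exists_forall_planeCross_ne_zero hγ hγ' hγline
      (fun l : s × s ↦ (l.1 : EuclideanSpace ℝ (Fin 2)))
      (fun l ↦ if (l.1 : EuclideanSpace ℝ (Fin 2)) = l.2 then deriv γ 0 else l.2 - l.1)
      (fun l ↦ by
        split_ifs with h
        · exact hγ' 0
        · exact sub_ne_zero.2 (Ne.symm h))
    have hline : ∀ a ∈ s, ∀ b ∈ s, a ≠ b → planeCross (b - a) (γ t - a) ≠ 0 :=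
      fun a ha b hb hab ↦ by simpa [hab] using ht (⟨a, ha⟩, ⟨b, hb⟩)
    have hmem : γ t ∉ s := fun h ↦ ht (⟨γ t, h⟩, ⟨γ t, h⟩) (by simp)
    refine ⟨insert (γ t) s, by simp [hmem, hcard], ?_, ?_⟩
    · rw [Finset.coe_insert]
      exact insert_subset (mem_range_self t) hs
    · intro a ha b hb c hc hab hbc hac
      rcases Finset.mem_insert.1 ha with rfl | ha
      · have hb := (Finset.mem_insert.1 hb).resolve_left hab.symm
        have hc := (Finset.mem_insert.1 hc).resolve_left hac.symm
        refine fun h ↦ hline b hb c hc hbc ?_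
        simp only [planeCross_apply, PiLp.sub_apply] at h ⊢
        linarith
      rcases Finset.mem_insert.1 hb with rfl | hb
      · have hc := (Finset.mem_insert.1 hc).resolve_left hbc.symm
        exact fun h ↦ hline a ha c hc hac (planeCross_eq_zero_comm.1 h)
      rcases Finset.mem_insert.1 hc with rfl | hc
      · exact hline a ha b hb hab
      · exact hgen a ha b hb c hc hab hbc hac

/-- Every smooth convex curve not lying on a line contains arbitrarily many
points in general position: for each `n` there are `n` distinct points on the
curve, no three of which are collinear. -/
theorem smooth_convex_curve_points_in_general_position
    (K : Set (EuclideanSpace ℝ (Fin 2))) (hK : Convex ℝ K)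
    (γ : ℝ → EuclideanSpace ℝ (Fin 2)) (hγ : ContDiff ℝ 1 γ)
    (hγ' : ∀ t, deriv γ t ≠ 0)
    (hγK : Set.range γ ⊆ frontier K)
    (hγline : ¬ Collinear ℝ (Set.range γ)) :
    ∀ n : ℕ, ∃ p : Fin n → EuclideanSpace ℝ (Fin 2),
      Function.Injective p ∧ (∀ i, p i ∈ Set.range γ) ∧
      ∀ i j k, i ≠ j → j ≠ k → i ≠ k →
        ¬ Collinear ℝ ({p i, p j, p k} : Set (EuclideanSpace ℝ (Fin 2))) := by
  intro n
  obtain ⟨s, hcard, hs, hgen⟩ := exists_finset_subset_range_general_position hγ hγ' hγline n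
  let e := s.equivFinOfCardEq hcard
  have hinj : Function.Injective fun i ↦ (e.symm i : EuclideanSpace ℝ (Fin 2)) :=
    Subtype.val_injective.comp e.symm.injective
  refine ⟨fun i ↦ e.symm i, hinj, fun i ↦ hs (e.symm i).2, fun i j k hij hjk hik h ↦ ?_⟩
  exact hgen _ (e.symm i).2 _ (e.symm j).2 _ (e.symm k).2 (hinj.ne hij) (hinj.ne hjk)
    (hinj.ne hik) h.planeCross_eq_zero
end
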